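/- Let G be the non quasi-split unramified unitary group in four variables over F_0 and let n be a positive integer with gcd(n, 3) = 1. Let [Λ_4, 2n, n, β] and [Λ_5, 2n, n, γ] be fundamental skew strata. Then there is no irreducible smooth representation of G which contains both of them. -/

import Mathlib

/-!
Common framework for formalizing statements from
"Representations of non quasi-split U(4) over a p-adic field I" (M. Miyauchi).

We model the non-archimedean local field `F` with its (possibly trivial) Galois
involution, ring of integers `O`, uniformizer `ϖ`, a finite-dimensional hermitian
space `(V, h)` over `F`, the adjoint involution `σA` on `A = End_F V`, the unitary
group `G = {g ∈ A^× | g σ(g) = 1}` (as a subgroup of `Aˣ`), self-dual lattice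
sequences, the filtrations `a_n(Λ)`, the congruence subsets `P_n(Λ)`, skew
(semisimple) strata, characters attached to strata, smooth representations, and
Hecke algebras.
-/

noncomputable section
open scoped Classical Pointwise

universe u v w

/-- The ambient data: a field `F` with involution `conj` (Galois involution of
`F/F₀`), ring of integers `O` (a valuation subring with uniformizer `ϖ` and finite
residue field), a hermitian space `(V, h)` and the adjoint involution `σA` on
`End_F V` induced by `h`. -/
structure USetting (F : Type u) [Field F] (V : Type v) [AddCommGroup V] [Module F V] where
  /-- the Galois involution `x ↦ x̄` on `F` -/
  conj : F ≃+* F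
  conj_invol : ∀ x : F, conj (conj x) = x
  /-- the ring of integers `o_F` -/
  O : Subring F
  /-- a uniformizer `ϖ_F` -/
  ϖ : F
  ϖ_mem : ϖ ∈ O
  ϖ_ne_zero : ϖ ≠ 0
  ϖ_not_unit : ∀ y ∈ O, ϖ * y ≠ 1
  conj_O : ∀ x ∈ O, conj x ∈ O
  /-- `O` is a valuation ring of `F` -/
  O_val : ∀ x : F, x ≠ 0 → x ∈ O ∨ x⁻¹ ∈ O
  /-- every nonunit of `O` is divisible by `ϖ`: the maximal ideal is `ϖO` -/
  unif : ∀ x ∈ O, (∀ y ∈ O, x * y ≠ 1) → ∃ z ∈ O, x = ϖ * z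
  /-- the residue field `o_F/p_F` is finite -/
  res_fin : Finite (O ⧸ (Ideal.span {(⟨ϖ, ϖ_mem⟩ : O)} : Ideal O))
  /-- the hermitian form `h` on `V` -/
  h : V → V → F
  h_add_left : ∀ u v w : V, h (u + v) w = h u w + h v w
  h_smul_left : ∀ (c : F) (u w : V), h (c • u) w = conj c * h u w
  h_conj_symm : ∀ u w : V, h w u = conj (h u w)
  h_nondeg : ∀ u : V, (∀ w : V, h u w = 0) → u = 0
  /-- the involution on `A = End_F V` induced by `h` -/
  σA : Module.End F V → Module.End F V
  σA_adj : ∀ (X : Module.End F V) (u w : V), h (X u) w = h u (σA X w)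
  σA_one : σA 1 = 1
  σA_mul : ∀ X Y, σA (X * Y) = σA Y * σA X
  σA_add : ∀ X Y, σA (X + Y) = σA X + σA Y
  σA_invol : ∀ X, σA (σA X) = X

namespace USetting

variable {F : Type u} [Field F] {V : Type v} [AddCommGroup V] [Module F V]
variable (S : USetting F V)

/-- the maximal ideal `p_F = ϖ o_F` of `o_F`, as a subset of `F` -/
def pF : Set F := {y : F | ∃ z ∈ S.O, y = S.ϖ * z}

/-- the residue characteristic of `F` -/
def residueChar : ℕ :=
  ringChar (S.O ⧸ (Ideal.span {(⟨S.ϖ, S.ϖ_mem⟩ : S.O)} : Ideal S.O))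

/-- An `o_F`-lattice sequence in `V`: a decreasing `ℤ`-indexed family of
`o_F`-submodules of `V`, periodic with (minimal) period `e` under multiplication
by `ϖ`. -/
structure LatSeq where
  L : ℤ → Set V
  zero_mem : ∀ i, (0 : V) ∈ L i
  add_mem : ∀ i, ∀ v w : V, v ∈ L i → w ∈ L i → v + w ∈ L i
  smul_mem : ∀ i, ∀ c ∈ S.O, ∀ v ∈ L i, c • v ∈ L i
  dec : ∀ i, L (i + 1) ⊆ L i
  e : ℤ
  e_pos : 0 < e
  periodic : ∀ i, L (i + e) = S.ϖ • L i
  e_min : ∀ e' : ℤ, 0 < e' → (∀ i, L (i + e') = S.ϖ • L i) → e ≤ e'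

/-- each member of the sequence is a full `o_F`-lattice in `V`
(finitely generated over `o_F` and spanning `V` over `F`) -/
def IsFull (Λ : S.LatSeq) : Prop :=
  ∀ i : ℤ, Submodule.span F (Λ.L i) = ⊤ ∧
    ∃ s : Finset V, ↑s ⊆ Λ.L i ∧
      ∀ v ∈ Λ.L i, ∃ c : V → F, (∀ w ∈ s, c w ∈ S.O) ∧ v = ∑ w ∈ s, c w • w

/-- the filtration `a_n(Λ)` of `A = End_F V` -/
def aFil (Λ : S.LatSeq) (n : ℤ) : Set (Module.End F V) :=
  {X : Module.End F V | ∀ i : ℤ, ∀ v ∈ Λ.L i, X v ∈ Λ.L (i + n)}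

/-- `A_- = {X ∈ A | X + σ(X) = 0}` -/
def Aminus : Set (Module.End F V) := {X | S.σA X = -X}

/-- the dual lattice `L^# = {v | h(v, L) ⊆ o_F}` -/
def dualLat (L : Set V) : Set V := {v : V | ∀ w ∈ L, S.h v w ∈ S.O}

/-- `Λ` is self-dual with duality invariant `d`: `Λ(i)^# = Λ(d - i)` -/
def selfDualWith (Λ : S.LatSeq) (d : ℤ) : Prop :=
  ∀ i : ℤ, S.dualLat (Λ.L i) = Λ.L (d - i)

def isSelfDual (Λ : S.LatSeq) : Prop := ∃ d : ℤ, S.selfDualWith Λ d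

/-- the unitary group `G = {g ∈ A^× | g σ(g) = 1}` as a subgroup of `Aˣ` -/
def GU : Subgroup (Module.End F V)ˣ where
  carrier := {u : (Module.End F V)ˣ |
    S.σA (u : Module.End F V) = ((u⁻¹ : (Module.End F V)ˣ) : Module.End F V)}
  one_mem' := by simpa using S.σA_one
  mul_mem' := by
    intro a b ha hb
    simp only [Set.mem_setOf_eq] at *
    rw [Units.val_mul, S.σA_mul, ha, hb, mul_inv_rev, Units.val_mul]
  inv_mem' := by
    intro a ha
    simp only [Set.mem_setOf_eq] at *
    rw [← ha, S.σA_invol, inv_inv]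

/-- the underlying endomorphism of an element of `G` -/
def toE (g : S.GU) : Module.End F V := ((g : (Module.End F V)ˣ) : Module.End F V)

/-- `P_k(Λ) = G ∩ (1 + a_k(Λ))` (for `k ≥ 1`) -/
def Pset (Λ : S.LatSeq) (k : ℤ) : Set S.GU := {g : S.GU | S.toE g - 1 ∈ S.aFil Λ k}

/-- `P_0(Λ) = G ∩ a_0(Λ)` -/
def P0set (Λ : S.LatSeq) : Set S.GU := {g : S.GU | S.toE g ∈ S.aFil Λ 0}

/-- `B`, the `A`-centralizer of `β` -/
def Bcent (β : Module.End F V) : Set (Module.End F V) := {X | X * β = β * X}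

/-- `B^⊥`, the orthogonal complement of `B` in `A` w.r.t. the pairing `(x,y) ↦ tr_{A/F}(xy)` -/
def Bperp (β : Module.End F V) : Set (Module.End F V) :=
  {X | ∀ Y ∈ Bcent β, LinearMap.trace F V (X * Y) = 0}

/-- sum of two subsets of `A` -/
def setAdd (s t : Set (Module.End F V)) : Set (Module.End F V) :=
  {z | ∃ x ∈ s, ∃ y ∈ t, z = x + y}

/-- `𝔍 = a'_n ⊕ a^⊥_{[(n+1)/2]}` -/
def frakJ (Λ : S.LatSeq) (n : ℤ) (β : Module.End F V) : Set (Module.End F V) :=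
  setAdd (S.aFil Λ n ∩ Bcent β) (S.aFil Λ ((n + 1) / 2) ∩ Bperp β)

/-- `𝔍₊ = a'_n ⊕ a^⊥_{[n/2]+1}` -/
def frakJplus (Λ : S.LatSeq) (n : ℤ) (β : Module.End F V) : Set (Module.End F V) :=
  setAdd (S.aFil Λ n ∩ Bcent β) (S.aFil Λ (n / 2 + 1) ∩ Bperp β)

/-- `J = (1 + 𝔍) ∩ G` -/
def Jset (Λ : S.LatSeq) (n : ℤ) (β : Module.End F V) : Set S.GU :=
  {g : S.GU | S.toE g - 1 ∈ S.frakJ Λ n β}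

/-- `J₊ = (1 + 𝔍₊) ∩ G` -/
def Jplusset (Λ : S.LatSeq) (n : ℤ) (β : Module.End F V) : Set S.GU :=
  {g : S.GU | S.toE g - 1 ∈ S.frakJplus Λ n β}

/-- `G_E = G ∩ B`, the `G`-centralizer of `β` -/
def GEset (β : Module.End F V) : Set S.GU := {g : S.GU | S.toE g ∈ Bcent β}

/-- the set `J G_E J` -/
def JGEJ (Λ : S.LatSeq) (n : ℤ) (β : Module.End F V) : Set S.GU :=
  {a : S.GU | ∃ j₁ ∈ S.Jset Λ n β, ∃ c ∈ S.GEset β, ∃ j₂ ∈ S.Jset Λ n β, a = j₁ * c * j₂}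

/-- `ν_Λ(X) = k`, i.e. `X ∈ a_k(Λ) \ a_{k+1}(Λ)` -/
def HasVal (Λ : S.LatSeq) (X : Module.End F V) (k : ℤ) : Prop :=
  X ∈ S.aFil Λ k ∧ X ∉ S.aFil Λ (k + 1)

/-- `y_β = ϖ^{n/k} β^{e/k}` where `k = gcd(e(Λ), n)` -/
def ybeta (Λ : S.LatSeq) (n : ℤ) (β : Module.End F V) : Module.End F V :=
  S.ϖ ^ ((n / (Int.gcd Λ.e n : ℤ)).toNat) • β ^ ((Λ.e / (Int.gcd Λ.e n : ℤ)).toNat)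

/-- two polynomials over `F` with integral coefficients are coprime modulo `p_F` -/
def CoprimeModP (f g : Polynomial F) : Prop :=
  ∃ u v : Polynomial F, (∀ i, u.coeff i ∈ S.O) ∧ (∀ i, v.coeff i ∈ S.O) ∧
    ∀ i, (u * f + v * g - 1).coeff i ∈ S.pF

/-- the filtration `a_m(Λ ∩ U)` on `End_F(U)` cut out by a subspace `U ⊆ V` -/
def aFilOn (Λ : S.LatSeq) (U : Submodule F V) (m : ℤ) : Set (Module.End F U) :=
  {X : Module.End F U | ∀ i : ℤ, ∀ v : U, (v : V) ∈ Λ.L i → ((X v : U) : V) ∈ Λ.L (i + m)}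

def HasValOn (Λ : S.LatSeq) (U : Submodule F V) (X : Module.End F U) (k : ℤ) : Prop :=
  X ∈ S.aFilOn Λ U k ∧ X ∉ S.aFilOn Λ U (k + 1)

/-- `x` is integral over `o_F` -/
def IsIntegralO {R : Type*} [Ring R] [Algebra F R] (x : R) : Prop :=
  ∃ p : Polynomial F, p.Monic ∧ (∀ i, p.coeff i ∈ S.O) ∧ Polynomial.aeval x p = 0

/-- `[Λ|U, n, n-1, βU]` is a simple stratum: `E = F[βU]` is a field, `Λ|U` is an
`o_E`-lattice sequence, `ν(βU) = -n`, and `βU` is minimal over `F` (expressed by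
the standard equivalent exactness property of `ad(βU)`, cf. Bushnell–Kutzko
(1.4.9), (1.4.15)). -/
def SimpleOn (Λ : S.LatSeq) (n : ℤ) (U : Submodule F V) (βU : Module.End F U) : Prop :=
  IsField (Algebra.adjoin F ({βU} : Set (Module.End F U))) ∧
  (∀ x : Module.End F U, x ∈ Algebra.adjoin F ({βU} : Set (Module.End F U)) →
      S.IsIntegralO x → ∀ i : ℤ, ∀ v : U, (v : V) ∈ Λ.L i → ((x v : U) : V) ∈ Λ.L i) ∧
  S.HasValOn Λ U βU (-n) ∧
  (∀ m : ℤ, ∀ X ∈ S.aFilOn Λ U m, βU * X - X * βU ∈ S.aFilOn Λ U (m - n + 1) →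
      ∃ Y : Module.End F U, Y * βU = βU * Y ∧ X - Y ∈ S.aFilOn Λ U (m + 1))

/-- `E = F[βU]` is tamely ramified over `F`: the ramification index
`e(E/F) = e(Λ)/g`, where `g` generates the value group `ν_Λ(E^×)`, is prime to
the residue characteristic. -/
def TameOn (Λ : S.LatSeq) (U : Submodule F V) (βU : Module.End F U) : Prop :=
  ∃ g : ℤ, 0 < g ∧
    (∀ x : Module.End F U, x ∈ Algebra.adjoin F ({βU} : Set (Module.End F U)) → x ≠ 0 →
        ∃ m : ℤ, g ∣ m ∧ S.HasValOn Λ U x m) ∧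
    (∃ x : Module.End F U, x ∈ Algebra.adjoin F ({βU} : Set (Module.End F U)) ∧
        S.HasValOn Λ U x g) ∧
    ¬ ((S.residueChar : ℤ) ∣ (Λ.e / g))

/-- restriction of an endomorphism to an invariant subspace -/
def restr (β : Module.End F V) (U : Submodule F V) (hU : ∀ v ∈ U, β v ∈ U) :
    Module.End F U :=
  LinearMap.restrict β hU

lemma pow_inv (β : Module.End F V) (U : Submodule F V) (hU : ∀ v ∈ U, β v ∈ U) :
    ∀ m : ℕ, ∀ v ∈ U, (β ^ m) v ∈ U := by
  intro m
  induction m with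
  | zero => intro v hv; simpa using hv
  | succ t ih =>
      intro v hv
      rw [pow_succ]
      exact ih _ (hU v hv)

lemma ybeta_inv (Λ : S.LatSeq) (n : ℤ) (β : Module.End F V) (U : Submodule F V)
    (hU : ∀ v ∈ U, β v ∈ U) : ∀ v ∈ U, S.ybeta Λ n β v ∈ U := by
  intro v hv
  show (S.ϖ ^ ((n / (Int.gcd Λ.e n : ℤ)).toNat) •
      β ^ ((Λ.e / (Int.gcd Λ.e n : ℤ)).toNat)) v ∈ U
  rw [LinearMap.smul_apply]
  exact U.smul_mem _ (pow_inv β U hU _ v hv)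

variable [FiniteDimensional F V]

/-- `[Λ, n, n-1, β]` is a skew semisimple stratum, split with respect to the
orthogonal `F`-splitting `V = W 0 ⊥ … ⊥ W (k-1)`: `Λ` is a full self-dual
lattice sequence, `β` is skew with `ν_Λ(β) = -n`, the splitting is orthogonal,
compatible with `Λ` and preserved by `β`, each restricted stratum is zero or
simple, no characteristic polynomial of a nonzero component is divisible by `X`
mod `p_F`, and the characteristic polynomials of distinct components are
coprime mod `p_F`. -/
structure IsSkewSS (Λ : S.LatSeq) (n : ℤ) (β : Module.End F V)
    (k : ℕ) (W : Fin k → Submodule F V) : Prop where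
  full : S.IsFull Λ
  selfdual : S.isSelfDual Λ
  n_pos : 0 < n
  skew : β ∈ S.Aminus
  mem : β ∈ S.aFil Λ (-n)
  val : β ∉ S.aFil Λ (1 - n)
  k_pos : 0 < k
  internal : DirectSum.IsInternal W
  orth : ∀ i j, i ≠ j → ∀ v ∈ W i, ∀ w ∈ W j, S.h v w = 0
  lat_compat : ∀ m : ℤ, ∀ f : Fin k → V, (∀ i, f i ∈ W i) →
      ((∑ i, f i) ∈ Λ.L m ↔ ∀ i, f i ∈ Λ.L m)
  β_inv : ∀ i, ∀ v ∈ W i, β v ∈ W i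
  comp : ∀ i, (∀ v ∈ W i, β v = 0) ∨ S.SimpleOn Λ n (W i) (restr β (W i) (β_inv i))
  comp_nondeg : ∀ i, ¬ (∀ v ∈ W i, β v = 0) →
      (LinearMap.charpoly
        (restr (S.ybeta Λ n β) (W i) (S.ybeta_inv Λ n β (W i) (β_inv i)))).coeff 0 ∉ S.pF
  coprime : ∀ i j, i ≠ j →
      S.CoprimeModP
        (LinearMap.charpoly
          (restr (S.ybeta Λ n β) (W i) (S.ybeta_inv Λ n β (W i) (β_inv i))))
        (LinearMap.charpoly
          (restr (S.ybeta Λ n β) (W j) (S.ybeta_inv Λ n β (W j) (β_inv j))))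

/-- the stratum `[Λ, n, n-1, β]` is fundamental: the reduction mod `p_F` of the
characteristic polynomial of `y_β` is not `X^N` -/
def IsFundamental (Λ : S.LatSeq) (n : ℤ) (β : Module.End F V) : Prop :=
  ¬ ∀ i : ℕ, i < Module.finrank F V →
      (LinearMap.charpoly (S.ybeta Λ n β)).coeff i ∈ S.pF

section Char

variable (F₀ : Type w) [Field F₀] [Algebra F₀ F]

/-- `tr_{A/F₀} = tr_{F/F₀} ∘ tr_{A/F}` -/
def trA0 (X : Module.End F V) : F₀ := Algebra.trace F₀ F (LinearMap.trace F V X)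

/-- the character `ψ_β(x) = ψ₀(tr_{A/F₀}(β(x-1)))` -/
def psiCh (ψ₀ : F₀ → ℂ) (β : Module.End F V) (g : S.GU) : ℂ :=
  ψ₀ (trA0 F₀ (β * (S.toE g - 1)))

/-- `ψ₀` is an additive character of `F₀` with conductor `p₀` -/
def IsAddCh (ψ₀ : F₀ → ℂ) : Prop :=
  (∀ x y : F₀, ψ₀ (x + y) = ψ₀ x * ψ₀ y) ∧
  (∀ x : F₀, algebraMap F₀ F x ∈ S.pF → ψ₀ x = 1) ∧
  (∃ x : F₀, algebraMap F₀ F x ∈ S.O ∧ ψ₀ x ≠ 1)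

/-- `F₀` is the fixed field of the involution -/
def FixedField : Prop := ∀ x : F, S.conj x = x ↔ x ∈ (algebraMap F₀ F).range

end Char

section Rep

variable {W : Type*} [AddCommGroup W] [Module ℂ W]

/-- smoothness of a representation of `G` (relative to the lattice sequence `Λ`:
the groups `P_k(Λ)`, `k ≥ 1`, form a basis of neighborhoods of the identity) -/
def SmoothRel (Λ : S.LatSeq) (π : S.GU →* Module.End ℂ W) : Prop :=
  ∀ w : W, ∃ k : ℤ, 1 ≤ k ∧ ∀ g ∈ S.Pset Λ k, π g w = w

/-- smoothness of a representation of `G` -/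
def Smooth (π : S.GU →* Module.End ℂ W) : Prop :=
  ∀ w : W, ∃ Λ : S.LatSeq, S.IsFull Λ ∧ S.isSelfDual Λ ∧
    ∃ k : ℤ, 1 ≤ k ∧ ∀ g ∈ S.Pset Λ k, π g w = w

/-- irreducibility -/
def Irred (π : S.GU →* Module.End ℂ W) : Prop :=
  (∃ w : W, w ≠ 0) ∧
  ∀ U : Submodule ℂ W, (∀ g : S.GU, ∀ w ∈ U, π g w ∈ U) → U = ⊥ ∨ U = ⊤

/-- `π` contains the character `χ` of the subset `K ⊆ G` -/
def ContainsChar (π : S.GU →* Module.End ℂ W) (K : Set S.GU) (χ : S.GU → ℂ) : Prop :=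
  ∃ w : W, w ≠ 0 ∧ ∀ g ∈ K, π g w = χ g • w

/-- `π` has positive level: no nonzero `P_1(Λ)`-fixed vector for any self-dual `Λ` -/
def PositiveLevel (π : S.GU →* Module.End ℂ W) : Prop :=
  ∀ Λ : S.LatSeq, S.IsFull Λ → S.isSelfDual Λ →
    ∀ w : W, (∀ g ∈ S.Pset Λ 1, π g w = w) → w = 0

end Rep

section Hecke

/-- the double coset `KgK` -/
def dCoset (K : Subgroup S.GU) (g : S.GU) : Set S.GU :=
  {a : S.GU | ∃ x ∈ K, ∃ y ∈ K, a = x * g * y}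

/-- the double coset `KgK` for a subset `K` -/
def dCosetSet (K : Set S.GU) (g : S.GU) : Set S.GU :=
  {a : S.GU | ∃ x ∈ K, ∃ y ∈ K, a = x * g * y}

/-- convolution of two functions on `G` relative to the open compact subgroup `K`
(Haar measure normalized by `vol(K) = 1`):
`(f₁ * f₂)(g) = ∑_{xK ∈ G/K} f₁(x) f₂(x⁻¹ g)`. -/
def hConv {M : Type*} [Ring M] (K : Subgroup S.GU) (f₁ f₂ : S.GU → M) : S.GU → M :=
  fun g => ∑ᶠ q : S.GU ⧸ K, f₁ (Quotient.out q) * f₂ ((Quotient.out q)⁻¹ * g)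

/-- `f` belongs to the Hecke algebra `H(G//K, τ)` with support contained in `supp`:
`f(kgk') = τ(k) f(g) τ(k')` for `k, k' ∈ K`, and `f` is compactly supported
(its support meets only finitely many cosets of `K`). -/
def IsHecke {M : Type*} [Ring M] (K : Subgroup S.GU) (supp : Set S.GU)
    (τ : S.GU → M) (f : S.GU → M) : Prop :=
  (∀ k ∈ K, ∀ g : S.GU, ∀ k' ∈ K, f (k * g * k') = τ k * f g * τ k') ∧
  Function.support f ⊆ supp ∧
  ((fun a : S.GU => (QuotientGroup.mk a : S.GU ⧸ K)) '' Function.support f).Finite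

/-- `[KgK : K] = [K : K ∩ gKg⁻¹]`, the number of left cosets of `K` in `KgK` -/
def dcIndex (K : Subgroup S.GU) (g : S.GU) : ℕ :=
  Nat.card ((fun a : S.GU => (QuotientGroup.mk a : S.GU ⧸ K)) '' S.dCoset K g)

end Hecke


section U4

/-! Concrete data for the non quasi-split unramified unitary group in four
variables: `V = F^4`, `h(v,w) = ᵗv̄ H w` with `H = E₁₄ + ϖE₂₂ + E₃₃ + E₄₁`,
the standard lattices `N₀, N₁` and their duals, and the standard self-dual
lattice sequences `Λ₁, …, Λ₅`. -/

variable (T : USetting F (Fin 4 → F))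

/-- the hermitian form of the non quasi-split unramified `U(4)`:
`h(v, w) = ᵗv̄ H w`, `H = E₁₄ + ϖE₂₂ + E₃₃ + E₄₁` -/
def IsU4Form : Prop :=
  ∀ v w : Fin 4 → F, T.h v w =
    T.conj (v 0) * w 3 + T.ϖ * (T.conj (v 1) * w 1) + T.conj (v 2) * w 2 +
      T.conj (v 3) * w 0

/-- `F/F₀` is quadratic unramified with common uniformizer `ϖ`:
`ϖ` is fixed by the involution, and `F = F₀[√ε]` for a non-square unit `ε` of `o₀`. -/
def IsUnramifiedQuadratic : Prop :=
  T.conj T.ϖ = T.ϖ ∧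
  ∃ ε s : F, ε ∈ T.O ∧ (∃ y ∈ T.O, ε * y = 1) ∧ T.conj ε = ε ∧
    (¬ ∃ y : F, T.conj y = y ∧ y ^ 2 = ε) ∧ s ^ 2 = ε ∧ T.conj s = -s

/-- `N₀ = o_F e₁ ⊕ o_F e₂ ⊕ o_F e₃ ⊕ o_F e₄` -/
def N0 : Set (Fin 4 → F) := {v | ∀ j, v j ∈ T.O}

/-- `N₁ = o_F e₁ ⊕ o_F e₂ ⊕ o_F e₃ ⊕ p_F e₄` -/
def N1 : Set (Fin 4 → F) := {v | (∀ j, v j ∈ T.O) ∧ v 3 ∈ T.pF}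

/-- `N₀^# = o_F e₁ ⊕ p_F⁻¹ e₂ ⊕ o_F e₃ ⊕ o_F e₄` -/
def N0s : Set (Fin 4 → F) :=
  {v | v 0 ∈ T.O ∧ T.ϖ * v 1 ∈ T.O ∧ v 2 ∈ T.O ∧ v 3 ∈ T.O}

/-- `N₁^# = p_F⁻¹ e₁ ⊕ p_F⁻¹ e₂ ⊕ o_F e₃ ⊕ o_F e₄` -/
def N1s : Set (Fin 4 → F) :=
  {v | T.ϖ * v 0 ∈ T.O ∧ T.ϖ * v 1 ∈ T.O ∧ v 2 ∈ T.O ∧ v 3 ∈ T.O}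

/-- `Λ₁(2i) = ϖ^i N₀`, `Λ₁(2i+1) = ϖ^{i+1} N₀^#` -/
def IsLam1 (Λ : T.LatSeq) : Prop :=
  Λ.e = 2 ∧ ∀ i : ℤ,
    Λ.L (2*i) = T.ϖ ^ i • T.N0 ∧ Λ.L (2*i+1) = T.ϖ ^ (i+1) • T.N0s

/-- `Λ₂(2i) = ϖ^i N₁`, `Λ₂(2i+1) = ϖ^{i+1} N₁^#` -/
def IsLam2 (Λ : T.LatSeq) : Prop :=
  Λ.e = 2 ∧ ∀ i : ℤ,
    Λ.L (2*i) = T.ϖ ^ i • T.N1 ∧ Λ.L (2*i+1) = T.ϖ ^ (i+1) • T.N1s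

/-- `Λ₃(4i) = ϖ^i N₀`, `Λ₃(4i+1) = ϖ^i N₁`, `Λ₃(4i+2) = ϖ^{i+1} N₁^#`,
`Λ₃(4i+3) = ϖ^{i+1} N₀^#` -/
def IsLam3 (Λ : T.LatSeq) : Prop :=
  Λ.e = 4 ∧ ∀ i : ℤ,
    Λ.L (4*i) = T.ϖ ^ i • T.N0 ∧ Λ.L (4*i+1) = T.ϖ ^ i • T.N1 ∧
    Λ.L (4*i+2) = T.ϖ ^ (i+1) • T.N1s ∧ Λ.L (4*i+3) = T.ϖ ^ (i+1) • T.N0s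

/-- `Λ₄(6i) = Λ₄(6i+1) = ϖ^i N₀`, `Λ₄(6i+2) = ϖ^i N₁`, `Λ₄(6i+3) = ϖ^{i+1} N₁^#`,
`Λ₄(6i+4) = Λ₄(6i+5) = ϖ^{i+1} N₀^#` -/
def IsLam4 (Λ : T.LatSeq) : Prop :=
  Λ.e = 6 ∧ ∀ i : ℤ,
    Λ.L (6*i) = T.ϖ ^ i • T.N0 ∧ Λ.L (6*i+1) = T.ϖ ^ i • T.N0 ∧
    Λ.L (6*i+2) = T.ϖ ^ i • T.N1 ∧ Λ.L (6*i+3) = T.ϖ ^ (i+1) • T.N1s ∧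
    Λ.L (6*i+4) = T.ϖ ^ (i+1) • T.N0s ∧ Λ.L (6*i+5) = T.ϖ ^ (i+1) • T.N0s

/-- `Λ₅(6i-1) = ϖ^i N₀`, `Λ₅(6i) = Λ₅(6i+1) = ϖ^i N₁`,
`Λ₅(6i+2) = Λ₅(6i+3) = ϖ^{i+1} N₁^#`, `Λ₅(6i+4) = ϖ^{i+1} N₀^#` -/
def IsLam5 (Λ : T.LatSeq) : Prop :=
  Λ.e = 6 ∧ ∀ i : ℤ,
    Λ.L (6*i-1) = T.ϖ ^ i • T.N0 ∧ Λ.L (6*i) = T.ϖ ^ i • T.N1 ∧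
    Λ.L (6*i+1) = T.ϖ ^ i • T.N1 ∧ Λ.L (6*i+2) = T.ϖ ^ (i+1) • T.N1s ∧
    Λ.L (6*i+3) = T.ϖ ^ (i+1) • T.N1s ∧ Λ.L (6*i+4) = T.ϖ ^ (i+1) • T.N0s

/-- the matrix of `β = ϖ^{-m}(Y E₂₃ - ϖ Ȳ E₃₂)` -/
def betaMat (m : ℤ) (Y : F) : Matrix (Fin 4) (Fin 4) F :=
  fun i j =>
    if i = 1 ∧ j = 2 then T.ϖ ^ (-m) * Y
    else if i = 2 ∧ j = 1 then -(T.ϖ ^ (1 - m) * T.conj Y) else 0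

/-- the matrix of `s₁ = E₁₄ + E₂₂ + E₃₃ + E₄₁` -/
def s1Mat : Matrix (Fin 4) (Fin 4) F :=
  !![0,0,0,1; 0,1,0,0; 0,0,1,0; 1,0,0,0]

/-- the matrix of `s₂ = ϖ⁻¹E₁₄ + E₂₂ + E₃₃ + ϖE₄₁` -/
def s2Mat : Matrix (Fin 4) (Fin 4) F :=
  !![0,0,0,T.ϖ⁻¹; 0,1,0,0; 0,0,1,0; T.ϖ,0,0,0]

end U4

end USetting

namespace U17
open USetting

variable {F : Type u} [Field F] (T : USetting F (Fin 4 → F))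

lemma zpow_conj (hc : T.conj T.ϖ = T.ϖ) (k : ℤ) : T.conj (T.ϖ ^ k) = T.ϖ ^ k := by
  rw [map_zpow₀, hc]

lemma zpow_mem {k : ℤ} (hk : 0 ≤ k) : T.ϖ ^ k ∈ T.O := by
  lift k to ℕ using hk
  simpa using T.O.pow_mem T.ϖ_mem k

lemma zp_mono {a b : ℤ} {x : F} (h : T.ϖ ^ a * x ∈ T.O) (hab : a ≤ b) : T.ϖ ^ b * x ∈ T.O := by
  have : T.ϖ ^ b * x = T.ϖ ^ (b - a) * (T.ϖ ^ a * x) := by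
    rw [← mul_assoc, ← zpow_add₀ T.ϖ_ne_zero]; congr 2; ring
  rw [this]
  exact T.O.mul_mem (zpow_mem T (by omega)) h

lemma zp_mul {a b c : ℤ} {x y : F} (h : T.ϖ ^ a * x ∈ T.O) (h' : T.ϖ ^ b * y ∈ T.O)
    (hab : a + b ≤ c) : T.ϖ ^ c * (x * y) ∈ T.O := by
  apply zp_mono T (a := a + b) _ hab
  rw [zpow_add₀ T.ϖ_ne_zero]
  have := T.O.mul_mem h h'
  convert this using 1; ring

lemma zp_add {a : ℤ} {x y : F} (h : T.ϖ ^ a * x ∈ T.O) (h' : T.ϖ ^ a * y ∈ T.O) :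
    T.ϖ ^ a * (x + y) ∈ T.O := by
  rw [mul_add]; exact T.O.add_mem h h'

lemma zp_sum {ι : Type*} (s : Finset ι) {a : ℤ} {f : ι → F} (h : ∀ i ∈ s, T.ϖ ^ a * f i ∈ T.O) :
    T.ϖ ^ a * (∑ i ∈ s, f i) ∈ T.O := by
  rw [Finset.mul_sum]; exact T.O.sum_mem h

lemma zp_neg {a : ℤ} {x : F} (h : T.ϖ ^ a * x ∈ T.O) : T.ϖ ^ a * (-x) ∈ T.O := by
  rw [mul_neg]; exact T.O.neg_mem h

lemma zp_conj (hc : T.conj T.ϖ = T.ϖ) {a : ℤ} {x : F} (h : T.ϖ ^ a * x ∈ T.O) :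
    T.ϖ ^ a * T.conj x ∈ T.O := by
  have := T.conj_O _ h
  rwa [map_mul, zpow_conj T hc] at this

lemma mem_pF {x : F} : x ∈ T.pF ↔ T.ϖ ^ (-1 : ℤ) * x ∈ T.O := by
  constructor
  · rintro ⟨z, hz, rfl⟩
    rw [← mul_assoc, zpow_neg_one, inv_mul_cancel₀ T.ϖ_ne_zero, one_mul]; exact hz
  · intro h
    refine ⟨_, h, ?_⟩
    rw [← mul_assoc, zpow_neg_one, mul_inv_cancel₀ T.ϖ_ne_zero, one_mul]

lemma one_not_pF : (1 : F) ∉ T.pF := by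
  rintro ⟨z, hz, h⟩
  exact T.ϖ_not_unit z hz h.symm

lemma zp_neg_not {k : ℤ} (hk : k < 0) : T.ϖ ^ k ∉ T.O := by
  intro h
  apply one_not_pF T
  rw [mem_pF]
  exact zp_mono T (a := k) (by simpa using h) (by omega)

/-- either unit inverse in O, or in pF -/
lemma unit_or_pF {x : F} (hx : x ∈ T.O) : x ∈ T.pF ∨ (x ≠ 0 ∧ x⁻¹ ∈ T.O) := by
  by_cases h : ∀ y ∈ T.O, x * y ≠ 1
  · left; exact T.unif x hx h
  · right
    push Not at h
    obtain ⟨y, hy, hxy⟩ := h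
    refine ⟨left_ne_zero_of_mul_eq_one hxy, ?_⟩
    rwa [inv_eq_of_mul_eq_one_right hxy]

lemma inv_or_pF {x : F} : x ∈ T.pF ∨ (x ≠ 0 ∧ x⁻¹ ∈ T.O) := by
  by_cases h0 : x = 0
  · left; rw [h0, mem_pF]; simp
  rcases T.O_val x h0 with h | h
  · exact unit_or_pF T h
  · exact Or.inr ⟨h0, h⟩

lemma pF_sub_O {x : F} (h : x ∈ T.pF) : x ∈ T.O := by
  obtain ⟨z, hz, rfl⟩ := h
  exact T.O.mul_mem T.ϖ_mem hz

lemma two_inv (hodd : ¬ (2 ∣ T.residueChar)) : (2:F) ≠ 0 ∧ (2 : F)⁻¹ ∈ T.O := by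
  have h2 : (2:F) ∈ T.O := by simp
  rcases unit_or_pF T h2 with h | h
  · exfalso
    obtain ⟨z, hz, h⟩ := h
    apply hodd
    have hmem : (2 : T.O) ∈ (Ideal.span {(⟨T.ϖ, T.ϖ_mem⟩ : T.O)} : Ideal T.O) := by
      rw [Ideal.mem_span_singleton]
      exact ⟨⟨z, hz⟩, Subtype.ext h⟩
    have hd : T.residueChar ∣ 2 := by
      apply ringChar.dvd
      have := Ideal.Quotient.eq_zero_iff_mem.mpr hmem
      rw [map_ofNat] at this
      exact_mod_cast this
    have hne : T.residueChar ≠ 1 := by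
      intro h1
      have h3 : ((1 : ℕ) : (T.O ⧸ (Ideal.span {(⟨T.ϖ, T.ϖ_mem⟩ : T.O)} : Ideal T.O))) = 0 := by
        rw [← h1]; exact ringChar.Nat.cast_ringChar
      rw [Nat.cast_one] at h3
      have := Ideal.Quotient.eq_zero_iff_mem.mp (show Ideal.Quotient.mk (Ideal.span {(⟨T.ϖ, T.ϖ_mem⟩ : T.O)}) (1 : T.O) = 0 from h3)
      rw [Ideal.mem_span_singleton] at this
      obtain ⟨y, hy⟩ := this
      exact T.ϖ_not_unit y y.2 (congrArg Subtype.val hy).symm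
    rcases (Nat.dvd_prime Nat.prime_two).mp hd with h' | h'
    · exact absurd h' hne
    · rw [h']
  · exact h

/-- Standard coordinates description of a lattice sequence of period 6. -/
def Std (α : Fin 4 → ℤ) (Λ : T.LatSeq) : Prop :=
  ∀ i v, v ∈ Λ.L i ↔ ∀ j, T.ϖ ^ ((α j - i) / 6) * v j ∈ T.O

lemma mem_smul_zpow {q : ℤ} {N : Set (Fin 4 → F)} {v : Fin 4 → F} :
    v ∈ T.ϖ ^ q • N ↔ (T.ϖ ^ (-q)) • v ∈ N := by
  rw [Set.mem_smul_set_iff_inv_smul_mem₀ (zpow_ne_zero _ T.ϖ_ne_zero), zpow_neg]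

lemma zp1 (a : ℤ) (x : F) : T.ϖ * (T.ϖ ^ a * x) = T.ϖ ^ (a+1) * x := by
  rw [zpow_add₀ T.ϖ_ne_zero, zpow_one]; ring

lemma zpm1 (a : ℤ) (x : F) : T.ϖ ^ (-1 : ℤ) * (T.ϖ ^ a * x) = T.ϖ ^ (a-1) * x := by
  rw [← mul_assoc, ← zpow_add₀ T.ϖ_ne_zero]; congr 2; ring

lemma N0_iff {q : ℤ} {v : Fin 4 → F} : v ∈ T.ϖ ^ q • T.N0 ↔
    T.ϖ ^ (-q) * v 0 ∈ T.O ∧ T.ϖ ^ (-q) * v 1 ∈ T.O ∧ T.ϖ ^ (-q) * v 2 ∈ T.O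
      ∧ T.ϖ ^ (-q) * v 3 ∈ T.O := by
  rw [mem_smul_zpow]
  simp [N0, Fin.forall_fin_succ]

lemma N1_iff {q : ℤ} {v : Fin 4 → F} : v ∈ T.ϖ ^ q • T.N1 ↔
    T.ϖ ^ (-q) * v 0 ∈ T.O ∧ T.ϖ ^ (-q) * v 1 ∈ T.O ∧ T.ϖ ^ (-q) * v 2 ∈ T.O
      ∧ T.ϖ ^ (-q-1) * v 3 ∈ T.O := by
  rw [mem_smul_zpow]
  show ((∀ j, _) ∧ _) ↔ _
  rw [mem_pF]
  simp only [Fin.forall_fin_succ, Pi.smul_apply, smul_eq_mul, zpm1]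
  constructor
  · rintro ⟨⟨h0, h1, h2, h3, -⟩, h⟩
    exact ⟨h0, h1, h2, h⟩
  · rintro ⟨h0, h1, h2, h3⟩
    exact ⟨⟨h0, h1, h2, zp_mono T h3 (by omega), fun i => i.elim0⟩, h3⟩

lemma N0s_iff {q : ℤ} {v : Fin 4 → F} : v ∈ T.ϖ ^ q • T.N0s ↔
    T.ϖ ^ (-q) * v 0 ∈ T.O ∧ T.ϖ ^ (-q+1) * v 1 ∈ T.O ∧ T.ϖ ^ (-q) * v 2 ∈ T.O
      ∧ T.ϖ ^ (-q) * v 3 ∈ T.O := by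
  rw [mem_smul_zpow]
  show _ ∧ _ ↔ _
  simp only [Pi.smul_apply, smul_eq_mul, zp1]

lemma N1s_iff {q : ℤ} {v : Fin 4 → F} : v ∈ T.ϖ ^ q • T.N1s ↔
    T.ϖ ^ (-q+1) * v 0 ∈ T.O ∧ T.ϖ ^ (-q+1) * v 1 ∈ T.O ∧ T.ϖ ^ (-q) * v 2 ∈ T.O
      ∧ T.ϖ ^ (-q) * v 3 ∈ T.O := by
  rw [mem_smul_zpow]
  show _ ∧ _ ↔ _
  simp only [Pi.smul_apply, smul_eq_mul, zp1]

def α4 : Fin 4 → ℤ := ![3,5,2,1]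
def α5 : Fin 4 → ℤ := ![3,4,1,-1]

lemma std_aux {α : Fin 4 → ℤ} {i : ℤ} {v : Fin 4 → F} {a b c d : ℤ}
   (ha : (α 0 - i)/6 = a) (hb : (α 1 - i)/6 = b) (hc : (α 2 - i)/6 = c) (hd : (α 3 - i)/6 = d) :
   (∀ j, T.ϖ ^ ((α j - i) / 6) * v j ∈ T.O) ↔ (T.ϖ ^ a * v 0 ∈ T.O ∧ T.ϖ ^ b * v 1 ∈ T.O
     ∧ T.ϖ ^ c * v 2 ∈ T.O ∧ T.ϖ ^ d * v 3 ∈ T.O) := by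
  subst ha hb hc hd
  constructor
  · intro h; exact ⟨h 0, h 1, h 2, h 3⟩
  · rintro ⟨h0, h1, h2, h3⟩ j
    fin_cases j <;> assumption

lemma std4 {Λ : T.LatSeq} (h : T.IsLam4 Λ) : Std T α4 Λ := by
  intro i v
  obtain ⟨h0, h1, h2, h3, h4, h5⟩ := h.2 (i/6)
  have hr : i = 6 * (i/6) ∨ i = 6*(i/6)+1 ∨ i = 6*(i/6)+2 ∨ i = 6*(i/6)+3 ∨ i = 6*(i/6)+4 ∨
     i = 6*(i/6)+5 := by omega
  generalize i / 6 = q at *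
  rcases hr with rfl | rfl | rfl | rfl | rfl | rfl
  · rw [h0, N0_iff, std_aux T] <;> simp [α4] <;> omega
  · rw [h1, N0_iff, std_aux T] <;> simp [α4] <;> omega
  · rw [h2, N1_iff, std_aux T] <;> simp [α4] <;> omega
  · rw [h3, N1s_iff, std_aux T] <;> simp [α4] <;> omega
  · rw [h4, N0s_iff, std_aux T] <;> simp [α4] <;> omega
  · rw [h5, N0s_iff, std_aux T] <;> simp [α4] <;> omega

lemma std5 {Λ : T.LatSeq} (h : T.IsLam5 Λ) : Std T α5 Λ := by
  intro i v
  obtain ⟨h0, h1, h2, h3, h4, h5⟩ := h.2 ((i+1)/6)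
  have hr : i = 6 * ((i+1)/6) - 1 ∨ i = 6*((i+1)/6) ∨ i = 6*((i+1)/6)+1 ∨ i = 6*((i+1)/6)+2 ∨
     i = 6*((i+1)/6)+3 ∨ i = 6*((i+1)/6)+4 := by omega
  generalize (i+1) / 6 = q at *
  rcases hr with rfl | rfl | rfl | rfl | rfl | rfl
  · rw [h0, N0_iff, std_aux T] <;> simp [α5] <;> omega
  · rw [h1, N1_iff, std_aux T] <;> simp [α5] <;> omega
  · rw [h2, N1_iff, std_aux T] <;> simp [α5] <;> omega
  · rw [h3, N1s_iff, std_aux T] <;> simp [α5] <;> omega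
  · rw [h4, N1s_iff, std_aux T] <;> simp [α5] <;> omega
  · rw [h5, N0s_iff, std_aux T] <;> simp [α5] <;> omega

end U17

namespace U17
open USetting

variable {F : Type u} [Field F] (T : USetting F (Fin 4 → F))

abbrev EE (F : Type u) [Field F] := Module.End F (Fin 4 → F)

def ent (X : EE F) (j k : Fin 4) : F := X (Pi.single k 1) j

lemma vec_eq (v : Fin 4 → F) : v = ∑ k, v k • (Pi.single k 1 : Fin 4 → F) := by
  ext j
  simp [Finset.sum_apply, Pi.single_apply]

lemma apply_eq (X : EE F) (v : Fin 4 → F) (j : Fin 4) : X v j = ∑ k, v k * ent X j k := by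
  conv_lhs => rw [vec_eq v]
  simp [map_sum, Finset.sum_apply, ent]

lemma ent_mul (X Y : EE F) (j k : Fin 4) : ent (X * Y) j k = ∑ l, ent X j l * ent Y l k := by
  show X (Y _) j = _
  rw [apply_eq]
  exact Finset.sum_congr rfl fun l _ => mul_comm _ _

lemma trace_eq (X : EE F) : LinearMap.trace F _ X = ∑ j, ent X j j := by
  rw [LinearMap.trace_eq_matrix_trace F (Pi.basisFun F (Fin 4))]
  simp [Matrix.trace, ent]

lemma zpe (a b : ℤ) (x : F) : T.ϖ ^ a * (T.ϖ ^ b * x) = T.ϖ ^ (a+b) * x := by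
  rw [zpow_add₀ T.ϖ_ne_zero]; ring

variable {T}
lemma single_mem {α : Fin 4 → ℤ} {Λ : T.LatSeq} (hs : Std T α Λ) (k : Fin 4) :
    (Pi.single k 1 : Fin 4 → F) ∈ Λ.L (α k) := by
  rw [hs]
  intro j
  by_cases h : j = k
  · subst h; simp
  · simp [h]

lemma aFil_iff {α : Fin 4 → ℤ} {Λ : T.LatSeq} (hs : Std T α Λ) {m : ℤ} {X : EE F} :
    X ∈ T.aFil Λ m ↔ ∀ j k, T.ϖ ^ ((α j - α k - m) / 6) * ent X j k ∈ T.O := by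
  constructor
  · intro h j k
    have := (hs _ _).mp (h _ _ (single_mem hs k)) j
    rw [show α j - α k - m = α j - (α k + m) by ring]; exact this
  · intro h i v hv
    rw [hs] at hv ⊢
    intro j
    rw [apply_eq]
    refine zp_sum T _ fun k _ => zp_mul T (hv k) (h j k) ?_
    omega

lemma aFil_add {Λ : T.LatSeq} {m : ℤ} {X Y : EE F} (hX : X ∈ T.aFil Λ m) (hY : Y ∈ T.aFil Λ m) :
    X + Y ∈ T.aFil Λ m := fun i v hv => Λ.add_mem _ _ _ (hX i v hv) (hY i v hv)

lemma aFil_smul {Λ : T.LatSeq} {m : ℤ} {X : EE F} {c : F} (hc : c ∈ T.O) (hX : X ∈ T.aFil Λ m) :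
    c • X ∈ T.aFil Λ m := fun i v hv => Λ.smul_mem _ c hc _ (hX i v hv)

lemma neg_one_smulE (X : EE F) : (-1 : F) • X = -X := by
  apply LinearMap.ext; intro v; simp

lemma aFil_neg {Λ : T.LatSeq} {m : ℤ} {X : EE F} (hX : X ∈ T.aFil Λ m) :
    -X ∈ T.aFil Λ m := by
  have := aFil_smul (c := -1) (T.O.neg_mem T.O.one_mem) hX
  rwa [neg_one_smulE] at this

lemma aFil_sub {Λ : T.LatSeq} {m : ℤ} {X Y : EE F} (hX : X ∈ T.aFil Λ m) (hY : Y ∈ T.aFil Λ m) :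
    X - Y ∈ T.aFil Λ m := by
  rw [sub_eq_add_neg]; exact aFil_add hX (aFil_neg hY)

lemma L_anti (Λ : T.LatSeq) {i j : ℤ} (h : i ≤ j) : Λ.L j ⊆ Λ.L i := by
  obtain ⟨k, rfl⟩ := Int.le.dest h
  clear h
  induction k with
  | zero => simp
  | succ k ih =>
    push_cast
    rw [← add_assoc]
    exact (Λ.dec _).trans ih

lemma L_neg (Λ : T.LatSeq) {i : ℤ} {v} (h : v ∈ Λ.L i) : -v ∈ Λ.L i := by
  have := Λ.smul_mem i (-1) (T.O.neg_mem T.O.one_mem) v h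
  simpa using this

lemma L_sub (Λ : T.LatSeq) {i : ℤ} {v w} (h : v ∈ Λ.L i) (h' : w ∈ Λ.L i) : v - w ∈ Λ.L i := by
  rw [sub_eq_add_neg]; exact Λ.add_mem _ _ _ h (L_neg Λ h')

lemma aFil_anti {Λ : T.LatSeq} {m m' : ℤ} {X : EE F} (hX : X ∈ T.aFil Λ m) (h : m' ≤ m) :
    X ∈ T.aFil Λ m' := fun i v hv => L_anti Λ (by omega) (hX i v hv)

lemma aFil_mul {Λ : T.LatSeq} {m l k : ℤ} {X Y : EE F} (hX : X ∈ T.aFil Λ m)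
    (hY : Y ∈ T.aFil Λ l) (hk : k = m + l) : X * Y ∈ T.aFil Λ k := by
  intro i v hv
  have := hX _ _ (hY i v hv)
  rw [hk, show i + (m + l) = i + l + m by ring]; exact this

lemma aFil_one {Λ : T.LatSeq} : (1 : EE F) ∈ T.aFil Λ 0 := fun i v hv => by simpa using hv

lemma tr_mem {α : Fin 4 → ℤ} {Λ : T.LatSeq} (hs : Std T α Λ) {X : EE F} (hX : X ∈ T.aFil Λ 1) :
    LinearMap.trace F _ X ∈ T.pF := by
  rw [mem_pF, trace_eq]
  refine zp_sum T _ fun j _ => ?_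
  have := (aFil_iff hs).mp hX j j
  simpa using this

/-- elementary endomorphism -/
def Eab (c : F) (a b : Fin 4) : EE F := c • ((LinearMap.single F (fun _ : Fin 4 => F) a).comp (LinearMap.proj b))

lemma Eab_ent (c : F) (a b j k : Fin 4) : ent (Eab c a b) j k = if j = a ∧ k = b then c else 0 := by
  simp only [ent, Eab, LinearMap.smul_apply, LinearMap.comp_apply, LinearMap.proj_apply,
    Pi.smul_apply, LinearMap.single_apply, Pi.single_apply, smul_eq_mul]
  by_cases h1 : j = a <;> by_cases h2 : k = b <;> simp [h1, h2, eq_comm]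
  exact fun h => absurd h.symm h2

lemma dual_mem {α : Fin 4 → ℤ} {Λ : T.LatSeq} (hs : Std T α Λ) {m : ℤ} {X : EE F}
    (h : ∀ Y ∈ T.aFil Λ m, LinearMap.trace F _ (X * Y) ∈ T.pF) : X ∈ T.aFil Λ (1 - m) := by
  rw [aFil_iff hs]
  intro j k
  have h1 := h (Eab (T.ϖ ^ (-((α k - α j - m) / 6))) k j) (by
    rw [aFil_iff hs]
    intro a b
    rw [Eab_ent]
    split_ifs with h
    · obtain ⟨rfl, rfl⟩ := h
      rw [← zpow_add₀ T.ϖ_ne_zero]; simp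
    · simp)
  rw [mem_pF, trace_eq] at h1
  have h2 : ∑ l, ent (X * Eab (T.ϖ ^ (-((α k - α j - m) / 6))) k j) l l
    = T.ϖ ^ (-((α k - α j - m) / 6)) * ent X j k := by
    simp only [ent_mul, Eab_ent]
    rw [Finset.sum_eq_single j]
    · rw [Finset.sum_eq_single k]
      · simp [mul_comm]
      · intro b _ hb; simp [hb]
      · simp
    · intro b _ hb; simp [hb]
    · simp
  rw [h2, zpe] at h1
  exact zp_mono T h1 (by omega)

/-! hermitian form -/
lemma h_add_right (u v w) : T.h u (v + w) = T.h u v + T.h u w := by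
  rw [T.h_conj_symm (v+w) u, T.h_add_left, map_add, ← T.h_conj_symm, ← T.h_conj_symm]

lemma h_smul_right (c : F) (u w) : T.h u (c • w) = c * T.h u w := by
  rw [T.h_conj_symm (c • w) u, T.h_smul_left, map_mul, T.conj_invol, ← T.h_conj_symm]

lemma h_neg_right (u w) : T.h u (-w) = - T.h u w := by
  have := h_smul_right (T := T) (-1) u w; simpa using this
lemma h_neg_left (u w) : T.h (-u) w = - T.h u w := by
  have := T.h_smul_left (-1) u w; simpa using this
lemma h_sub_right (u v w) : T.h u (v - w) = T.h u v - T.h u w := by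
  rw [sub_eq_add_neg, h_add_right, h_neg_right, sub_eq_add_neg]
lemma h_sub_left (u v w) : T.h (u - v) w = T.h u w - T.h v w := by
  rw [sub_eq_add_neg, T.h_add_left, h_neg_left, sub_eq_add_neg]

lemma h_ext {x y} (h : ∀ u, T.h u x = T.h u y) : x = y := by
  rw [← sub_eq_zero]
  apply T.h_nondeg
  intro w
  rw [T.h_conj_symm, h_sub_right, h w, sub_self, map_zero]

lemma σ_unique' {X Y : EE F} (h : ∀ u w, T.h (X u) w = T.h u (Y w)) : T.σA X = Y := by
  apply LinearMap.ext
  intro w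
  apply h_ext (T := T)
  intro u
  rw [← h, T.σA_adj]

lemma σ_smul (c : F) (X : EE F) : T.σA (c • X) = T.conj c • T.σA X := by
  apply σ_unique'
  intro u w
  rw [LinearMap.smul_apply, LinearMap.smul_apply, T.h_smul_left, h_smul_right, T.σA_adj]

lemma σ_neg (X : EE F) : T.σA (-X) = - T.σA X := by
  have := σ_smul (T := T) (-1) X; rwa [neg_one_smulE, map_neg, map_one, neg_one_smulE] at this

lemma σ_sub (X Y : EE F) : T.σA (X - Y) = T.σA X - T.σA Y := by
  rw [sub_eq_add_neg, T.σA_add, σ_neg, sub_eq_add_neg]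

lemma σ_aFil {Λ : T.LatSeq} {d : ℤ} (hd : T.selfDualWith Λ d) {m : ℤ} {X : EE F}
    (hX : X ∈ T.aFil Λ m) : T.σA X ∈ T.aFil Λ m := by
  intro i v hv
  have := hd (d - i - m)
  rw [show d - (d - i - m) = i + m by ring] at this
  rw [← this]
  intro w hw
  rw [T.h_conj_symm, ← T.σA_adj]
  apply T.conj_O
  have h1 := hX _ _ hw
  rw [show d - i - m + m = d - i by ring] at h1
  rw [T.h_conj_symm]
  apply T.conj_O
  have h2 := hd (d - i)
  rw [show d - (d - i) = i by ring] at h2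
  rw [← h2] at hv
  exact hv _ h1

lemma selfdual_aux (hf : T.IsU4Form) (hc : T.conj T.ϖ = T.ϖ) {α : Fin 4 → ℤ} {Λ : T.LatSeq} (hs : Std T α Λ) (d : ℤ)
   (h03 : α 0 + α 3 = d + 5) (h2 : 2 * α 2 = d + 5) (h1 : 2 * α 1 = d + 11) :
   T.selfDualWith Λ d := by
  intro i
  ext v
  constructor
  · intro hv
    rw [hs]
    have key : ∀ (a : Fin 4) , T.ϖ ^ (-((α a - i) / 6)) * T.h v (Pi.single a 1) ∈ T.O := by
      intro a
      have := hv (T.ϖ ^ (-((α a - i) / 6)) • Pi.single a 1) (by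
        rw [hs]
        intro j
        by_cases h : j = a
        · subst h; simp [mul_inv_cancel₀ (zpow_ne_zero _ T.ϖ_ne_zero)]
        · simp [h])
      rwa [h_smul_right] at this
    have k' : ∀ (a : Fin 4) , T.ϖ ^ (-((α a - i) / 6)) * T.h (Pi.single a 1) v ∈ T.O := by
      intro a
      rw [T.h_conj_symm]; exact zp_conj T hc (key a)
    have k0 := k' 0
    have k1 := k' 1
    have k2 := k' 2
    have k3 := k' 3
    rw [hf] at k0 k1 k2 k3
    simp at k0 k1 k2 k3
    intro j
    fin_cases j
    · refine zp_mono T (a := -((α 3 - i) / 6)) (by simpa using k3) ?_; simp; omega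
    · refine zp_mono T (a := -((α 1 - i) / 6)+1) (by rw [← zp1]; convert k1 using 1; rw [zpow_neg]; simp; ring) ?_; simp; omega
    · refine zp_mono T (a := -((α 2 - i) / 6)) (by simpa using k2) ?_; simp; omega
    · refine zp_mono T (a := -((α 0 - i) / 6)) (by simpa using k0) ?_; simp; omega
  · intro hv w hw
    rw [hs] at hv hw
    rw [hf]
    have e : ∀ x : F, x = T.ϖ ^ (0:ℤ) * x := by simp
    refine T.O.add_mem (T.O.add_mem (T.O.add_mem ?_ ?_) ?_) ?_
    · rw [e (_ * _)]; exact zp_mul T (zp_conj T hc (hv 0)) (hw 3) (by omega)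
    · rw [show ∀ x, T.ϖ * x = T.ϖ ^ (1:ℤ) * x by simp]; exact zp_mul T (zp_conj T hc (hv 1)) (hw 1) (by omega)
    · rw [e (_ * _)]; exact zp_mul T (zp_conj T hc (hv 2)) (hw 2) (by omega)
    · rw [e (_ * _)]; exact zp_mul T (zp_conj T hc (hv 3)) (hw 0) (by omega)

lemma selfdual4 (hf : T.IsU4Form) (hc : T.conj T.ϖ = T.ϖ) {Λ : T.LatSeq} (hs : Std T α4 Λ) :
    T.selfDualWith Λ (-1) := selfdual_aux hf hc hs _ (by simp [α4]) (by simp [α4]) (by simp [α4])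

lemma selfdual5 (hf : T.IsU4Form) (hc : T.conj T.ϖ = T.ϖ) {Λ : T.LatSeq} (hs : Std T α5 Λ) :
    T.selfDualWith Λ (-3) := selfdual_aux hf hc hs _ (by simp [α5]) (by simp [α5]) (by simp [α5])

lemma tr_σ (hf : T.IsU4Form) (X : EE F) :
    LinearMap.trace F _ (T.σA X) = T.conj (LinearMap.trace F _ X) := by
  have h0 := T.σA_adj X (Pi.single 0 1) (Pi.single 3 1)
  have h1 := T.σA_adj X (Pi.single 1 1) (Pi.single 1 1)
  have h2 := T.σA_adj X (Pi.single 2 1) (Pi.single 2 1)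
  have h3 := T.σA_adj X (Pi.single 3 1) (Pi.single 0 1)
  rw [hf, hf] at h0 h1 h2 h3
  simp [T.ϖ_ne_zero] at h0 h1 h2 h3
  rw [trace_eq, trace_eq]
  simp only [Fin.sum_univ_four, map_add, ent]
  rw [h0, h1, h2, h3]; ring

lemma tr_mem_conj {x : F} (h : x ∈ T.pF) (hc : T.conj T.ϖ = T.ϖ) : T.conj x ∈ T.pF := by
  rw [mem_pF] at *; exact zp_conj T hc h

/-- making a group element -/
def mkG (X : EE F) (h1 : T.σA X * X = 1) (h2 : X * T.σA X = 1) : T.GU :=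
  ⟨⟨X, T.σA X, h2, h1⟩, rfl⟩

@[simp] lemma toE_mkG (X : EE F) (h1 : T.σA X * X = 1) (h2) : T.toE (mkG X h1 h2) = X := rfl

lemma toE_mul (g k : T.GU) : T.toE (g * k) = T.toE g * T.toE k := rfl
lemma toE_one : T.toE (1 : T.GU) = 1 := rfl
lemma toE_inv (g : T.GU) : T.toE g⁻¹ = T.σA (T.toE g) := g.2.symm
lemma toE_inv_mul (g : T.GU) : T.toE g⁻¹ * T.toE g = 1 := by rw [← toE_mul, inv_mul_cancel, toE_one]
lemma toE_mul_inv (g : T.GU) : T.toE g * T.toE g⁻¹ = 1 := by rw [← toE_mul, mul_inv_cancel, toE_one]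
lemma toE_inj {g k : T.GU} (h : T.toE g = T.toE k) : g = k := Subtype.ext (Units.ext h)
lemma h_G (g : T.GU) (u w) : T.h (T.toE g u) (T.toE g w) = T.h u w := by
  rw [T.σA_adj, ← toE_inv]
  rw [← Module.End.mul_apply, toE_inv_mul, Module.End.one_apply]

section tr
variable {F₀ : Type w} [Field F₀] [Algebra F₀ F] [FiniteDimensional F₀ F]

lemma trace_alg (h2 : (2:F) ≠ 0) (hfix : T.FixedField F₀) (hdeg : Module.finrank F₀ F = 2) (z : F) :
    algebraMap F₀ F (Algebra.trace F₀ F z) = z + T.conj z := by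
  let c : F ≃ₐ[F₀] F := AlgEquiv.ofRingEquiv (f := T.conj) (fun x => (hfix _).mpr ⟨x, rfl⟩)
  have key : ∀ x, Algebra.trace F₀ F (T.conj x) = Algebra.trace F₀ F x := fun x =>
    Algebra.trace_eq_of_algEquiv c x
  obtain ⟨r, hr⟩ := (hfix (z + T.conj z)).mp (by rw [map_add, T.conj_invol, add_comm])
  have h1 : Algebra.trace F₀ F (z + T.conj z) = 2 * r := by
    rw [← hr]
    show Algebra.trace F₀ F (algebraMap F₀ F r) = _
    rw [Algebra.trace_algebraMap, hdeg]; simp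
  rw [map_add, key, ← two_mul] at h1
  have h2' : (2:F₀) ≠ 0 := by
    intro h; apply h2
    rw [← map_ofNat (algebraMap F₀ F), h, map_zero]
  rw [mul_left_cancel₀ h2' h1]; exact hr

end tr
end U17

namespace U17
open USetting

variable {F : Type u} [Field F] {T : USetting F (Fin 4 → F)}

/-- good index pairs -/
def Good (n : ℤ) (p q : Fin 4) : Prop :=
  (n % 3 = 1 ∧ p = 0 ∧ q = 3) ∨ (n % 3 = 2 ∧ p = 3 ∧ q = 0)

lemma exists_good {n : ℤ} (hn3 : Int.gcd n 3 = 1) : ∃ p q, Good n p q := by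
  have h : n % 3 = 1 ∨ n % 3 = 2 := by
    by_contra hh
    have h3 : (3:ℤ) ∣ n := by omega
    have := Int.dvd_coe_gcd h3 (dvd_refl 3)
    rw [hn3] at this
    omega
  rcases h with h | h
  · exact ⟨0, 3, Or.inl ⟨h, rfl, rfl⟩⟩
  · exact ⟨3, 0, Or.inr ⟨h, rfl, rfl⟩⟩

lemma α40 : α4 0 = 3 := rfl
lemma α41 : α4 1 = 5 := rfl
lemma α42 : α4 2 = 2 := rfl
lemma α43 : α4 3 = 1 := rfl
lemma α50 : α5 0 = 3 := rfl
lemma α51 : α5 1 = 4 := rfl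
lemma α52 : α5 2 = 1 := rfl
lemma α53 : α5 3 = -1 := rfl

lemma Good.spec {n : ℤ} {p q : Fin 4} (h : Good n p q) :
    6 ∣ α4 q - α4 p + 2 * n ∧ 6 ∣ α4 1 - α4 q + 2 * n ∧ 6 ∣ α4 p - α4 1 + 2 * n ∧
    (∀ i : ℤ, i % 2 = 1 → 6 ∣ α4 p - i ∨ 6 ∣ α4 q - i ∨ 6 ∣ α4 1 - i) := by
  rcases h with ⟨h, rfl, rfl⟩ | ⟨h, rfl, rfl⟩
  · rw [α40, α41, α43]; refine ⟨by omega, by omega, by omega, fun i hi => by omega⟩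
  · rw [α40, α41, α43]; refine ⟨by omega, by omega, by omega, fun i hi => by omega⟩

lemma step {α : Fin 4 → ℤ} (hα : α = α4 ∨ α = α5) {Λ : T.LatSeq} (hs : Std T α Λ) {i : ℤ} {k : Fin 4} (hk : 6 ∣ α k - i)
    {v} (hv : v ∈ Λ.L i) : v - v k • Pi.single k 1 ∈ Λ.L (i+1) := by
  have hv' := (hs _ _).mp hv
  rw [hs]
  intro j
  by_cases h : j = k
  · subst h; simp
  · have : (α j - (i+1)) / 6 = (α j - i)/6 := by
      have : ¬ (6 ∣ α j - α k) := by
        rcases hα with rfl | rfl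
        · fin_cases j <;> fin_cases k <;> simp [α4] at * 
        · fin_cases j <;> fin_cases k <;> simp [α5] at * 
      omega
    rw [this]
    simpa [h] using hv' j

lemma step0 {α : Fin 4 → ℤ} {Λ : T.LatSeq} (hs : Std T α Λ) {i : ℤ} (hk : ∀ k, ¬ 6 ∣ α k - i)
    {v} (hv : v ∈ Λ.L i) : v ∈ Λ.L (i+1) := by
  have hv' := (hs _ _).mp hv
  rw [hs]
  intro j
  have : (α j - (i+1)) / 6 = (α j - i)/6 := by
    have := hk j
    omega
  rw [this]; exact hv' j

lemma stepβ {Λ : T.LatSeq} (hs : Std T α4 Λ) {n i : ℤ} {β : EE F} (hβ : β ∈ T.aFil Λ (-(2*n)))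
    {k l : Fin 4} (hk : 6 ∣ α4 k - i) (hl : 6 ∣ α4 l - α4 k + 2*n) {v} (hv : v ∈ Λ.L i) :
    β v - (v k * ent β l k) • Pi.single l 1 ∈ Λ.L (i - 2*n + 1) := by
  have h1 := step (Or.inl rfl) hs hk hv
  have h2 : v k • (Pi.single k 1 : Fin 4 → F) ∈ Λ.L i := by
    have := L_sub Λ hv (Λ.dec _ h1)
    simpa using this
  have h3 := hβ _ _ h1
  have h4 := step (Or.inl rfl) hs (k := l) (by omega) (hβ _ _ h2)
  have h5 := Λ.add_mem _ _ _ (L_anti Λ (i := i - 2*n+1) (by omega) h3) (L_anti Λ (i := i - 2*n+1) (by omega) h4)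
  convert h5 using 1
  simp only [map_sub, map_smul, ent]
  simp

/-- the leading coefficient -/
def ucoef (T : USetting F (Fin 4 → F)) (n : ℤ) (p q : Fin 4) (β : EE F) : F :=
  T.ϖ ^ n * (ent β q p * ent β 1 q * ent β p 1)

def yE (T : USetting F (Fin 4 → F)) (n : ℤ) (β : EE F) : EE F := T.ϖ ^ n • β ^ 3

lemma step3 {Λ : T.LatSeq} (hs : Std T α4 Λ) {n i : ℤ} {β : EE F} (hβ : β ∈ T.aFil Λ (-(2*n)))
    {k l m : Fin 4} (hk : 6 ∣ α4 k - i) (hl : 6 ∣ α4 l - α4 k + 2*n) (hm : 6 ∣ α4 m - α4 l + 2*n)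
    (hkm : 6 ∣ α4 k - α4 m + 2*n) {v} (hv : v ∈ Λ.L i) :
    (β ^ 3) v - (ent β l k * ent β m l * ent β k m) • v ∈ Λ.L (i - 6*n + 1) := by
  have h1 := stepβ hs hβ hk hl hv
  have h1' : (v k * ent β l k) • (Pi.single l 1 : Fin 4 → F) ∈ Λ.L (i - 2*n) := by
    have := L_sub Λ (L_anti Λ (i := i - 2*n) (by omega) (hβ _ _ hv)) (Λ.dec _ h1)
    simpa using this
  have h2 := stepβ hs hβ (by omega) hm h1'
  have h2' : (v k * ent β l k * ent β m l) • (Pi.single m 1 : Fin 4 → F) ∈ Λ.L (i - 2*n - 2*n) := by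
    have := L_sub Λ (L_anti Λ (i := i - 2*n - 2*n) (by omega) (hβ _ _ h1')) (Λ.dec _ h2)
    simpa using this
  have h3 := stepβ hs hβ (by omega) hkm h2'
  have h4 : v k • (Pi.single k 1 : Fin 4 → F) - v ∈ Λ.L (i+1) := by
    rw [← neg_sub]; exact L_neg Λ (step (Or.inl rfl) hs hk hv)
  -- the scalar has valuation
  have hc : T.ϖ ^ n * (ent β l k * ent β m l * ent β k m) ∈ T.O := by
    have a1 := (aFil_iff hs).mp hβ l k
    have a2 := (aFil_iff hs).mp hβ m l
    have a3 := (aFil_iff hs).mp hβ k m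
    exact zp_mul T (zp_mul T a1 a2 le_rfl) a3 (by omega)
  have h5 : (ent β l k * ent β m l * ent β k m) • (v k • (Pi.single k 1 : Fin 4 → F) - v) ∈ Λ.L (i - 6*n + 1) := by
    have h4' := (hs _ _).mp h4
    rw [hs]
    intro j
    rw [Pi.smul_apply, smul_eq_mul]
    refine zp_mul T hc (h4' j) (by omega)
  have b1 := L_anti Λ (i := i - 6*n + 1) (by omega) (hβ _ _ (hβ _ _ h1))
  have b2 := L_anti Λ (i := i - 6*n + 1) (by omega) (hβ _ _ h2)
  have b3 := L_anti Λ (i := i - 6*n + 1) (by omega) h3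
  have := Λ.add_mem _ _ _ (Λ.add_mem _ _ _ (Λ.add_mem _ _ _ b1 b2) b3) h5
  convert this using 1
  have e3 : (β ^ 3) v = β (β (β v)) := by
    rw [pow_succ, pow_two]; rfl
  rw [e3]
  simp only [map_sub, map_smul, Pi.smul_apply, Pi.single_eq_same, smul_eq_mul, mul_one, smul_sub, smul_smul]
  rw [show ent β l k * ent β m l * ent β k m * v k = v k * ent β l k * ent β m l * ent β k m by ring]
  abel

lemma smul_zp {α} {Λ : T.LatSeq} (hs : Std T α Λ) {i : ℤ} (n : ℤ) {v} (hv : v ∈ Λ.L i) :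
    T.ϖ ^ n • v ∈ Λ.L (i + 6*n) := by
  rw [hs] at *
  intro j
  rw [Pi.smul_apply, smul_eq_mul, zpe]
  exact zp_mono T (hv j) (by omega)

lemma y_odd {Λ : T.LatSeq} (hs : Std T α4 Λ) {n i : ℤ} {p q} (hg : Good n p q) {β : EE F}
    (hβ : β ∈ T.aFil Λ (-(2*n))) (hi : i % 2 = 1) {v} (hv : v ∈ Λ.L i) :
    yE T n β v - ucoef T n p q β • v ∈ Λ.L (i+1) := by
  obtain ⟨g1, g2, g3, g4⟩ := hg.spec
  have : (β ^ 3) v - (ent β q p * ent β 1 q * ent β p 1) • v ∈ Λ.L (i - 6*n + 1) := by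
    rcases g4 i hi with h | h | h
    · exact step3 hs hβ h g1 g2 g3 hv
    · have := step3 hs hβ h g2 g3 g1 hv
      rwa [show ent β q p * ent β 1 q * ent β p 1 = ent β 1 q * ent β p 1 * ent β q p by ring]
    · have := step3 hs hβ h g3 g1 g2 hv
      rwa [show ent β q p * ent β 1 q * ent β p 1 = ent β p 1 * ent β q p * ent β 1 q by ring]
  have := smul_zp hs n this
  rw [show i - 6*n+1+6*n = i+1 by ring, smul_sub, smul_smul] at this
  exact this

lemma Good.nmod {n p q} (h : Good n p q) : n % 3 = 1 ∨ n % 3 = 2 := by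
  rcases h with h | h
  · exact Or.inl h.1
  · exact Or.inr h.1

lemma α4_even {i : ℤ} (hi : i % 6 = 0 ∨ i % 6 = 4) (k) : ¬ 6 ∣ α4 k - i := by
  fin_cases k <;> simp [α4] <;> omega

lemma α5_even {i : ℤ} (hi : i % 6 = 0 ∨ i % 6 = 2) (k) : ¬ 6 ∣ α5 k - i := by
  fin_cases k <;> simp [α5] <;> omega

lemma yE_mem {α} {Λ : T.LatSeq} (hs : Std T α Λ) {n : ℤ} {β : EE F}
    (hβ : β ∈ T.aFil Λ (-(2*n))) : yE T n β ∈ T.aFil Λ 0 := by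
  intro i v hv
  have h := smul_zp hs n (hβ _ _ (hβ _ _ (hβ _ _ hv)))
  rw [show i + -(2*n) + -(2*n) + -(2*n) + 6*n = i + 0 by ring] at h
  convert h using 1
  show T.ϖ ^ n • (β ^ 3) v = _
  rw [pow_succ, pow_two]; rfl

lemma y_even {Λ : T.LatSeq} (hs : Std T α4 Λ) {n i : ℤ} {p q} (hg : Good n p q) {β : EE F}
    (hβ : β ∈ T.aFil Λ (-(2*n))) (hi : i % 2 = 0) {v} (hv : v ∈ Λ.L i) :
    yE T n β v ∈ Λ.L (i+1) := by
  have hy := yE_mem hs hβ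
  by_cases h2 : i % 6 = 2
  · have h1 := hβ _ _ hv
    have h2 := step0 hs (α4_even (by have := hg.nmod; omega)) h1
    have h3 := smul_zp hs n (hβ _ _ (hβ _ _ h2))
    rw [show i + -(2*n) + 1 + -(2*n) + -(2*n) + 6*n = i + 1 by ring] at h3
    convert h3 using 1
    show T.ϖ ^ n • (β ^ 3) v = _
    rw [pow_succ, pow_two]; rfl
  · have h1 := hy _ _ (step0 hs (α4_even (by omega)) hv)
    simpa using h1

/-- same idea for Λ5 at index 4 : `y` kills the graded piece -/
lemma y5 {Λ : T.LatSeq} (hs : Std T α5 Λ) {n i : ℤ} {p q} (hg : Good n p q) {γ : EE F}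
    (hγ : γ ∈ T.aFil Λ (-(2*n))) (hi : i % 6 = 4) {v} (hv : v ∈ Λ.L i) :
    yE T n γ v ∈ Λ.L (i+1) := by
  have h1 := hγ _ _ hv
  have h2 := step0 hs (α5_even (by have := hg.nmod; omega)) h1
  have h3 := smul_zp hs n (hγ _ _ (hγ _ _ h2))
  rw [show i + -(2*n) + 1 + -(2*n) + -(2*n) + 6*n = i + 1 by ring] at h3
  convert h3 using 1
  show T.ϖ ^ n • (γ ^ 3) v = _
  rw [pow_succ, pow_two]; rfl

lemma ucoef_mem {Λ : T.LatSeq} (hs : Std T α4 Λ) {n : ℤ} {p q} (hg : Good n p q) {β : EE F}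
    (hβ : β ∈ T.aFil Λ (-(2*n))) : ucoef T n p q β ∈ T.O := by
  have a1 := (aFil_iff hs).mp hβ q p
  have a2 := (aFil_iff hs).mp hβ 1 q
  have a3 := (aFil_iff hs).mp hβ p 1
  obtain ⟨g1, g2, g3, g4⟩ := hg.spec
  exact zp_mul T (zp_mul T a1 a2 le_rfl) a3 (by omega)

lemma pF_pow {x : F} (hx : x ∈ T.O) {m : ℕ} (h : x ^ m ∈ T.pF) : x ∈ T.pF := by
  rcases unit_or_pF T hx with h1 | ⟨h0, h1⟩
  · exact h1
  · exfalso
    apply one_not_pF T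
    obtain ⟨z, hz, hh⟩ := h
    refine ⟨z * (x⁻¹) ^ m, T.O.mul_mem hz (T.O.pow_mem h1 m), ?_⟩
    rw [← mul_assoc, ← hh, ← mul_pow, mul_inv_cancel₀ h0, one_pow]

lemma charpoly_nil {Λ : T.LatSeq} (hs : Std T α4 Λ) {y : EE F} (hy : y ∈ T.aFil Λ 1) (i : ℕ)
    (hi : i < 4) : y.charpoly.coeff i ∈ T.pF := by
  have hent : ∀ j k, ent y j k ∈ T.O := by
    intro j k
    have := (aFil_iff hs).mp hy j k
    have h2 := zp_mono T this (b := 0) (by fin_cases j <;> fin_cases k <;> simp [α4])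
    simpa using h2
  let M : Matrix (Fin 4) (Fin 4) T.O := fun j k => ⟨ent y j k, hent j k⟩
  let I : Ideal T.O := Ideal.span {(⟨T.ϖ, T.ϖ_mem⟩ : T.O)}
  have hM : M.map T.O.subtype = LinearMap.toMatrix' y := by
    ext j k; rfl
  have hy6 : y ^ 6 ∈ T.aFil Λ 6 := by
    have : ∀ m : ℕ, y ^ m ∈ T.aFil Λ m := by
      intro m
      induction m with
      | zero => simpa using aFil_one
      | succ m ih => rw [pow_succ]; exact aFil_mul ih hy (by push_cast; ring)
    exact this 6
  have hM6 : (M.map (Ideal.Quotient.mk I)) ^ 6 = 0 := by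
    rw [← RingHom.mapMatrix_apply, ← map_pow]
    ext j k
    rw [RingHom.mapMatrix_apply, Matrix.map_apply, Matrix.zero_apply, Ideal.Quotient.eq_zero_iff_mem]
    have h1 : ((M ^ 6) j k : F) = ent (y ^ 6) j k := by
      have : (M ^ 6).map T.O.subtype = LinearMap.toMatrix' (y ^ 6) := by
        rw [← RingHom.mapMatrix_apply, map_pow, RingHom.mapMatrix_apply, hM]
        exact (map_pow LinearMap.toMatrixAlgEquiv' y 6).symm
      exact congrFun (congrFun this j) k
    have h2 := (aFil_iff hs).mp hy6 j k
    have h3 := zp_mono T h2 (b := -1) (by fin_cases j <;> fin_cases k <;> simp [α4])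
    rw [← h1, ← mem_pF] at h3
    obtain ⟨z, hz, h⟩ := h3
    exact Ideal.mem_span_singleton.mpr ⟨⟨z, hz⟩, Subtype.ext h⟩
  have hn := Matrix.isNilpotent_charpoly_sub_pow_of_isNilpotent (⟨6, hM6⟩ : IsNilpotent (M.map (Ideal.Quotient.mk I)))
  rw [Polynomial.isNilpotent_iff] at hn
  obtain ⟨m, hm⟩ := hn i
  rw [Polynomial.coeff_sub, Polynomial.coeff_X_pow, if_neg (by simp; omega), sub_zero,
    Matrix.charpoly_map, Polynomial.coeff_map, ← map_pow, Ideal.Quotient.eq_zero_iff_mem] at hm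
  obtain ⟨z, hz⟩ := Ideal.mem_span_singleton.mp hm
  have hc : y.charpoly = M.charpoly.map T.O.subtype := by
    rw [← Matrix.charpoly_map, hM, ← LinearMap.toMatrix_eq_toMatrix', LinearMap.charpoly_toMatrix]
  rw [hc, Polynomial.coeff_map]
  apply pF_pow (m := m) (M.charpoly.coeff i).2
  exact ⟨z, z.2, congrArg Subtype.val hz⟩

lemma ybeta_eq {Λ : T.LatSeq} (he : Λ.e = 6) {n : ℤ} (hn : 0 < n) (hn3 : Int.gcd n 3 = 1) (β : EE F) :
    T.ybeta Λ (2*n) β = yE T n β := by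
  have hg : Int.gcd 6 (2*n) = 2 := by
    rw [show (6:ℤ) = 2 * 3 by norm_num, Int.gcd_mul_left, Int.gcd_comm, hn3]; rfl
  unfold ybeta yE
  rw [he, hg]
  have h1 : (2 * n / ((2:ℕ):ℤ)) = n := by push_cast; omega
  rw [h1]
  congr 1
  rw [← zpow_natCast, Int.toNat_of_nonneg hn.le]

lemma u_unit {Λ : T.LatSeq} (hs : Std T α4 Λ) (he : Λ.e = 6) {n : ℤ} (hn : 0 < n) (hn3 : Int.gcd n 3 = 1)
    {p q} (hg : Good n p q) {β : EE F} (hβ : β ∈ T.aFil Λ (-(2*n))) (hf : T.IsFundamental Λ (2*n) β) :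
    ucoef T n p q β ∉ T.pF := by
  intro hu
  apply hf
  intro i hi
  rw [ybeta_eq he hn hn3]
  apply charpoly_nil hs _ i (by simpa using hi)
  intro i v hv
  by_cases h : i % 2 = 1
  · have h1 := y_odd hs hg hβ h hv
    obtain ⟨z, hz, hh⟩ := hu
    have h2 : ucoef T n p q β • v ∈ Λ.L (i+1) := by
      rw [hh, mul_comm, mul_smul]
      apply Λ.smul_mem _ _ hz
      have := smul_zp hs 1 hv
      rw [zpow_one] at this
      exact L_anti Λ (by omega) this
    have := Λ.add_mem _ _ _ h1 h2
    simpa using this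
  · exact y_even hs hg hβ (by omega) hv

/-- consequence: the entry `β_{qp}` is exactly `unit * ϖ^r`. -/
lemma ent_unit {Λ : T.LatSeq} (hs : Std T α4 Λ) {n : ℤ}
    {p q} (hg : Good n p q) {β : EE F} (hβ : β ∈ T.aFil Λ (-(2*n)))
    (hu : ucoef T n p q β ∉ T.pF) :
    T.ϖ ^ ((α4 q - α4 p + 2*n)/6) * ent β q p ∈ T.O ∧ T.ϖ ^ ((α4 q - α4 p + 2*n)/6) * ent β q p ∉ T.pF := by
  obtain ⟨g1, g2, g3, g4⟩ := hg.spec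
  have a1 := (aFil_iff hs).mp hβ q p
  have a2 := (aFil_iff hs).mp hβ 1 q
  have a3 := (aFil_iff hs).mp hβ p 1
  rw [sub_neg_eq_add] at a1
  refine ⟨a1, fun h => hu ?_⟩
  rw [mem_pF, zpe] at h
  rw [mem_pF]
  unfold ucoef
  rw [zpe]
  exact zp_mul T (zp_mul T h a2 le_rfl) a3 (by omega)

lemma Good.ne {n p q} (h : Good n p q) : p ≠ q := by
  rcases h with ⟨_, rfl, rfl⟩ | ⟨_, rfl, rfl⟩ <;> decide

/-- perturbation keeps u mod p -/
lemma u_pert {Λ : T.LatSeq} (hs : Std T α4 Λ) {n : ℤ} (hn : 0 < n)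
    {p q} (hg : Good n p q) {β β' : EE F} (hβ : β ∈ T.aFil Λ (-(2*n)))
    (hd : β' - β ∈ T.aFil Λ (-n)) (hu : ucoef T n p q β ∉ T.pF) : ucoef T n p q β' ∉ T.pF := by
  obtain ⟨g1, g2, g3, g4⟩ := hg.spec
  intro h
  apply hu
  have hβ' : β' ∈ T.aFil Λ (-(2*n)) := by
    have := aFil_add hβ (aFil_anti hd (m' := -(2*n)) (by omega))
    simpa using this
  have a : ∀ j k, T.ϖ ^ ((α4 j - α4 k + 2*n)/6) * ent β j k ∈ T.O := by
    intro j k; have := (aFil_iff hs).mp hβ j k; rwa [sub_neg_eq_add] at this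
  have a' : ∀ j k, T.ϖ ^ ((α4 j - α4 k + 2*n)/6) * ent β' j k ∈ T.O := by
    intro j k; have := (aFil_iff hs).mp hβ' j k; rwa [sub_neg_eq_add] at this
  have b : ∀ j k, 6 ∣ α4 j - α4 k + 2*n → T.ϖ ^ ((α4 j - α4 k + 2*n)/6 - 1) * (ent β' j k - ent β j k) ∈ T.O := by
    intro j k hd6
    have := (aFil_iff hs).mp hd j k
    have e : ent (β' - β) j k = ent β' j k - ent β j k := rfl
    rw [e] at this
    exact zp_mono T this (by omega)
  rw [mem_pF] at h ⊢
  unfold ucoef at *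
  rw [zpe] at *
  have e : ent β q p * ent β 1 q * ent β p 1 = ent β' q p * ent β' 1 q * ent β' p 1
     + (-((ent β' q p - ent β q p) * ent β' 1 q * ent β' p 1) + (-(ent β q p * (ent β' 1 q - ent β 1 q) * ent β' p 1)
     + -(ent β q p * ent β 1 q * (ent β' p 1 - ent β p 1)))) := by ring
  rw [e]
  refine zp_add T h (zp_add T (zp_neg T ?_) (zp_add T (zp_neg T ?_) (zp_neg T ?_)))
  · exact zp_mul T (zp_mul T (b _ _ g1) (a' _ _) le_rfl) (a' _ _) (by omega)
  · exact zp_mul T (zp_mul T (a _ _) (b _ _ g2) le_rfl) (a' _ _) (by omega)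
  · exact zp_mul T (zp_mul T (a _ _) (a _ _) le_rfl) (b _ _ g3) (by omega)

end U17

namespace U17
open USetting

variable {F : Type u} [Field F] (T : USetting F (Fin 4 → F))

/-- coarse valuation ring -/
def Oc : ValuationSubring F where
  carrier := {x | ∃ k : ℕ, T.ϖ ^ (k:ℤ) * x ∈ T.O}
  mul_mem' := by
    rintro x y ⟨k, hk⟩ ⟨l, hl⟩
    exact ⟨k + l, zp_mul T hk hl (by push_cast; omega)⟩
  one_mem' := ⟨0, by simp⟩
  add_mem' := by
    rintro x y ⟨k, hk⟩ ⟨l, hl⟩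
    exact ⟨k + l, zp_add T (zp_mono T hk (by push_cast; omega)) (zp_mono T hl (by push_cast; omega))⟩
  zero_mem' := ⟨0, by simp⟩
  neg_mem' := by
    rintro x ⟨k, hk⟩
    exact ⟨k, zp_neg T hk⟩
  mem_or_inv_mem' := by
    intro x
    by_cases hx : x = 0
    · left; exact ⟨0, by simp [hx]⟩
    · rcases T.O_val x hx with h | h
      · exact Or.inl ⟨0, by simpa using h⟩
      · exact Or.inr ⟨0, by simpa using h⟩

lemma mem_Oc {x : F} : x ∈ Oc T ↔ ∃ k : ℕ, T.ϖ ^ (k:ℤ) * x ∈ T.O := Iff.rfl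

def vc : Valuation F (Oc T).ValueGroup := (Oc T).valuation

variable {T}

lemma vc_le_one {x : F} : vc T x ≤ 1 ↔ x ∈ Oc T := (Oc T).valuation_le_one_iff x

lemma O_le {x : F} (h : x ∈ T.O) : vc T x ≤ 1 := vc_le_one.mpr ⟨0, by simpa using h⟩

lemma zO_le {k : ℤ} {x : F} (h : T.ϖ ^ k * x ∈ T.O) : vc T x ≤ 1 := by
  rw [vc_le_one, mem_Oc]
  exact ⟨k.toNat, zp_mono T h (Int.self_le_toNat k)⟩

lemma vc_unit {x : F} (h0 : x ≠ 0) (h : x ∈ T.O) (h' : x⁻¹ ∈ T.O) : vc T x = 1 := by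
  apply le_antisymm (O_le h)
  have := O_le h'
  rw [map_inv₀] at this
  have h1 : vc T x ≠ 0 := (Valuation.ne_zero_iff _).mpr h0
  rwa [inv_le_one₀ (zero_lt_iff.mpr h1)] at this

lemma vc_ϖ : vc T T.ϖ = 1 := by
  apply le_antisymm (O_le T.ϖ_mem)
  have : vc T (T.ϖ⁻¹) ≤ 1 := zO_le (k := 1) (by simp [T.ϖ_ne_zero])
  rw [map_inv₀] at this
  have h1 : vc T T.ϖ ≠ 0 := (Valuation.ne_zero_iff _).mpr T.ϖ_ne_zero
  rwa [inv_le_one₀ (zero_lt_iff.mpr h1)] at this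

lemma vc_zpow (k : ℤ) : vc T (T.ϖ ^ k) = 1 := by rw [map_zpow₀, vc_ϖ, one_zpow]

lemma vc_lt_mem {x : F} (h : vc T x < 1) (k : ℤ) : T.ϖ ^ k * x ∈ T.O := by
  by_cases h0 : x = 0
  · simp [h0]
  rcases T.O_val (T.ϖ ^ k * x) (mul_ne_zero (zpow_ne_zero _ T.ϖ_ne_zero) h0) with h1 | h1
  · exact h1
  · exfalso
    have := O_le h1
    rw [map_inv₀, map_mul, vc_zpow, one_mul] at this
    have h2 : vc T x ≠ 0 := (Valuation.ne_zero_iff _).mpr h0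
    rw [inv_le_one₀ (zero_lt_iff.mpr h2)] at this
    exact absurd h (not_lt.mpr this)

lemma vc_conj (hc : T.conj T.ϖ = T.ϖ) (x : F) : vc T (T.conj x) = vc T x := by
  by_cases h0 : x = 0
  · simp [h0]
  have h0' : T.conj x ≠ 0 := by simpa using h0
  have key : ∀ a : F, a ≠ 0 → T.conj a = a⁻¹ → vc T a = 1 := by
    intro a ha hh
    rcases T.O_val a ha with h | h
    · exact vc_unit ha h (hh ▸ T.conj_O _ h)
    · have := T.conj_O _ h
      rw [map_inv₀, hh, inv_inv] at this
      exact vc_unit ha this h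
  have := key (T.conj x / x) (div_ne_zero h0' h0) (by rw [map_div₀, T.conj_invol, inv_div])
  rw [map_div₀] at this
  have h2 : vc T x ≠ 0 := (Valuation.ne_zero_iff _).mpr h0
  rwa [div_eq_one_iff_eq h2] at this

lemma vc_one_add {r : F} (h : r ∈ T.pF) : vc T (1 + r) = 1 := by
  have hO : 1 + r ∈ T.O := T.O.add_mem T.O.one_mem (pF_sub_O T h)
  rcases unit_or_pF T hO with h1 | ⟨h1, h2⟩
  · exfalso
    apply one_not_pF T
    rw [mem_pF] at *
    have := zp_add T h1 (zp_neg T h)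
    simpa using this
  · exact vc_unit h1 hO h2

lemma aniso (hc : T.conj T.ϖ = T.ϖ) (a b : F) :
    vc T a * vc T a ≤ vc T (T.ϖ * (T.conj a * a) + T.conj b * b) ∧
    vc T b * vc T b ≤ vc T (T.ϖ * (T.conj a * a) + T.conj b * b) := by
  by_cases ha : a = 0
  · subst ha; simp [vc_conj hc]
  by_cases hb : b = 0
  · subst hb; simp [vc_conj hc, vc_ϖ]
  have ha' : T.conj a ≠ 0 := by simpa using ha
  have hb' : T.conj b ≠ 0 := by simpa using hb
  rcases inv_or_pF T (x := b / a) with h | ⟨-, h⟩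
  · have hr : (T.conj b * b) / (T.ϖ * (T.conj a * a)) ∈ T.pF := by
      rw [mem_pF] at *
      have h1 := zp_mul T (zp_conj T hc h) h (c := -2) (by norm_num)
      have e : (T.conj b * b) / (T.ϖ * (T.conj a * a)) = T.ϖ ^ (-1:ℤ) * (T.conj (b/a) * (b/a)) := by
        rw [map_div₀, zpow_neg_one]; field_simp
      rw [e, zpe]; exact h1
    have e : T.ϖ * (T.conj a * a) + T.conj b * b = T.ϖ * (T.conj a * a) * (1 + (T.conj b * b) / (T.ϖ * (T.conj a * a))) := by
      have := T.ϖ_ne_zero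
      field_simp
    have h2 : vc T b ≤ vc T a := by
      have := O_le (pF_sub_O T h)
      rw [map_div₀] at this
      exact (div_le_one₀ (zero_lt_iff.mpr ((Valuation.ne_zero_iff _).mpr ha))).mp this
    rw [e, map_mul, vc_one_add hr, map_mul, map_mul, vc_ϖ, vc_conj hc, one_mul, mul_one]
    exact ⟨le_rfl, mul_le_mul' h2 h2⟩
  · rw [inv_div] at h
    have hr : (T.ϖ * (T.conj a * a)) / (T.conj b * b) ∈ T.pF := by
      refine ⟨T.conj (a/b) * (a/b), T.O.mul_mem (T.conj_O _ h) h, ?_⟩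
      rw [map_div₀]; field_simp
    have e : T.ϖ * (T.conj a * a) + T.conj b * b = (T.conj b * b) * (1 + (T.ϖ * (T.conj a * a)) / (T.conj b * b)) := by
      field_simp
      ring
    have h2 : vc T a ≤ vc T b := by
      have := O_le h
      rw [map_div₀] at this
      exact (div_le_one₀ (zero_lt_iff.mpr ((Valuation.ne_zero_iff _).mpr hb))).mp this
    rw [e, map_mul, vc_one_add hr, map_mul, vc_conj hc, mul_one]
    exact ⟨mul_le_mul' h2 h2, le_rfl⟩

def PQ (p q : Fin 4) : Prop := (p = 0 ∧ q = 3) ∨ (p = 3 ∧ q = 0)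

lemma form_pq (hf : T.IsU4Form) {p q} (hpq : PQ p q) (v w) : T.h v w =
    T.conj (v p) * w q + T.conj (v q) * w p + (T.ϖ * (T.conj (v 1) * w 1) + T.conj (v 2) * w 2) := by
  rw [hf]
  rcases hpq with ⟨rfl, rfl⟩ | ⟨rfl, rfl⟩ <;> ring

lemma PQ.cases {p q} (hpq : PQ p q) (j) : j = p ∨ j = q ∨ j = 1 ∨ j = 2 := by
  rcases hpq with ⟨rfl, rfl⟩ | ⟨rfl, rfl⟩ <;> fin_cases j <;> simp

lemma PQ.ne {p q} (hpq : PQ p q) : p ≠ q ∧ p ≠ 1 ∧ p ≠ 2 ∧ q ≠ 1 ∧ q ≠ 2 := by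
  rcases hpq with ⟨rfl, rfl⟩ | ⟨rfl, rfl⟩ <;> decide

lemma iso_bound (hf : T.IsU4Form) (hc : T.conj T.ϖ = T.ϖ) {p q} (hpq : PQ p q) {z} (hz : T.h z z = 0) :
    vc T (z 1) * vc T (z 1) ≤ vc T (z p) * vc T (z q) ∧
    vc T (z 2) * vc T (z 2) ≤ vc T (z p) * vc T (z q) := by
  rw [form_pq hf hpq] at hz
  have h1 : T.ϖ * (T.conj (z 1) * z 1) + T.conj (z 2) * z 2 = -(T.conj (z p) * z q + T.conj (z q) * z p) := by
    linear_combination hz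
  have h2 := aniso hc (z 1) (z 2)
  rw [h1, Valuation.map_neg] at h2
  have h3 : vc T (T.conj (z p) * z q + T.conj (z q) * z p) ≤ vc T (z p) * vc T (z q) := by
    apply Valuation.map_add_le
    · rw [map_mul, vc_conj hc]
    · rw [map_mul, vc_conj hc, mul_comm]
  exact ⟨h2.1.trans h3, h2.2.trans h3⟩

lemma iso_all_le (hf : T.IsU4Form) (hc : T.conj T.ϖ = T.ϖ) {p q} (hpq : PQ p q) {z} (hz : T.h z z = 0)
    (hp : vc T (z p) ≤ 1) (hq : vc T (z q) ≤ 1) (j) : vc T (z j) ≤ 1 := by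
  obtain ⟨h1, h2⟩ := iso_bound hf hc hpq hz
  have h3 : vc T (z p) * vc T (z q) ≤ 1 := mul_le_one' hp hq
  have key : ∀ x : (Oc T).ValueGroup, x * x ≤ 1 → x ≤ 1 := by
    intro x hx
    by_contra h
    push Not at h
    exact absurd hx (not_le.mpr (one_lt_mul'' h h))
  rcases hpq.cases j with rfl | rfl | rfl | rfl
  · exact hp
  · exact hq
  · exact key _ (h1.trans h3)
  · exact key _ (h2.trans h3)

lemma iso_all_lt (hf : T.IsU4Form) (hc : T.conj T.ϖ = T.ϖ) {p q} (hpq : PQ p q) {z} (hz : T.h z z = 0)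
    (hp : vc T (z p) ≤ 1) (hq : vc T (z q) < 1) (j) (hj : j ≠ p) : vc T (z j) < 1 := by
  obtain ⟨h1, h2⟩ := iso_bound hf hc hpq hz
  have h3 : vc T (z p) * vc T (z q) < 1 := by
    calc _ ≤ 1 * vc T (z q) := mul_le_mul_left hp _
      _ < 1 := by rwa [one_mul]
  have key : ∀ x : (Oc T).ValueGroup, x * x < 1 → x < 1 := by
    intro x hx
    by_contra h
    push Not at h
    exact absurd hx (not_lt.mpr (one_le_mul h h))
  rcases hpq.cases j with rfl | rfl | rfl | rfl
  · exact absurd rfl hj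
  · exact hq
  · exact key _ (h1.trans_lt h3)
  · exact key _ (h2.trans_lt h3)

/-! transvections -/
variable (T) in
def hlin (z : Fin 4 → F) : (Fin 4 → F) →ₗ[F] F where
  toFun := T.h z
  map_add' := h_add_right z
  map_smul' := fun c w => h_smul_right c z w

variable (T) in
def tvE (z : Fin 4 → F) (y : F) : EE F := 1 + (hlin T z).smulRight (y • z)

lemma tvE_apply (z : Fin 4 → F) (y : F) (u) : tvE T z y u = u + (y * T.h z u) • z := by
  show u + (T.h z u) • (y • z) = _
  rw [smul_smul, mul_comm]

lemma tvE_σ {z : Fin 4 → F} {y : F} (hy : T.conj y = -y) : T.σA (tvE T z y) = tvE T z (-y) := by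
  apply σ_unique'
  intro u w
  rw [tvE_apply, tvE_apply, T.h_add_left, T.h_smul_left, h_add_right, h_smul_right, map_mul, hy,
    ← T.h_conj_symm]
  ring

lemma tvE_mul {z : Fin 4 → F} (hz : T.h z z = 0) (a b : F) : tvE T z a * tvE T z b = tvE T z (a + b) := by
  apply LinearMap.ext
  intro u
  rw [Module.End.mul_apply, tvE_apply, tvE_apply, tvE_apply, h_add_right, h_smul_right, hz, mul_zero, add_zero,
    add_assoc, ← add_smul]
  congr 2; ring

lemma tvE_zero (z : Fin 4 → F) : tvE T z 0 = 1 := by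
  apply LinearMap.ext
  intro u
  simp [tvE_apply]

variable (T) in
def tv (z : Fin 4 → F) (y : F) : T.GU :=
  if h : T.h z z = 0 ∧ T.conj y = -y then
    mkG (tvE T z y) (by rw [tvE_σ h.2, tvE_mul h.1, neg_add_cancel, tvE_zero])
      (by rw [tvE_σ h.2, tvE_mul h.1, add_neg_cancel, tvE_zero])
  else 1

lemma tv_toE {z : Fin 4 → F} {y : F} (hz : T.h z z = 0) (hy : T.conj y = -y) :
    T.toE (tv T z y) = tvE T z y := by
  unfold tv
  rw [dif_pos ⟨hz, hy⟩]; rfl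

lemma tv_conj (g : T.GU) {z : Fin 4 → F} {y : F} (hz : T.h z z = 0) (hy : T.conj y = -y) :
    g * tv T z y = tv T (T.toE g z) y * g := by
  apply toE_inj
  rw [toE_mul, toE_mul, tv_toE hz hy, tv_toE (by rw [h_G, hz]) hy]
  apply LinearMap.ext
  intro u
  rw [Module.End.mul_apply, Module.End.mul_apply, tvE_apply, tvE_apply, h_G, map_add, map_smul]

lemma tv_smul {z : Fin 4 → F} {y : F} (hz : T.h z z = 0) (hy : T.conj y = -y) (c : F) :
    tv T (c • z) y = tv T z (T.conj c * c * y) := by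
  apply toE_inj
  rw [tv_toE (by rw [T.h_smul_left, h_smul_right, hz]; ring) hy,
    tv_toE hz (by rw [map_mul, map_mul, T.conj_invol, hy]; ring)]
  apply LinearMap.ext
  intro u
  rw [tvE_apply, tvE_apply, T.h_smul_left, smul_smul]
  congr 2; ring

end U17

namespace U17
open USetting

variable {F : Type u} [Field F] {T : USetting F (Fin 4 → F)}
variable {W : Type*} [AddCommGroup W] [Module ℂ W]

structure Dat (T : USetting F (Fin 4 → F)) (π : T.GU →* Module.End ℂ W) (v : W) (p q : Fin 4) (e : ℤ) (y0 s : F) (M0 : ℤ)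
    (θ : F → ℂ) : Prop where
  form : T.IsU4Form
  hc : T.conj T.ϖ = T.ϖ
  two : (2 : F) ≠ 0
  twoinv : (2 : F)⁻¹ ∈ T.O
  pq : PQ p q
  s0 : s ≠ 0
  sO : s ∈ T.O
  si : s⁻¹ ∈ T.O
  sc : T.conj s = -s
  F1 : ∀ z y, (∀ j, z j ∈ T.O) → T.h z z = 0 → T.conj y = -y → T.ϖ ^ (-M0) * y ∈ T.O → π (tv T z y) v = v
  F2 : ∀ z y, T.h z z = 0 → z p = 1 → (∀ j, j ≠ p → vc T (z j) < 1) → T.conj y = -y →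
    T.ϖ ^ (-e) * y ∈ T.O → π (tv T z y) v = θ y • v
  yc : T.conj y0 = -y0
  y0O : T.ϖ ^ (-e) * y0 ∈ T.O
  hθ : θ y0 ≠ 1
  hv : v ≠ 0

variable {π : T.GU →* Module.End ℂ W} {v : W} {p q : Fin 4} {e : ℤ} {y0 s : F} {M0 : ℤ} {θ : F → ℂ}

lemma π_mul (g k : T.GU) (w : W) : π (g * k) w = π g (π k w) := by rw [map_mul]; rfl

lemma π_inv {g : T.GU} {w : W} (h : π g w = w) : π g⁻¹ w = w := by
  conv_lhs => rw [← h]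
  rw [← π_mul, inv_mul_cancel, map_one]; rfl

lemma h_single_p (hf : T.IsU4Form) (hpq : PQ p q) (z) : T.h z (Pi.single p 1) = T.conj (z q) := by
  obtain ⟨h1, h2, h3, h4, h5⟩ := hpq.ne
  rw [form_pq hf hpq]; simp [h1.symm, h2.symm, h3.symm]

lemma PQ.symm {p q} (h : PQ p q) : PQ q p := by
  rcases h with ⟨rfl, rfl⟩ | ⟨rfl, rfl⟩
  · exact Or.inr ⟨rfl, rfl⟩
  · exact Or.inl ⟨rfl, rfl⟩

lemma h_single_self (hf : T.IsU4Form) (hpq : PQ p q) : T.h (Pi.single p 1) (Pi.single p 1) = 0 := by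
  rw [h_single_p hf hpq]; simp [hpq.ne.1.symm]

lemma single_O (p : Fin 4) (j) : (Pi.single p 1 : Fin 4 → F) j ∈ T.O := by
  by_cases h : j = p
  · subst h; simp
  · simp [h]

lemma skew_mul {r y : F} (hr : T.conj r = r) (hy : T.conj y = -y) : T.conj (r * y) = -(r * y) := by
  rw [map_mul, hr, hy, mul_neg]

lemma norm_fix (c : F) : T.conj (T.conj c * c) = T.conj c * c := by
  rw [map_mul, T.conj_invol, mul_comm]

lemma Dat.not_fix (D : Dat T π v p q e y0 s M0 θ) : π (tv T (Pi.single p 1) y0) v ≠ v := by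
  intro h
  rw [D.F2 (Pi.single p 1) y0 (h_single_self D.form D.pq) (by simp) (fun j hj => by simp [hj]) D.yc D.y0O] at h
  have : (θ y0 - 1) • v = 0 := by rw [sub_smul, h, one_smul, sub_self]
  rcases smul_eq_zero.mp this with h | h
  · exact D.hθ (sub_eq_zero.mp h)
  · exact D.hv h

/-- v is fixed by transvections along coarse-small vectors -/
lemma Dat.fix_small (D : Dat T π v p q e y0 s M0 θ) {z} (hz : T.h z z = 0) (hz1 : ∀ j, vc T (z j) < 1)
    {y : F} (hy : T.conj y = -y) (hyO : vc T y ≤ 1) : π (tv T z y) v = v := by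
  obtain ⟨k, hk⟩ := mem_Oc T |>.mp (vc_le_one.mp hyO)
  let K : ℤ := |M0| + k
  have e1 : z = T.ϖ ^ K • (T.ϖ ^ (-K) • z) := by
    rw [smul_smul, ← zpow_add₀ T.ϖ_ne_zero]; simp
  have hz' : T.h (T.ϖ ^ (-K) • z) (T.ϖ ^ (-K) • z) = 0 := by
    rw [T.h_smul_left, h_smul_right, hz]; ring
  rw [e1, tv_smul hz' hy, zpow_conj T D.hc]
  apply D.F1 _ _ _ hz'
  · apply skew_mul _ hy
    rw [map_mul, zpow_conj T D.hc]
  · rw [← zpow_add₀ T.ϖ_ne_zero, zpe]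
    apply zp_mono T hk
    have := neg_abs_le M0
    have := le_abs_self M0
    have := abs_nonneg M0
    simp only [K]; omega
  · intro j
    exact vc_lt_mem (hz1 j) _

lemma Dat.claim1 (D : Dat T π v p q e y0 s M0 θ) {z} (hz : T.h z z = 0)
    (hzq : vc T (z q) ≤ 1) (hprim : vc T (z p) = 1 ∨ vc T (z q) = 1)
    (hfix : ∀ y, T.conj y = -y → vc T y ≤ 1 → π (tv T z y) v = v) : False := by
  set M : ℤ := |M0| with hM
  have hMM : M0 ≤ M := le_abs_self M0
  have hss : T.conj (T.ϖ ^ M * s) = -(T.ϖ ^ M * s) := skew_mul (zpow_conj T D.hc M) D.sc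
  have hsO : T.ϖ ^ (-M0) * (T.ϖ ^ M * s) ∈ T.O := by
    rw [zpe]; exact T.O.mul_mem (zpow_mem T (by omega)) D.sO
  have hvs : vc T (T.ϖ ^ M * s) = 1 := by rw [map_mul, vc_zpow, vc_unit D.s0 D.sO D.si, one_mul]
  have hs0 : T.ϖ ^ M * s ≠ 0 := mul_ne_zero (zpow_ne_zero _ T.ϖ_ne_zero) D.s0
  set a' := T.ϖ ^ M * s with ha'
  have hpp := h_single_self D.form D.pq
  have hqq := h_single_self D.form D.pq.symm
  -- the vector e'
  obtain ⟨κ, hκ, hlam⟩ : ∃ κ : T.GU, π κ v = v ∧ vc T (T.h z (T.toE κ (Pi.single p 1))) = 1 := by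
    by_cases hq1 : vc T (z q) = 1
    · refine ⟨1, by simp, ?_⟩
      rw [toE_one, Module.End.one_apply, h_single_p D.form D.pq, vc_conj D.hc, hq1]
    · have hp1 : vc T (z p) = 1 := by tauto
      have hq1 : vc T (z q) < 1 := lt_of_le_of_ne hzq hq1
      refine ⟨tv T (Pi.single q 1) a', D.F1 _ _ (single_O q) hqq hss hsO, ?_⟩
      rw [tv_toE hqq hss, tvE_apply, h_add_right, h_smul_right, h_single_p D.form D.pq,
        h_single_p D.form D.pq.symm, h_single_p D.form D.pq]
      simp only [Pi.single_eq_same, map_one, mul_one]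
      have h1 : vc T (a' * T.conj (z p)) = 1 := by rw [map_mul, hvs, vc_conj D.hc, hp1, one_mul]
      rw [Valuation.map_add_eq_of_lt_right, h1]
      rw [h1, vc_conj D.hc]; exact hq1
  set e' := T.toE κ (Pi.single p 1) with he'
  have hee : T.h e' e' = 0 := by rw [he', h_G, hpp]
  set l := T.h z e' with hl
  have hl0 : l ≠ 0 := by intro h; rw [h] at hlam; simp at hlam
  have hlc0 : T.conj l ≠ 0 := by simpa using hl0
  -- v is fixed by tv e' y iff by tv e_p y
  have htr : ∀ y, T.conj y = -y → (π (tv T e' y) v = v ↔ π (tv T (Pi.single p 1) y) v = v) := by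
    intro y hy
    have h1 := tv_conj κ hpp hy
    have h2 : π κ (π (tv T (Pi.single p 1) y) v) = π (tv T e' y) v := by
      rw [← π_mul, h1, π_mul, hκ]
    rw [← h2]
    constructor
    · intro h
      have := congrArg (π κ⁻¹) h
      rw [← π_mul, inv_mul_cancel, map_one, π_inv hκ] at this
      exact this
    · intro h; rw [h, hκ]
  set a : F := -(a' * (T.conj l * l))⁻¹ with ha
  have hac : T.conj a = -a := by
    rw [ha, map_neg, map_inv₀, map_mul, norm_fix, hss]; simp [inv_neg]
  have hva : vc T a ≤ 1 := by
    rw [ha, Valuation.map_neg, map_inv₀, map_mul (vc T) a', hvs, map_mul, vc_conj D.hc, hlam]; simp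
  have f1 : π (tv T z a) v = v := hfix a hac hva
  have f2 : π (tv T e' a') v = v := (htr _ hss).mpr (D.F1 _ _ (single_O p) hpp hss hsO)
  set ρ : T.GU := tv T z a * (tv T e' a' * tv T z a) with hρ
  have hρv : π ρ v = v := by rw [hρ, π_mul, π_mul, f1, f2, f1]
  have hρz : T.toE ρ z = (a' * T.conj l) • e' := by
    rw [hρ, toE_mul, toE_mul, tv_toE hz hac, tv_toE hee hss, Module.End.mul_apply, Module.End.mul_apply]
    rw [tvE_apply z a z, hz, mul_zero, zero_smul, add_zero, tvE_apply, tvE_apply, h_add_right, h_smul_right, hz,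
      zero_add, T.h_conj_symm z e', ← hl]
    have : a * (a' * T.conj l * l) = -1 := by
      rw [ha]; field_simp
    rw [this]; simp
  set d := a' * T.conj l with hd
  have hd0 : d ≠ 0 := mul_ne_zero hs0 hlc0
  have hdc0 : T.conj d ≠ 0 := by simpa using hd0
  have hvd : vc T d = 1 := by rw [hd, map_mul, hvs, vc_conj D.hc, hlam, one_mul]
  set y := (T.conj d * d)⁻¹ * y0 with hy
  have hyc : T.conj y = -y := skew_mul (by rw [map_inv₀, norm_fix]) D.yc
  have hvy : vc T y ≤ 1 := by
    rw [hy, map_mul, map_inv₀, map_mul, vc_conj D.hc, hvd]; simpa using zO_le D.y0O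
  have f3 := hfix y hyc hvy
  have f4 := tv_conj ρ hz hyc
  rw [hρz, tv_smul hee hyc] at f4
  have f5 : T.conj d * d * y = y0 := by
    rw [hy, mul_inv_cancel_left₀]; exact mul_ne_zero hdc0 hd0
  rw [f5] at f4
  have f6 : π (tv T e' y0) v = v := by
    have := congrArg (fun g => π g v) f4
    simp only [π_mul, hρv, f3] at this
    exact this.symm
  exact D.not_fix ((htr _ D.yc).mp f6)

/-- the involution -/
def gE (p q : Fin 4) (t : F) : EE F where
  toFun z := fun j => if j = p then t⁻¹ * z q else if j = q then t * z p else z j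
  map_add' x y := by
    ext j; simp only [Pi.add_apply]; split_ifs <;> ring
  map_smul' c x := by
    ext j; simp only [Pi.smul_apply, smul_eq_mul, RingHom.id_apply]; split_ifs <;> ring

lemma gE_p (t : F) (z) : gE p q t z p = t⁻¹ * z q := by simp [gE]
lemma gE_q (hpq : PQ p q) (t : F) (z) : gE p q t z q = t * z p := by simp [gE, hpq.ne.1.symm]
lemma gE_1 (hpq : PQ p q) (t : F) (z) : gE p q t z 1 = z 1 := by
  simp [gE, hpq.ne.2.1.symm, hpq.ne.2.2.2.1.symm]
lemma gE_2 (hpq : PQ p q) (t : F) (z) : gE p q t z 2 = z 2 := by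
  simp [gE, hpq.ne.2.2.1.symm, hpq.ne.2.2.2.2.symm]

lemma gE_gE (hpq : PQ p q) {t : F} (ht : t ≠ 0) (z) : gE p q t (gE p q t z) = z := by
  ext j
  rcases hpq.cases j with rfl | rfl | rfl | rfl
  · rw [gE_p, gE_q hpq, inv_mul_cancel_left₀ ht]
  · rw [gE_q hpq, gE_p, mul_inv_cancel_left₀ ht]
  · rw [gE_1 hpq, gE_1 hpq]
  · rw [gE_2 hpq, gE_2 hpq]

lemma gE_σ (hf : T.IsU4Form) (hpq : PQ p q) {t : F} (ht : t ≠ 0) (htc : T.conj t = t) :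
    T.σA (gE p q t) = gE p q t := by
  apply σ_unique'
  intro u w
  rw [form_pq hf hpq, form_pq hf hpq]
  simp only [gE_p, gE_q hpq, gE_1 hpq, gE_2 hpq, map_mul, map_inv₀, htc]
  ring

lemma gE_mul (hpq : PQ p q) {t : F} (ht : t ≠ 0) : gE p q t * gE p q t = 1 :=
  LinearMap.ext fun z => gE_gE hpq ht z

def gG (hf : T.IsU4Form) (hpq : PQ p q) {t : F} (ht : t ≠ 0) (htc : T.conj t = t) : T.GU :=
  mkG (gE p q t) (by rw [gE_σ hf hpq ht htc, gE_mul hpq ht]) (by rw [gE_σ hf hpq ht htc, gE_mul hpq ht])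

end U17

namespace U17
open USetting

variable {F : Type u} [Field F] {T : USetting F (Fin 4 → F)}
variable {W : Type*} [AddCommGroup W] [Module ℂ W]
variable {π : T.GU →* Module.End ℂ W} {v : W} {p q : Fin 4} {e : ℤ} {y0 s : F} {M0 : ℤ} {θ : F → ℂ}

lemma gG_apply (hf : T.IsU4Form) (hpq : PQ p q) {t : F} (ht : t ≠ 0) (htc : T.conj t = t) (z) :
    T.toE (gG hf hpq ht htc) z = gE p q t z := rfl

/-- scalars on v and v' -/
lemma Dat.indep (D : Dat T π v p q e y0 s M0 θ) {t : F} (ht : t ≠ 0) (htc : T.conj t = t) (htv : vc T t < 1)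
    {a a' : ℂ} (hne : a ≠ 1 ∨ a' ≠ 1)
    (h : a • v + a' • π (gG D.form D.pq ht htc) v = v + π (gG D.form D.pq ht htc) v) : False := by
  set g := gG D.form D.pq ht htc with hg
  set v' := π g v with hv'
  have hpp := h_single_self D.form D.pq
  have hqq := h_single_self D.form D.pq.symm
  have hv'0 : v' ≠ 0 := by
    intro h0
    apply D.hv
    have := congrArg (π g⁻¹) h0
    rwa [hv', ← π_mul, inv_mul_cancel, map_one, map_zero] at this
  have fv' : π (tv T (Pi.single p 1) y0) v' = v' := by
    have h1 := tv_conj g (z := t • Pi.single q 1) (by rw [T.h_smul_left, h_smul_right, hqq]; ring) D.yc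
    have h2 : T.toE g (t • Pi.single q 1) = Pi.single p 1 := by
      rw [gG_apply]
      have hn := D.pq.ne
      ext j
      rcases D.pq.cases j with rfl | rfl | rfl | rfl
      · rw [gE_p]; simp [ht]
      · rw [gE_q D.pq]; simp [hn.1, hn.1.symm]
      · rw [gE_1 D.pq]; simp [hn.2.1.symm, hn.2.2.2.1.symm]
      · rw [gE_2 D.pq]; simp [hn.2.2.1.symm, hn.2.2.2.2.symm]
    rw [h2] at h1
    rw [hv', ← π_mul, ← h1, π_mul]
    congr 1
    rw [tv_smul hqq D.yc]
    apply D.F1 _ _ (single_O q) hqq (skew_mul (norm_fix t) D.yc)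
    apply vc_lt_mem
    have h3 := zO_le D.y0O
    rw [map_mul, map_mul, vc_conj D.hc]
    calc vc T t * vc T t * vc T y0 ≤ vc T t * 1 * 1 := by gcongr
      _ < 1 := by simpa using htv
  have h1 : (a - 1) • v = -((a' - 1) • v') := by
    rw [sub_smul, sub_smul, one_smul, one_smul, ← sub_eq_zero]
    rw [← sub_eq_zero] at h
    rw [← h]; abel
  by_cases ha : a = 1
  · rw [ha, sub_self, zero_smul, eq_comm, neg_eq_zero] at h1
    rcases smul_eq_zero.mp h1 with h2 | h2
    · have := sub_eq_zero.mp h2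
      tauto
    · exact hv'0 h2
  · have ha0 : a - 1 ≠ 0 := sub_ne_zero.mpr ha
    have h2 : v = (-((a-1)⁻¹ * (a' - 1))) • v' := by
      rw [neg_smul, mul_smul, ← smul_neg, ← h1, smul_smul, inv_mul_cancel₀ ha0, one_smul]
    apply D.not_fix
    rw [h2, map_smul, fv']

/-- normalization -/
lemma Dat.main (D : Dat T π v p q e y0 s M0 θ) {t : F} (ht : t ≠ 0) (htc : T.conj t = t) (htv : vc T t < 1)
    {z} (hz : T.h z z = 0) (M : ℤ)
    (hfix : ∀ y, T.conj y = -y → T.ϖ ^ (-M) * y ∈ T.O → π (tv T z y) (v + π (gG D.form D.pq ht htc) v) =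
      v + π (gG D.form D.pq ht htc) v)
    {c : F} (hcm : c = z p ∨ c = z q) (hp : vc T (z p) ≤ vc T c) (hq : vc T (z q) ≤ vc T c)
    (hgp : vc T (t⁻¹ * z q) ≤ vc T c) (hgq : vc T (t * z p) ≤ vc T c) : vc T c ≤ 1 := by
  by_contra hc1
  push Not at hc1
  set g := gG D.form D.pq ht htc with hg
  have hc0 : c ≠ 0 := by rintro rfl; simp at hc1
  have hvc0 : 0 < vc T c := zero_lt_iff.mpr ((Valuation.ne_zero_iff _).mpr hc0)
  have hcc0 : T.conj c ≠ 0 := by simpa using hc0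
  set z0 := c⁻¹ • z with hz0
  have hzz : z = c • z0 := by rw [hz0, smul_smul, mul_inv_cancel₀ hc0, one_smul]
  have hz0i : T.h z0 z0 = 0 := by rw [hz0, T.h_smul_left, h_smul_right, hz]; ring
  have hfix0 : ∀ y, T.conj y = -y → vc T y ≤ 1 → π (tv T z0 y) (v + π g v) = v + π g v := by
    intro y hy hy1
    have h1 := hfix ((T.conj c * c)⁻¹ * y) (skew_mul (by rw [map_inv₀, norm_fix]) hy) (by
      apply vc_lt_mem
      rw [map_mul, map_inv₀, map_mul, vc_conj D.hc]
      have : (vc T c * vc T c)⁻¹ < 1 := by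
        rw [inv_lt_one₀ (mul_pos hvc0 hvc0)]
        exact one_lt_mul'' hc1 hc1
      calc _ ≤ (vc T c * vc T c)⁻¹ * 1 := by gcongr
        _ < 1 := by simpa using this)
    rw [hzz, tv_smul hz0i (skew_mul (by rw [map_inv₀, norm_fix]) hy), mul_inv_cancel_left₀ (mul_ne_zero hcc0 hc0)] at h1
    exact h1
  have val : ∀ x, vc T (c⁻¹ * x) ≤ 1 ↔ vc T x ≤ vc T c := by
    intro x; rw [map_mul, map_inv₀, inv_mul_le_one₀ hvc0]
  have hzp : vc T (z0 p) ≤ 1 := (val _).mpr hp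
  have hzq : vc T (z0 q) ≤ 1 := (val _).mpr hq
  have hgp' : vc T (t⁻¹ * z0 q) ≤ 1 := by
    have := (val _).mpr hgp; rwa [mul_left_comm] at this
  have hgq' : vc T (t * z0 p) < 1 := by
    rw [map_mul]
    calc vc T t * vc T (z0 p) ≤ vc T t * 1 := by gcongr
      _ < 1 := by simpa using htv
  have hprim : vc T (z0 p) = 1 ∨ vc T (z0 q) = 1 := by
    rcases hcm with h | h
    · left; rw [hz0, Pi.smul_apply, ← h, smul_eq_mul, inv_mul_cancel₀ hc0, map_one]
    · right; rw [hz0, Pi.smul_apply, ← h, smul_eq_mul, inv_mul_cancel₀ hc0, map_one]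
  clear_value z0
  have hgi : T.h (gE p q t z0) (gE p q t z0) = 0 := by
    have := h_G g z0 z0
    rw [hz0i] at this; exact this
  -- action on v'
  have hact : ∀ y, T.conj y = -y → π (tv T z0 y) (π g v) = π g (π (tv T (gE p q t z0) y) v) := by
    intro y hy
    have h1 := tv_conj g hgi hy
    have h2 : T.toE g (gE p q t z0) = z0 := gE_gE D.pq ht z0
    rw [h2] at h1
    rw [← π_mul, ← π_mul, h1]
  by_cases hlt : vc T (t⁻¹ * z0 q) < 1
  · have hall : ∀ j, vc T (gE p q t z0 j) < 1 := by
      intro j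
      by_cases hj : j = p
      · subst hj; rw [gE_p]; exact hlt
      · exact iso_all_lt D.form D.hc D.pq hgi (by rw [gE_p]; exact hgp') (by rw [gE_q D.pq]; exact hgq') j hj
    apply D.claim1 hz0i hzq hprim
    intro y hy hy1
    have h1 := hfix0 y hy hy1
    rw [map_add, hact y hy, D.fix_small hgi hall hy hy1] at h1
    exact add_right_cancel h1
  · have heq : vc T (t⁻¹ * z0 q) = 1 := le_antisymm hgp' (not_lt.mp hlt)
    have hvt0 : vc T t ≠ 0 := (Valuation.ne_zero_iff _).mpr ht
    have hqt : vc T (z0 q) = vc T t := by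
      rw [map_mul, map_inv₀] at heq
      rwa [inv_mul_eq_one₀ hvt0, eq_comm] at heq
    have hp1 : vc T (z0 p) = 1 := by
      rcases hprim with h | h
      · exact h
      · rw [hqt] at h; exact absurd h (ne_of_lt htv)
    have hb0 : z0 p ≠ 0 := by intro h; rw [h] at hp1; simp at hp1
    have hbc0 : T.conj (z0 p) ≠ 0 := by simpa using hb0
    set z1 := (z0 p)⁻¹ • z0 with hz1
    have hz1i : T.h z1 z1 = 0 := by rw [hz1, T.h_smul_left, h_smul_right, hz0i]; ring
    have hz1s : ∀ j, j ≠ p → vc T (z1 j) < 1 := by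
      intro j hj
      rw [hz1, Pi.smul_apply, smul_eq_mul, map_mul, map_inv₀, hp1, inv_one, one_mul]
      exact iso_all_lt D.form D.hc D.pq hz0i hzp (by rw [hqt]; exact htv) j hj
    set d := t⁻¹ * z0 q with hd
    have hd0 : d ≠ 0 := by intro h; rw [h] at heq; simp at heq
    have hdc0 : T.conj d ≠ 0 := by simpa using hd0
    set z2 := d⁻¹ • gE p q t z0 with hz2
    have hz2i : T.h z2 z2 = 0 := by rw [hz2, T.h_smul_left, h_smul_right, hgi]; ring
    have hz2s : ∀ j, j ≠ p → vc T (z2 j) < 1 := by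
      intro j hj
      rw [hz2, Pi.smul_apply, smul_eq_mul, map_mul, map_inv₀, heq, inv_one, one_mul]
      exact iso_all_lt D.form D.hc D.pq hgi (by rw [gE_p]; exact hgp') (by rw [gE_q D.pq]; exact hgq') j hj
    have hz1p : z1 p = 1 := by rw [hz1, Pi.smul_apply, smul_eq_mul, inv_mul_cancel₀ hb0]
    have hz2p : z2 p = 1 := by rw [hz2, Pi.smul_apply, smul_eq_mul, gE_p, inv_mul_cancel₀ hd0]
    have ez0 : z0 = z0 p • z1 := by rw [hz1, smul_smul, mul_inv_cancel₀ hb0, one_smul]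
    have egz : gE p q t z0 = d • z2 := by rw [hz2, smul_smul, mul_inv_cancel₀ hd0, one_smul]
    set N1 := T.conj (z0 p) * z0 p with hN1
    set N2 := T.conj d * d with hN2
    have hN1f : T.conj N1 = N1 := norm_fix _
    have hN2f : T.conj N2 = N2 := norm_fix _
    have hN10 : N1 ≠ 0 := mul_ne_zero hbc0 hb0
    have hN20 : N2 ≠ 0 := mul_ne_zero hdc0 hd0
    have hvN1 : vc T N1 = 1 := by rw [hN1, map_mul, vc_conj D.hc, hp1, one_mul]
    have hvN2 : vc T N2 = 1 := by rw [hN2, map_mul, vc_conj D.hc, heq, one_mul]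
    -- key : for y
    have key : ∀ y, T.conj y = -y → T.ϖ ^ (-e) * (N1 * y) ∈ T.O → T.ϖ ^ (-e) * (N2 * y) ∈ T.O →
        θ (N1 * y) = 1 ∧ θ (N2 * y) = 1 := by
      intro y hy h1 h2
      by_contra hcon
      have hy1 : vc T y ≤ 1 := by
        have := zO_le h1
        rwa [map_mul, hvN1, one_mul] at this
      have h3 := hfix0 y hy hy1
      have ev : π (tv T z0 y) v = θ (N1 * y) • v := by
        conv_lhs => rw [ez0]
        rw [tv_smul hz1i hy]
        exact D.F2 _ _ hz1i hz1p hz1s (skew_mul hN1f hy) h1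
      have ev' : π (tv T (gE p q t z0) y) v = θ (N2 * y) • v := by
        rw [egz, tv_smul hz2i hy]
        exact D.F2 _ _ hz2i hz2p hz2s (skew_mul hN2f hy) h2
      rw [map_add, hact y hy, ev', ev, map_smul] at h3
      exact D.indep ht htc htv (by tauto) h3
    rcases T.O_val (N2 / N1) (div_ne_zero hN20 hN10) with h | h
    · have := (key (N1⁻¹ * y0) (skew_mul (by rw [map_inv₀, hN1f]) D.yc)
        (by rw [mul_inv_cancel_left₀ hN10]; exact D.y0O)
        (by
          have := T.O.mul_mem h D.y0O
          convert this using 1; field_simp)).1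
      rw [mul_inv_cancel_left₀ hN10] at this
      exact D.hθ this
    · have := (key (N2⁻¹ * y0) (skew_mul (by rw [map_inv₀, hN2f]) D.yc)
        (by
          have := T.O.mul_mem h D.y0O
          convert this using 1; field_simp)
        (by rw [mul_inv_cancel_left₀ hN20]; exact D.y0O)).2
      rw [mul_inv_cancel_left₀ hN20] at this
      exact D.hθ this

end U17

namespace U17
open USetting

variable {F : Type u} [Field F] {T : USetting F (Fin 4 → F)}
variable {W : Type*} [AddCommGroup W] [Module ℂ W]
variable {π : T.GU →* Module.End ℂ W} {v : W} {p q : Fin 4} {e : ℤ} {y0 s : F} {M0 : ℤ} {θ : F → ℂ}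

lemma per_nat (Λ : T.LatSeq) (a : ℕ) (i : ℤ) (x) : T.ϖ ^ (a:ℤ) • x ∈ Λ.L (i + Λ.e * a) ↔ x ∈ Λ.L i := by
  induction a generalizing x with
  | zero => simp
  | succ a ih =>
    have h1 : i + Λ.e * ((a + 1 : ℕ) : ℤ) = (i + Λ.e * a) + Λ.e := by push_cast; ring
    rw [h1, Λ.periodic, Set.mem_smul_set_iff_inv_smul_mem₀ T.ϖ_ne_zero, smul_smul]
    rw [← ih x]
    have : T.ϖ⁻¹ * T.ϖ ^ ((a+1 : ℕ):ℤ) = T.ϖ ^ (a:ℤ) := by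
      have := T.ϖ_ne_zero
      push_cast
      rw [zpow_add₀ this]; field_simp
    rw [this]

lemma per_mem (Λ : T.LatSeq) (a : ℤ) (i : ℤ) (x) : T.ϖ ^ a • x ∈ Λ.L (i + Λ.e * a) ↔ x ∈ Λ.L i := by
  obtain ⟨k, rfl | rfl⟩ := a.eq_nat_or_neg
  · exact per_nat Λ k i x
  · rw [← per_nat Λ k (i + Λ.e * -k), smul_smul, ← zpow_add₀ T.ϖ_ne_zero]
    simp

def inL (Λ : T.LatSeq) (x : Fin 4 → F) : Prop := ∃ K : ℕ, T.ϖ ^ (K:ℤ) • x ∈ Λ.L 0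

lemma inL_all {Λ : T.LatSeq} {x} (h : inL Λ x) (i : ℤ) : ∃ K : ℕ, T.ϖ ^ (K:ℤ) • x ∈ Λ.L i := by
  obtain ⟨K, hK⟩ := h
  rw [← per_nat Λ i.toNat 0, smul_smul, ← zpow_add₀ T.ϖ_ne_zero] at hK
  refine ⟨i.toNat + K, ?_⟩
  push_cast
  refine L_anti Λ ?_ hK
  have := Λ.e_pos
  have h1 := Int.self_le_toNat i
  nlinarith

lemma inL_of {Λ : T.LatSeq} {x} {k i : ℤ} (h : T.ϖ ^ k • x ∈ Λ.L i) : inL Λ x := by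
  have he := Λ.e_pos
  rw [← per_mem Λ |i| i, smul_smul, ← zpow_add₀ T.ϖ_ne_zero] at h
  refine ⟨(|i| + k).toNat, ?_⟩
  have h0 : (0:ℤ) ≤ i + Λ.e * |i| := by
    have := neg_abs_le i
    have := abs_nonneg i
    nlinarith
  have h1 := L_anti Λ h0 h
  have h2 := Int.self_le_toNat (|i| + k)
  obtain ⟨c, hc⟩ := Int.le.dest h2
  rw [← hc, add_comm, zpow_add₀ T.ϖ_ne_zero, mul_smul]
  exact Λ.smul_mem _ _ (by simpa using T.O.pow_mem T.ϖ_mem c) _ h1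

lemma inL_mono {Λ : T.LatSeq} {x} {K K' : ℕ} (h : T.ϖ ^ (K:ℤ) • x ∈ Λ.L 0) (hk : K ≤ K') : T.ϖ ^ (K':ℤ) • x ∈ Λ.L 0 := by
  obtain ⟨c, rfl⟩ := Nat.exists_eq_add_of_le hk
  push_cast
  rw [add_comm, zpow_add₀ T.ϖ_ne_zero, mul_smul]
  exact Λ.smul_mem _ _ (by simpa using T.O.pow_mem T.ϖ_mem c) _ h

lemma inL_add {Λ : T.LatSeq} {x y} (h : inL Λ x) (h' : inL Λ y) : inL Λ (x + y) := by
  obtain ⟨K, hK⟩ := h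
  obtain ⟨K', hK'⟩ := h'
  refine ⟨K + K', ?_⟩
  rw [smul_add]
  exact Λ.add_mem _ _ _ (inL_mono hK (by omega)) (inL_mono hK' (by omega))

lemma inL_smul {Λ : T.LatSeq} {x} (h : inL Λ x) {c : F} (hc : vc T c ≤ 1) : inL Λ (c • x) := by
  obtain ⟨K, hK⟩ := h
  obtain ⟨K', hK'⟩ := (mem_Oc T).mp (vc_le_one.mp hc)
  refine ⟨K + K', ?_⟩
  have := Λ.smul_mem _ _ hK' _ hK
  rw [smul_smul] at this ⊢
  convert this using 2
  push_cast
  rw [zpow_add₀ T.ϖ_ne_zero]; ring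

lemma inL_sub {Λ : T.LatSeq} {x y} (h : inL Λ x) (h' : inL Λ y) : inL Λ (x - y) := by
  have := inL_add h (inL_smul h' (c := -1) (by simp))
  rwa [neg_one_smul, ← sub_eq_add_neg] at this

lemma tv_in_P {Λ : T.LatSeq} {d : ℤ} (hc : T.conj T.ϖ = T.ϖ) (hd : T.selfDualWith Λ d) {z} (hz : T.h z z = 0) (hL : inL Λ z) (k : ℤ) :
    ∃ M : ℤ, ∀ y, T.conj y = -y → T.ϖ ^ (-M) * y ∈ T.O → tv T z y ∈ T.Pset Λ k := by
  obtain ⟨K0, hK0⟩ := inL_all hL d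
  obtain ⟨K1, hK1⟩ := inL_all hL (Λ.e + k)
  refine ⟨K0 + K1, ?_⟩
  intro y hy hyO i u hu
  have he := Λ.e_pos
  rw [tv_toE hz hy, LinearMap.sub_apply, Module.End.one_apply, tvE_apply, add_sub_cancel_left]
  have h1 := Int.emod_add_mul_ediv i Λ.e
  have h2 := Int.emod_nonneg i he.ne'
  have h3 := Int.emod_lt_of_pos i he
  set a := i / Λ.e with ha
  have hu0 : T.ϖ ^ (-a) • u ∈ Λ.L 0 := by
    rw [← per_mem Λ a, smul_smul, ← zpow_add₀ T.ϖ_ne_zero]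
    simp only [add_neg_cancel, zpow_zero, one_smul, zero_add]
    exact L_anti Λ (by omega) hu
  have hh : T.h (T.ϖ ^ (K0:ℤ) • z) (T.ϖ ^ (-a) • u) ∈ T.O := by
    have := hd 0
    rw [sub_zero] at this
    rw [← this] at hK0
    exact hK0 _ hu0
  rw [T.h_smul_left, h_smul_right, map_zpow₀, hc] at hh
  have h4 := Λ.smul_mem _ _ (T.O.mul_mem hyO hh) _ hK1
  rw [← per_mem Λ a] at h4
  refine L_anti Λ (i := i + k) ?_ ?_ (j := Λ.e + k + Λ.e * a)
  · omega
  · convert h4 using 1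
    rw [smul_smul, smul_smul]
    congr 1
    have := T.ϖ_ne_zero
    rw [neg_add, zpow_add₀ this, zpow_neg, zpow_neg, zpow_neg]
    field_simp

lemma inL_dual {Λ : T.LatSeq} {d : ℤ} (hc : T.conj T.ϖ = T.ϖ) (hfull : T.IsFull Λ) (hd : T.selfDualWith Λ d) {x}
    (h : ∀ u, inL Λ u → vc T (T.h x u) ≤ 1) : inL Λ x := by
  obtain ⟨-, S, hS, hgen⟩ := hfull 0
  have h1 : ∀ w : Fin 4 → F, ∃ K : ℕ, w ∈ S → T.ϖ ^ (K:ℤ) * T.h x w ∈ T.O := by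
    intro w
    by_cases hw : w ∈ S
    · obtain ⟨K, hK⟩ := (mem_Oc T).mp (vc_le_one.mp (h w ⟨0, by simpa using hS hw⟩))
      exact ⟨K, fun _ => hK⟩
    · exact ⟨0, fun h => absurd h hw⟩
  choose K hK using h1
  apply inL_of (k := ∑ w ∈ S, K w) (i := d)
  have := hd 0
  rw [sub_zero] at this
  rw [← this]
  intro u hu
  obtain ⟨c, hc1, hc2⟩ := hgen u hu
  have hlin' : T.h x u = ∑ w ∈ S, c w * T.h x w := by
    rw [hc2]
    have : T.h x = hlin T x := rfl
    rw [this, map_sum]; simp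
  rw [T.h_smul_left, map_zpow₀, hc, hlin', Finset.mul_sum]
  apply Subring.sum_mem
  intro w hw
  rw [mul_left_comm]
  refine T.O.mul_mem (hc1 w hw) (zp_mono T (hK w hw) ?_)
  have := Finset.single_le_sum (f := fun w => (K w : ℤ)) (fun i _ => by positivity) hw
  exact_mod_cast this

lemma inL_h {Λ : T.LatSeq} {d : ℤ} (hc : T.conj T.ϖ = T.ϖ) (hd : T.selfDualWith Λ d) {x u} (hx : inL Λ x) (hu : inL Λ u) :
    vc T (T.h x u) ≤ 1 := by
  obtain ⟨K, hK⟩ := inL_all hx d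
  obtain ⟨K', hK'⟩ := hu
  have := hd 0
  rw [sub_zero] at this
  rw [← this] at hK
  have h := hK _ hK'
  rw [T.h_smul_left, h_smul_right, map_zpow₀, hc, zpe] at h
  exact zO_le h

theorem partA (D : Dat T π v p q e y0 s M0 θ) (hsm : T.Smooth π) {t : F} (ht : t ≠ 0) (htc : T.conj t = t)
    (htv : vc T t < 1) : False := by
  set g := gG D.form D.pq ht htc with hg
  have hgg : g * g = 1 := by
    apply toE_inj
    exact gE_mul D.pq ht
  set w := v + π g v with hw
  have hgw : π g w = w := by
    rw [hw, map_add, ← π_mul, hgg, map_one, Module.End.one_apply, add_comm]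
  obtain ⟨Λ, hfull, ⟨d, hd⟩, k, -, hk⟩ := hsm w
  have hvt : 0 < vc T t := zero_lt_iff.mpr ((Valuation.ne_zero_iff _).mpr ht)
  have hg2 : ∀ z, T.toE g z = gE p q t z := fun z => rfl
  -- isotropic vectors
  have iso : ∀ z, inL Λ z → T.h z z = 0 → ∀ j, vc T (z j) ≤ 1 ∧ vc T (gE p q t z j) ≤ 1 := by
    intro z hzL hz
    obtain ⟨M, hM⟩ := tv_in_P D.hc hd hz hzL k
    have hf1 : ∀ y, T.conj y = -y → T.ϖ ^ (-M) * y ∈ T.O → π (tv T z y) w = w :=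
      fun y hy hyO => hk _ (hM y hy hyO)
    have hgz : T.h (gE p q t z) (gE p q t z) = 0 := by rw [← hg2, h_G, hz]
    have hf2 : ∀ y, T.conj y = -y → T.ϖ ^ (-M) * y ∈ T.O → π (tv T (gE p q t z) y) w = w := by
      intro y hy hyO
      have h1 := tv_conj g hz hy
      rw [hg2] at h1
      have h2 : tv T (gE p q t z) y = g * tv T z y * g := by rw [h1, mul_assoc, hgg, mul_one]
      rw [h2, π_mul, π_mul, hgw, hf1 y hy hyO, hgw]
    have hA2 : vc T (z q) ≤ vc T (t⁻¹ * z q) := by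
      rw [map_mul, map_inv₀]
      have : 1 ≤ (vc T t)⁻¹ := (one_le_inv₀ hvt).mpr htv.le
      calc vc T (z q) = 1 * vc T (z q) := (one_mul _).symm
        _ ≤ _ := by gcongr
    have hA4 : vc T (t * z p) ≤ vc T (z p) := by
      rw [map_mul]
      calc _ ≤ 1 * vc T (z p) := by gcongr
        _ = _ := one_mul _
    have hmax : vc T (z p) ≤ 1 ∧ vc T (t⁻¹ * z q) ≤ 1 := by
      rcases le_total (vc T (t⁻¹ * z q)) (vc T (z p)) with h | h
      · have := D.main ht htc htv hz M hf1 (Or.inl rfl) le_rfl (hA2.trans h) h hA4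
        exact ⟨this, h.trans this⟩
      · have := D.main ht htc htv hgz M hf2 (c := t⁻¹ * z q) (Or.inl (by rw [gE_p])) (by rw [gE_p])
          (by rw [gE_q D.pq]; exact hA4.trans h)
          (by rw [gE_q D.pq, inv_mul_cancel_left₀ ht]; exact h)
          (by rw [gE_p, mul_inv_cancel_left₀ ht]; exact hA2)
        exact ⟨h.trans this, this⟩
    intro j
    exact ⟨iso_all_le D.form D.hc D.pq hz hmax.1 (hA2.trans hmax.2) j,
      iso_all_le D.form D.hc D.pq hgz (by rw [gE_p]; exact hmax.2) (by rw [gE_q D.pq]; exact hA4.trans hmax.1) j⟩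
  -- B closed
  let B : (Fin 4 → F) → Prop := fun x => ∀ j, vc T (x j) ≤ 1 ∧ vc T (gE p q t x j) ≤ 1
  have Badd : ∀ x y, B x → B y → B (x + y) := by
    intro x y hx hy j
    rw [map_add]
    exact ⟨(Valuation.map_add _ _ _).trans (max_le (hx j).1 (hy j).1),
      (Valuation.map_add _ _ _).trans (max_le (hx j).2 (hy j).2)⟩
  have Bsmul : ∀ c x, vc T c ≤ 1 → B x → B (c • x) := by
    intro c x hc hx j
    rw [map_smul, Pi.smul_apply, Pi.smul_apply, smul_eq_mul, smul_eq_mul, map_mul, map_mul]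
    exact ⟨mul_le_one' hc (hx j).1, mul_le_one' hc (hx j).2⟩
  have hLB : ∀ u, inL Λ u → B u := by
    obtain ⟨hspan, S, hS, hgen⟩ := hfull 0
    set e0 : Fin 4 → F := Pi.single p 1 with he0
    have he0i : T.h e0 e0 = 0 := h_single_self D.form D.pq
    have hlin' : ∀ x (c : (Fin 4 → F) → F), T.h x (∑ w ∈ S, c w • w) = ∑ w ∈ S, c w * T.h x w := by
      intro x c
      have : T.h x = hlin T x := rfl
      rw [this, map_sum]; simp
    have hex : ∃ u ∈ Λ.L 0, T.h e0 u ≠ 0 := by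
      by_contra hcon
      push Not at hcon
      have h1 : Submodule.span F (Λ.L 0) ≤ LinearMap.ker (hlin T e0) := by
        rw [Submodule.span_le]
        intro u hu
        exact hcon u hu
      rw [hspan] at h1
      have h2 : e0 = 0 := T.h_nondeg _ fun u => h1 (Submodule.mem_top (x := u))
      have := congrFun h2 p
      simp [he0] at this
    obtain ⟨u1, hu1, hu1'⟩ := hex
    have hSne : S.Nonempty := by
      by_contra hcon
      rw [Finset.not_nonempty_iff_eq_empty] at hcon
      obtain ⟨c, -, hc2⟩ := hgen u1 hu1
      rw [hcon] at hc2
      apply hu1'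
      rw [hc2, Finset.sum_empty]
      exact map_zero (hlin T e0)
    obtain ⟨u0, hu0S, hmax⟩ := S.exists_max_image (fun w => vc T (T.h e0 w)) hSne
    have hbd : ∀ u, inL Λ u → vc T (T.h e0 u) ≤ vc T (T.h e0 u0) := by
      rintro u ⟨K, hK⟩
      obtain ⟨c, hc1, hc2⟩ := hgen _ hK
      have h1 : vc T (T.h e0 u) = vc T (T.h e0 (T.ϖ ^ (K:ℤ) • u)) := by
        rw [h_smul_right, map_mul, vc_zpow, one_mul]
      rw [h1, hc2, hlin']
      apply Valuation.map_sum_le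
      intro w hw
      rw [map_mul]
      calc _ ≤ 1 * vc T (T.h e0 u0) := by
            gcongr
            · exact O_le (hc1 w hw)
            · exact hmax w hw
        _ = _ := one_mul _
    set a := T.h e0 u0 with ha
    have ha0 : a ≠ 0 := by
      intro h0
      have := hbd u1 ⟨0, by simpa using hu1⟩
      rw [h0, map_zero] at this
      exact hu1' ((Valuation.zero_iff _).mp (le_antisymm this zero_le'))
    have hva : 0 < vc T a := zero_lt_iff.mpr ((Valuation.ne_zero_iff _).mpr ha0)
    set z := (T.conj a)⁻¹ • e0 with hz
    have hzh : ∀ u, T.h z u = a⁻¹ * T.h e0 u := by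
      intro u; rw [hz, T.h_smul_left, map_inv₀, T.conj_invol]
    have hzz : T.h z z = 0 := by rw [hzh, hz, h_smul_right, he0i]; ring
    have hzL : inL Λ z := by
      apply inL_dual D.hc hfull hd
      intro u hu
      rw [hzh, map_mul, map_inv₀, inv_mul_le_one₀ hva]
      exact hbd u hu
    clear_value z
    have hu0L : inL Λ u0 := ⟨0, by simpa using hS hu0S⟩
    have hzu0 : T.h z u0 = 1 := by rw [hzh, inv_mul_cancel₀ ha0]
    have hu0z : T.h u0 z = 1 := by rw [T.h_conj_symm z u0, hzu0, map_one]
    have h2c : T.conj (2:F) = 2 := map_ofNat T.conj 2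
    have hvi2 : vc T (2:F)⁻¹ ≤ 1 := O_le D.twoinv
    have half : ∀ x, inL Λ x → vc T (T.h x x / 2) ≤ 1 := by
      intro x hx
      rw [div_eq_mul_inv, map_mul]
      exact mul_le_one' (inL_h D.hc hd hx hx) hvi2
    have halfc : ∀ x, T.conj (T.h x x / 2) = T.h x x / 2 := by
      intro x
      rw [map_div₀, h2c, ← T.h_conj_symm]
    have two0 := D.two
    set z2 := u0 - (T.h u0 u0 / 2) • z with hz2
    have hz2L : inL Λ z2 := inL_sub hu0L (inL_smul hzL (half _ hu0L))
    have hzz2 : T.h z z2 = 1 := by rw [hz2, h_sub_right, h_smul_right, hzz, hzu0]; ring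
    have hz2z : T.h z2 z = 1 := by rw [T.h_conj_symm z z2, hzz2, map_one]
    have hz2z2 : T.h z2 z2 = 0 := by
      have h1 : T.h z2 u0 = T.h u0 u0 / 2 := by
        rw [hz2, h_sub_left, T.h_smul_left, halfc, hzu0]; field_simp; ring
      conv_lhs => rw [hz2]
      rw [← hz2, h_sub_right, h_smul_right, hz2z, h1]; ring
    clear_value z2
    intro u hu
    set r := u - T.h z2 u • z - T.h z u • z2 with hr
    have hrL : inL Λ r := inL_sub (inL_sub hu (inL_smul hzL (inL_h D.hc hd hz2L hu)))
      (inL_smul hz2L (inL_h D.hc hd hzL hu))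
    have hzr : T.h z r = 0 := by
      rw [hr, h_sub_right, h_sub_right, h_smul_right, h_smul_right, hzz, hzz2]; ring
    have hz2r : T.h z2 r = 0 := by
      rw [hr, h_sub_right, h_sub_right, h_smul_right, h_smul_right, hz2z, hz2z2]; ring
    have hrz : T.h r z = 0 := by rw [T.h_conj_symm z r, hzr, map_zero]
    have hrz2 : T.h r z2 = 0 := by rw [T.h_conj_symm z2 r, hz2r, map_zero]
    set c := T.h r r / 2 with hcdef
    set qq := z + r - c • z2 with hqq
    have hqL : inL Λ qq := inL_sub (inL_add hzL hrL) (inL_smul hz2L (half _ hrL))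
    have hqi : T.h qq qq = 0 := by
      rw [hqq]
      simp only [h_sub_left, h_sub_right, T.h_add_left, h_add_right, T.h_smul_left, h_smul_right, hzz, hzr, hrz, hz2r,
        hrz2, hz2z, hzz2, hz2z2, hcdef, halfc]
      field_simp; ring
    have Bz : B z := iso z hzL hzz
    have Bz2 : B z2 := iso z2 hz2L hz2z2
    have Bq : B qq := iso qq hqL hqi
    have hrq : u = qq + (-1 : F) • z + c • z2 + T.h z2 u • z + T.h z u • z2 := by
      have : u = r + T.h z2 u • z + T.h z u • z2 := by rw [hr]; abel
      conv_lhs => rw [this]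
      have : r = qq + (-1 : F) • z + c • z2 := by rw [hqq, neg_one_smul]; abel
      rw [← this]
    rw [hrq]
    refine Badd _ _ (Badd _ _ (Badd _ _ (Badd _ _ Bq (Bsmul _ _ (by simp) Bz)) (Bsmul _ _ (half _ hrL) Bz2))
      (Bsmul _ _ (inL_h D.hc hd hz2L hu) Bz)) (Bsmul _ _ (inL_h D.hc hd hzL hu) Bz2)
  have heq : inL Λ (Pi.single q 1) := by
    apply inL_dual D.hc hfull hd
    intro u hu
    rw [T.h_conj_symm u, vc_conj D.hc, h_single_p D.form D.pq.symm, vc_conj D.hc]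
    exact (hLB u hu p).1
  have := (hLB _ heq p).2
  rw [gE_p, Pi.single_eq_same, mul_one, map_inv₀] at this
  rw [inv_le_one₀ hvt] at this
  exact absurd htv (not_lt.mpr this)

end U17

namespace U17
open USetting

variable {F : Type u} [Field F] {T : USetting F (Fin 4 → F)}
variable {W : Type*} [AddCommGroup W] [Module ℂ W]

section
variable {F₀ : Type w} [Field F₀] [Algebra F₀ F] [FiniteDimensional F₀ F]

lemma ψ_tr_one (hc : T.conj T.ϖ = T.ϖ) (h2 : (2:F) ≠ 0) (hfix : T.FixedField F₀) (hdeg : Module.finrank F₀ F = 2)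
    {ψ₀ : F₀ → ℂ} (hψ : T.IsAddCh F₀ ψ₀) {z : F} (hz : z ∈ T.pF) : ψ₀ (Algebra.trace F₀ F z) = 1 := by
  apply hψ.2.1
  rw [trace_alg h2 hfix hdeg]
  have := tr_mem_conj hz hc
  rw [mem_pF] at *
  exact zp_add T hz this

lemma Good.pq {n p q} (h : Good n p q) : PQ p q := by
  rcases h with h | h
  · exact Or.inl h.2
  · exact Or.inr h.2

lemma ent_tv (z : Fin 4 → F) (y : F) (j k) : ent (tvE T z y - 1) j k = y * T.h z (Pi.single k 1) * z j := by
  unfold ent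
  rw [LinearMap.sub_apply, Module.End.one_apply, tvE_apply, add_sub_cancel_left]; rfl

lemma h_single_O (hf : T.IsU4Form) {z} (hz : ∀ j, z j ∈ T.O) (k) : T.h z (Pi.single k 1) ∈ T.O := by
  rw [hf]
  have h1 : ∀ j : Fin 4, (Pi.single k 1 : Fin 4 → F) j ∈ T.O := fun j => single_O k j
  have h2 : ∀ j, T.conj (z j) ∈ T.O := fun j => T.conj_O _ (hz j)
  exact T.O.add_mem (T.O.add_mem (T.O.add_mem (T.O.mul_mem (h2 0) (h1 3)) (T.O.mul_mem T.ϖ_mem (T.O.mul_mem (h2 1) (h1 1))))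
    (T.O.mul_mem (h2 2) (h1 2))) (T.O.mul_mem (h2 3) (h1 0))

lemma α4_diff (j k : Fin 4) : -4 ≤ α4 j - α4 k := by fin_cases j <;> fin_cases k <;> decide

lemma skew_ent (hf : T.IsU4Form) {p q} (hpq : PQ p q) {β : EE F} (hβ : β ∈ T.Aminus) :
    T.conj (ent β q p) = - ent β q p := by
  have h1 := T.σA_adj β (Pi.single p 1) (Pi.single p 1)
  have hb : T.σA β = -β := hβ
  rw [hb, LinearMap.neg_apply, h_neg_right, h_single_p hf hpq] at h1
  rw [T.h_conj_symm (β (Pi.single p 1)) (Pi.single p 1), h_single_p hf hpq, T.conj_invol] at h1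
  exact h1

variable {π : T.GU →* Module.End ℂ W}

theorem arch (hodd : ¬ (2 ∣ T.residueChar)) (hf : T.IsU4Form) (hunram : T.IsUnramifiedQuadratic)
    (hfix : T.FixedField F₀) (hdeg : Module.finrank F₀ F = 2)
    {ψ₀ : F₀ → ℂ} (hψ : T.IsAddCh F₀ ψ₀) {n : ℤ} (hn : 0 < n) {p q} (hg : Good n p q)
    {Λ : T.LatSeq} (hs : Std T α4 Λ) {β : EE F} (hβ : β ∈ T.aFil Λ (-(2*n))) (hβ' : β ∈ T.Aminus)
    (hu : ucoef T n p q β ∉ T.pF) (hsm : T.Smooth π)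
    (hcon : T.ContainsChar π (T.Pset Λ (n + 1)) (T.psiCh F₀ ψ₀ β)) (x : F) : ∃ k : ℕ, T.ϖ ^ (k:ℤ) * x ∈ T.O := by
  obtain ⟨h2, h2i⟩ := two_inv T hodd
  obtain ⟨hc, ε, s, hεO, ⟨yε, hyε, hyε1⟩, -, -, hs2, hsc⟩ := hunram
  obtain ⟨v, hv0, hv⟩ := hcon
  obtain ⟨x0, hx0O, hx0⟩ := hψ.2.2
  obtain ⟨g1, g2, g3, g4⟩ := hg.spec
  obtain ⟨u1, u2⟩ := ent_unit hs hg hβ hu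
  have hpq := hg.pq
  set e := (α4 q - α4 p + 2*n)/6 with he
  set b := ent β q p with hb
  have hb0 : b ≠ 0 := by
    intro h0; apply u2; rw [h0, mul_zero, mem_pF]; simp
  have hbc : T.conj b = -b := skew_ent hf hpq hβ'
  have hε0 : ε ≠ 0 := by rintro rfl; simp at hyε1
  have hs0 : s ≠ 0 := by rintro rfl; apply hε0; rw [← hs2]; simp
  have hsO : s ∈ T.O := by
    rcases T.O_val s hs0 with h | h
    · exact h
    · have := T.O.mul_mem hεO h
      rw [← hs2] at this
      convert this using 1; field_simp
  have hsi : s⁻¹ ∈ T.O := by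
    have := T.O.mul_mem hsO hyε
    convert this using 1
    rw [← hs2] at hyε1
    field_simp; linear_combination -hyε1
  have hx0c : T.conj (algebraMap F₀ F x0) = algebraMap F₀ F x0 := (hfix _).mpr ⟨x0, rfl⟩
  have h2c : T.conj (2:F) = 2 := map_ofNat T.conj 2
  have hψP : ∀ g ∈ T.Pset Λ (n+1), ∀ (c r : F), LinearMap.trace F _ (β * (T.toE g - 1)) = c + r → r ∈ T.pF →
      π g v = ψ₀ (Algebra.trace F₀ F c) • v := by
    intro g hg c r hcr hr
    rw [hv g hg]
    unfold psiCh trA0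
    rw [hcr, map_add, hψ.1, ψ_tr_one hc h2 hfix hdeg hψ hr, mul_one]
  have ψ00 : ψ₀ 0 = 1 := hψ.2.1 0 ⟨0, T.O.zero_mem, by simp⟩
  have D : Dat T π v p q e (algebraMap F₀ F x0 / (2 * b)) s (n+2) (fun y => ψ₀ (Algebra.trace F₀ F (y * b))) :=
    { form := hf
      hc := hc
      two := h2
      twoinv := h2i
      pq := hpq
      s0 := hs0
      sO := hsO
      si := hsi
      sc := hsc
      F1 := by
        intro z y hzO hz hy hyO
        have hmem : tvE T z y - 1 ∈ T.aFil Λ (2*n+1) := by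
          rw [aFil_iff hs]
          intro j k
          rw [ent_tv, mul_assoc]
          have h1 : T.ϖ ^ (0:ℤ) * (T.h z (Pi.single k 1) * z j) ∈ T.O := by
            simpa using T.O.mul_mem (h_single_O hf hzO k) (hzO j)
          have := α4_diff j k
          exact zp_mul T hyO h1 (by omega)
        have h3 := hψP (tv T z y) (by
          show T.toE (tv T z y) - 1 ∈ T.aFil Λ (n+1)
          rw [tv_toE hz hy]; exact aFil_anti hmem (by omega)) 0 (LinearMap.trace F _ (β * (tvE T z y - 1)))
          (by rw [tv_toE hz hy, zero_add]) (tr_mem hs (aFil_mul hβ hmem (by ring)))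
        rw [h3, map_zero, ψ00, one_smul]
      F2 := by
        intro z y hz hzp hzs hy hyO
        have hyv : vc T y ≤ 1 := zO_le hyO
        have hhq : T.h z (Pi.single q 1) = 1 := by rw [h_single_p hf hpq.symm, hzp, map_one]
        have hzle : ∀ j, vc T (z j) ≤ 1 := by
          intro j
          by_cases hj : j = p
          · rw [hj, hzp, map_one]
          · exact (hzs j hj).le
        have hhs : ∀ k, k ≠ q → vc T (T.h z (Pi.single k 1)) < 1 := by
          intro k hk
          have hne := hpq.ne
          rcases hpq.cases k with rfl | rfl | rfl | rfl
          · rw [h_single_p hf hpq, vc_conj hc]; exact hzs _ hne.1.symm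
          · exact absurd rfl hk
          · rw [form_pq hf hpq]
            simp [hne.2.1, hne.2.2.2.1, vc_conj hc, vc_ϖ, hzs 1 hne.2.1.symm]
          · rw [form_pq hf hpq]
            simp [hne.2.2.1, hne.2.2.2.2, vc_conj hc, vc_ϖ, hzs 2 hne.2.2.1.symm]
        have hhle : ∀ k, vc T (T.h z (Pi.single k 1)) ≤ 1 := by
          intro k
          by_cases hk : k = q
          · rw [hk, hhq, map_one]
          · exact (hhs k hk).le
        have hsm : ∀ j k, vc T (ent (tvE T z y - 1) j k - if j = p ∧ k = q then y else 0) < 1 := by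
          intro j k
          rw [ent_tv]
          by_cases hj : j = p
          · by_cases hk : k = q
            · rw [if_pos ⟨hj, hk⟩, hk, hhq, hj, hzp]; simp
            · rw [if_neg (by tauto), sub_zero, map_mul, map_mul]
              calc _ ≤ 1 * vc T (T.h z (Pi.single k 1)) * 1 := by gcongr; exact hzle j
                _ < 1 := by simpa using hhs k hk
          · rw [if_neg (by tauto), sub_zero, map_mul, map_mul]
            calc _ ≤ 1 * 1 * vc T (z j) := by gcongr; exact hhle k
              _ < 1 := by simpa using hzs j hj
        have hmem : tvE T z y - 1 ∈ T.aFil Λ (n+1) := by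
          rw [aFil_iff hs]
          intro j k
          have h1 := vc_lt_mem (hsm j k) ((α4 j - α4 k - (n+1))/6)
          by_cases hjk : j = p ∧ k = q
          · rw [if_pos hjk, mul_sub] at h1
            have h3 : T.ϖ ^ ((α4 j - α4 k - (n+1))/6) * y ∈ T.O := by
              apply zp_mono T hyO
              rw [hjk.1, hjk.2]; omega
            have := T.O.add_mem h1 h3
            rwa [sub_add_cancel] at this
          · rwa [if_neg hjk, sub_zero] at h1
        refine hψP (tv T z y) (by
          show T.toE (tv T z y) - 1 ∈ T.aFil Λ (n+1)
          rw [tv_toE hz hy]; exact hmem) (y * b) (LinearMap.trace F _ (β * (tvE T z y - 1)) - y * b)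
          (by rw [tv_toE hz hy, add_sub_cancel]) ?_
        have key : LinearMap.trace F _ (β * (tvE T z y - 1)) - y * b =
            ∑ j, ∑ l, ent β j l * (ent (tvE T z y - 1) l j - if l = p ∧ j = q then y else 0) := by
          rw [trace_eq]
          simp_rw [ent_mul, mul_sub, Finset.sum_sub_distrib]
          congr 1
          have : ∀ j l, ent β j l * (if l = p ∧ j = q then y else 0) = if j = q then (if l = p then ent β j l * y else 0) else 0 := by
            intro j l
            split_ifs <;> simp_all
          simp_rw [this]
          simp [hb, mul_comm]
        rw [key, mem_pF]
        apply vc_lt_mem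
        apply Valuation.map_sum_lt' _ zero_lt_one
        intro j _
        apply Valuation.map_sum_lt' _ zero_lt_one
        intro l _
        rw [map_mul]
        calc _ ≤ 1 * vc T (ent (tvE T z y - 1) l j - if l = p ∧ j = q then y else 0) := by
              gcongr; exact zO_le ((aFil_iff hs).mp hβ j l)
          _ < 1 := by simpa using hsm l j
      yc := by rw [map_div₀, map_mul, hx0c, h2c, hbc, mul_neg, div_neg]
      y0O := by
        rcases unit_or_pF T u1 with h | h
        · exact absurd h u2
        · have := T.O.mul_mem (T.O.mul_mem hx0O h2i) h.2
          convert this using 1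
          rw [zpow_neg]
          have := T.ϖ_ne_zero
          field_simp
      hθ := by
        have : Algebra.trace F₀ F (algebraMap F₀ F x0 / (2 * b) * b) = x0 := by
          apply (algebraMap F₀ F).injective
          have h3 : algebraMap F₀ F x0 / (2 * b) * b = algebraMap F₀ F x0 / 2 := by field_simp
          rw [h3, trace_alg h2 hfix hdeg, map_div₀, hx0c, h2c]
          field_simp; ring
        show ψ₀ _ ≠ 1
        rw [this]; exact hx0
      hv := hv0 }
  by_contra hx
  have hx' : x ∉ Oc T := hx
  rw [← vc_le_one, not_le] at hx'
  have hx0' : x ≠ 0 := by rintro rfl; simp at hx'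
  have hxc0 : T.conj x ≠ 0 := by simpa using hx0'
  refine partA D hsm (t := (T.conj x * x)⁻¹) (inv_ne_zero (mul_ne_zero hxc0 hx0')) (by rw [map_inv₀, norm_fix]) ?_
  rw [map_inv₀, map_mul, vc_conj hc]
  have hpos : 0 < vc T x := zero_lt_iff.mpr ((Valuation.ne_zero_iff _).mpr hx0')
  rw [inv_lt_one₀ (mul_pos hpos hpos)]
  exact one_lt_mul'' hx' hx'
end
end U17

namespace U17
open USetting

lemma averaging {K : Type*} [Group K] {W : Type*} [AddCommGroup W] [Module ℂ W] (ρ : K →* Module.End ℂ W)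
    {χ : K → ℂ} {w2 : W} (hw2 : w2 ≠ 0) (hχ : ∀ k, ρ k w2 = χ k • w2) {S : Set W}
    (hS : w2 ∈ Submodule.span ℂ S) (hfi : ∀ x ∈ S, ∃ H : Subgroup K, H.FiniteIndex ∧ ∀ k ∈ H, ρ k x = x) :
    ∃ x ∈ S, ∀ k0 c, ρ k0 x = c • x → χ k0 = c := by
  by_contra hcon
  push Not at hcon
  have ρm : ∀ a b x, ρ (a * b) x = ρ a (ρ b x) := by intro a b x; rw [map_mul]; rfl
  have χm : ∀ a b, χ (a * b) = χ a * χ b := by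
    intro a b
    have h1 := hχ (a * b)
    rw [ρm, hχ b, map_smul, hχ a, smul_smul] at h1
    have := smul_left_injective ℂ hw2 h1
    simpa [mul_comm] using this.symm
  have χ1 : χ 1 = 1 := by
    have h1 := hχ 1
    rw [map_one, Module.End.one_apply] at h1
    exact (smul_left_injective ℂ hw2 (by simpa using h1.symm : χ 1 • w2 = (1:ℂ) • w2))
  have χ0 : ∀ a, χ a ≠ 0 := by
    intro a h
    have := χm a a⁻¹
    rw [mul_inv_cancel, χ1, h, zero_mul] at this
    exact one_ne_zero this
  obtain ⟨t, htS, htw⟩ := Submodule.mem_span_finite_of_mem_span hS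
  have hH : ∀ x : W, ∃ H : Subgroup K, x ∈ t → (H.FiniteIndex ∧ ∀ k ∈ H, ρ k x = x) := by
    intro x
    by_cases hx : x ∈ t
    · obtain ⟨H, hH⟩ := hfi x (htS hx)
      exact ⟨H, fun _ => hH⟩
    · exact ⟨⊤, fun h => absurd h hx⟩
  choose H hH using hH
  let N0 : Subgroup K := ⨅ x ∈ t, H x
  haveI : N0.FiniteIndex := Subgroup.finiteIndex_iInf' _ fun x hx => (hH x hx).1
  let N := N0.normalCore
  have hNfix : ∀ x ∈ t, ∀ k ∈ N, ρ k x = x := by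
    intro x hx k hk
    have h1 : k ∈ N0 := N0.normalCore_le hk
    simp only [N0, Subgroup.mem_iInf] at h1
    exact (hH x hx).2 k (h1 x hx)
  haveI : Fintype (K ⧸ N) := Subgroup.fintypeQuotientOfFiniteIndex
  have hNw : ∀ k ∈ N, ρ k w2 = w2 := by
    intro k hk
    have : Submodule.span ℂ (t : Set W) ≤ LinearMap.ker (ρ k - 1) := by
      rw [Submodule.span_le]
      intro x hx
      have := hNfix x hx k hk
      simp [this]
    have h2 := this htw
    simpa [sub_eq_zero] using h2
  have hNχ : ∀ k ∈ N, χ k = 1 := by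
    intro k hk
    have h1 := hχ k
    rw [hNw k hk] at h1
    exact (smul_left_injective ℂ hw2 (by simpa using h1.symm : χ k • w2 = (1:ℂ) • w2))
  let A : Module.End ℂ W := ∑ q : K ⧸ N, (χ q.out)⁻¹ • ρ q.out
  have hA : ∀ x, A x = ∑ q : K ⧸ N, (χ q.out)⁻¹ • ρ q.out x := by
    intro x; simp [A]
  have hAt : ∀ x ∈ t, A x = 0 := by
    intro x hx
    obtain ⟨k0, c, hk0, hne⟩ := hcon x (htS hx)
    have h1 : A x = ((χ k0)⁻¹ * c) • A x := by
      conv_lhs => rw [hA]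
      rw [hA, Finset.smul_sum]
      symm
      apply Fintype.sum_equiv (Equiv.mulRight (k0 : K ⧸ N))
      intro q
      obtain ⟨⟨m, hm⟩, hm'⟩ := QuotientGroup.mk_out_eq_mul N (q.out * k0)
      have h2 : (Equiv.mulRight (k0 : K ⧸ N)) q = ((q.out * k0 : K) : K ⧸ N) := by
        simp
      rw [h2, hm']
      simp only
      rw [χm, χm, hNχ m hm, ρm, ρm, hNfix x hx m hm, hk0, map_smul, smul_smul, smul_smul]
      congr 1
      have := χ0 q.out
      have := χ0 k0
      field_simp
    have h2 : ((χ k0)⁻¹ * c - 1) • A x = 0 := by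
      rw [sub_smul, one_smul, ← h1, sub_self]
    rcases smul_eq_zero.mp h2 with h3 | h3
    · exfalso
      apply hne
      have := χ0 k0
      field_simp at h3
      linear_combination -h3
    · exact h3
  have hAw : A w2 = 0 := by
    have : Submodule.span ℂ (t : Set W) ≤ LinearMap.ker A := by
      rw [Submodule.span_le]
      intro x hx
      exact hAt x hx
    exact this htw
  rw [hA] at hAw
  have h5 : ∀ q : K ⧸ N, (χ q.out)⁻¹ • ρ q.out w2 = w2 := by
    intro q
    rw [hχ, smul_smul, inv_mul_cancel₀ (χ0 _), one_smul]
  simp_rw [h5] at hAw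
  rw [Finset.sum_const, Finset.card_univ, ← Nat.cast_smul_eq_nsmul ℂ] at hAw
  rcases smul_eq_zero.mp hAw with h | h
  · have : Fintype.card (K ⧸ N) = 0 := by exact_mod_cast h
    rw [Fintype.card_eq_zero_iff] at this
    exact this.elim (1 : K)
  · exact hw2 h

variable {F : Type u} [Field F] {T : USetting F (Fin 4 → F)}
variable {W : Type*} [AddCommGroup W] [Module ℂ W]

variable (T) in
def MO (k : ℤ) : Set (EE F) := {X | ∀ j l, T.ϖ ^ (-k) * ent X j l ∈ T.O}

lemma MO_mul {a b c : ℤ} {X Y : EE F} (hX : X ∈ MO T a) (hY : Y ∈ MO T b) (h : c ≤ a + b) : X * Y ∈ MO T c := by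
  intro j l
  rw [ent_mul]
  exact zp_sum T _ fun i _ => zp_mul T (hX j i) (hY i l) (by omega)

lemma MO_arch (ha : ∀ x : F, ∃ k : ℕ, T.ϖ ^ (k:ℤ) * x ∈ T.O) (X : EE F) : ∃ N : ℕ, X ∈ MO T (-N) := by
  choose k hk using ha
  refine ⟨∑ j, ∑ l, k (ent X j l), ?_⟩
  intro j l
  rw [neg_neg]
  apply zp_mono T (hk _)
  have h1 := Finset.single_le_sum (f := fun l => k (ent X j l)) (fun i _ => Nat.zero_le _) (Finset.mem_univ l)
  have h2 := Finset.single_le_sum (f := fun j => ∑ l, k (ent X j l)) (fun i _ => Nat.zero_le _) (Finset.mem_univ j)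
  exact_mod_cast h1.trans h2

def Bd (α : Fin 4 → ℤ) : Prop := ∀ j k, α j - α k ≤ 5
lemma bd4 : Bd α4 := by intro j k; fin_cases j <;> fin_cases k <;> decide
lemma bd5 : Bd α5 := by intro j k; fin_cases j <;> fin_cases k <;> decide

lemma MO_aFil {α} (hα : Bd α) {Λ : T.LatSeq} (hs : Std T α Λ) {k m : ℤ} (h : m ≤ 6*k - 5) {X : EE F}
    (hX : X ∈ MO T k) : X ∈ T.aFil Λ m := by
  rw [aFil_iff hs]
  intro j l
  apply zp_mono T (hX j l)
  have := hα l j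
  omega

lemma aFil_MO {α} (hα : Bd α) {Λ : T.LatSeq} (hs : Std T α Λ) {k m : ℤ} (h : 6*k ≤ m) {X : EE F}
    (hX : X ∈ T.aFil Λ m) : X ∈ MO T k := by
  intro j l
  apply zp_mono T ((aFil_iff hs).mp hX j l)
  have := hα j l
  omega

lemma MO_one : (1 : EE F) ∈ MO T 0 := by
  intro j l
  simp only [neg_zero, zpow_zero, one_mul]
  exact single_O l j

lemma MO_add {k : ℤ} {X Y : EE F} (hX : X ∈ MO T k) (hY : Y ∈ MO T k) : X + Y ∈ MO T k :=
  fun j l => zp_add T (hX j l) (hY j l)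

lemma fin_res (T : USetting F (Fin 4 → F)) (N : ℕ) : ∃ (X : Type u) (_ : Finite X) (f : F → X), ∀ x ∈ T.O, ∀ x' ∈ T.O, f x = f x' →
    T.ϖ ^ (-(N:ℤ)) * (x - x') ∈ T.O := by
  haveI := T.res_fin
  let I : Ideal T.O := Ideal.span {(⟨T.ϖ, T.ϖ_mem⟩ : T.O)}
  haveI : Finite (T.O ⧸ I ^ N) := Ideal.finite_quotient_pow ⟨{⟨T.ϖ, T.ϖ_mem⟩}, by simp [I]⟩ N
  refine ⟨T.O ⧸ I ^ N, inferInstance, fun x => if h : x ∈ T.O then Ideal.Quotient.mk _ ⟨x, h⟩ else 0, ?_⟩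
  intro x hx x' hx' h
  simp only [hx, hx', dif_pos] at h
  rw [Ideal.Quotient.eq] at h
  simp only [I, Ideal.span_singleton_pow, Ideal.mem_span_singleton] at h
  obtain ⟨c, hc⟩ := h
  have h2 := congrArg Subtype.val hc
  simp only [Subring.coe_mul, Subring.coe_pow, AddSubgroupClass.coe_sub] at h2
  rw [h2, zpow_neg, zpow_natCast, inv_mul_cancel_left₀ (pow_ne_zero _ T.ϖ_ne_zero)]
  exact c.2

lemma P_inv {Λ : T.LatSeq} {d : ℤ} (hd : T.selfDualWith Λ d) {m : ℤ} {g : T.GU} (hg : g ∈ T.Pset Λ m) : g⁻¹ ∈ T.Pset Λ m := by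
  have h1 : T.σA (T.toE g - 1) ∈ T.aFil Λ m := σ_aFil hd hg
  rw [σ_sub, T.σA_one, ← toE_inv] at h1
  exact h1

def PG (Λ : T.LatSeq) (d : ℤ) (hd : T.selfDualWith Λ d) (m : ℤ) (hm : 0 ≤ m) : Subgroup T.GU where
  carrier := T.Pset Λ m
  one_mem' := by
    show T.toE 1 - 1 ∈ T.aFil Λ m
    rw [toE_one, sub_self]
    intro i v _
    exact Λ.zero_mem _
  mul_mem' := by
    intro a b ha hb
    show T.toE (a * b) - 1 ∈ T.aFil Λ m
    have : T.toE (a * b) - 1 = (T.toE a - 1) + (T.toE b - 1) + (T.toE a - 1) * (T.toE b - 1) := by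
      rw [toE_mul, sub_mul, mul_sub, one_mul, mul_one]; abel
    rw [this]
    intro i v hv
    have h1 := ha i v hv
    have h2 := hb i v hv
    have h3 := ha _ _ h2
    exact Λ.add_mem _ _ _ (Λ.add_mem _ _ _ h1 h2) (L_anti Λ (by omega) h3)
  inv_mem' := fun h => P_inv hd h

lemma finIdx {G : Type*} [Group G] (H : Subgroup G) {X : Type*} [Finite X] (f : G → X)
    (h : ∀ a b, f a = f b → a⁻¹ * b ∈ H) : H.FiniteIndex := by
  haveI : Finite (G ⧸ H) := by
    apply Finite.of_injective (fun q : G ⧸ H => f q.out)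
    intro q q' hq
    have := h _ _ hq
    rw [← QuotientGroup.eq, QuotientGroup.out_eq', QuotientGroup.out_eq'] at this
    exact this
  exact Subgroup.finiteIndex_of_finite_quotient

section
variable {F₀ : Type w} [Field F₀] [Algebra F₀ F]
variable {π : T.GU →* Module.End ℂ W}

theorem intertwine (ha : ∀ x : F, ∃ k : ℕ, T.ϖ ^ (k:ℤ) * x ∈ T.O) (hf : T.IsU4Form) (hc : T.conj T.ϖ = T.ϖ)
    {Λ₄ Λ₅ : T.LatSeq} (hs4 : Std T α4 Λ₄) (hs5 : Std T α5 Λ₅) {n : ℤ} (hn : 0 < n)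
    {χ4 χ5 : T.GU → ℂ} (hχ4 : ∀ g ∈ T.Pset Λ₄ (2*n+1), χ4 g = 1)
    (hirr : T.Irred π) (h4 : T.ContainsChar π (T.Pset Λ₄ (n + 1)) χ4)
    (h5 : T.ContainsChar π (T.Pset Λ₅ (n + 1)) χ5) :
    ∃ g : T.GU, ∀ k ∈ T.Pset Λ₅ (n+1), g⁻¹ * k * g ∈ T.Pset Λ₄ (n+1) → χ5 k = χ4 (g⁻¹ * k * g) := by
  obtain ⟨w1, hw1, h4⟩ := h4
  obtain ⟨w2, hw2, h5⟩ := h5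
  have hd4 := selfdual4 hf hc hs4
  have hd5 := selfdual5 hf hc hs5
  let K := PG Λ₅ _ hd5 (n+1) (by omega)
  let S : Set W := Set.range fun g : T.GU => π g w1
  have hspan : Submodule.span ℂ S = ⊤ := by
    rcases hirr.2 (Submodule.span ℂ S) (by
      intro g w hw
      have : Submodule.span ℂ S ≤ (Submodule.span ℂ S).comap (π g) := by
        rw [Submodule.span_le]
        rintro _ ⟨g', rfl⟩
        apply Submodule.subset_span
        exact ⟨g * g', π_mul g g' w1⟩
      exact this hw) with h | h
    · exfalso
      apply hw1
      have : π 1 w1 ∈ Submodule.span ℂ S := Submodule.subset_span ⟨1, rfl⟩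
      rw [h, map_one] at this
      simpa using this
    · exact h
  obtain ⟨_, ⟨g, rfl⟩, hg⟩ := averaging (π.comp K.subtype) (χ := fun k => χ5 k) hw2 (fun k => h5 k k.2) (S := S)
    (by rw [hspan]; trivial) (by
      rintro _ ⟨g, rfl⟩
      let P := PG Λ₄ _ hd4 (2*n+1) (by omega)
      let H : Subgroup K := (P.comap (MulAut.conj g⁻¹).toMonoidHom).comap K.subtype
      refine ⟨H, ?_, ?_⟩
      · obtain ⟨N1, hN1⟩ := MO_arch ha (T.toE g)
        obtain ⟨N2, hN2⟩ := MO_arch ha (T.toE g⁻¹)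
        let N : ℕ := N1 + N2 + n.toNat + 2
        obtain ⟨X, hX, f, hfX⟩ := fin_res T N
        have hKO : ∀ k ∈ K, T.toE k ∈ MO T 0 := by
          intro k hk
          have h1 : T.toE k - 1 ∈ MO T 0 := aFil_MO bd5 hs5 (by omega) hk
          have := MO_add h1 MO_one
          rwa [sub_add_cancel] at this
        have hKO' : ∀ k ∈ K, ∀ j l, ent (T.toE k) j l ∈ T.O := by
          intro k hk j l
          have := hKO k hk j l
          simpa using this
        apply finIdx H (X := Fin 4 → Fin 4 → X) (fun k j l => f (ent (T.toE k) j l))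
        intro a b hab
        have h1 : T.toE b - T.toE a ∈ MO T N := by
          intro j l
          exact hfX _ (hKO' b b.2 j l) _ (hKO' a a.2 j l) (congrFun (congrFun hab j) l).symm
        show T.toE (g⁻¹ * ((a:T.GU)⁻¹ * b) * g⁻¹⁻¹) - 1 ∈ T.aFil Λ₄ (2*n+1)
        have h2 : T.toE (g⁻¹ * ((a:T.GU)⁻¹ * b) * g⁻¹⁻¹) - 1 =
            T.toE g⁻¹ * (T.toE (a:T.GU)⁻¹ * (T.toE b - T.toE a)) * T.toE g := by
          rw [mul_sub, toE_inv_mul, mul_sub, sub_mul, mul_one, toE_inv_mul, inv_inv, toE_mul, toE_mul, toE_mul]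
        rw [h2]
        have h3 := MO_mul (MO_mul hN2 (MO_mul (hKO _ (K.inv_mem a.2)) h1 le_rfl) le_rfl) hN1 le_rfl
        refine MO_aFil bd4 hs4 ?_ h3
        have := Int.self_le_toNat n
        simp only [N]
        push_cast
        omega
      · intro k hk
        have hk' : g⁻¹ * (k:T.GU) * g⁻¹⁻¹ ∈ T.Pset Λ₄ (2*n+1) := hk
        rw [inv_inv] at hk'
        show π k (π g w1) = π g w1
        have h1 : (k : T.GU) * g = g * (g⁻¹ * k * g) := by group
        rw [← π_mul, h1, π_mul, h4 _ (aFil_anti (m := 2*n+1) hk' (by omega)), hχ4 _ hk', one_smul])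
  refine ⟨g, ?_⟩
  intro k hk hk4
  apply hg ⟨k, hk⟩
  show π k (π g w1) = _
  have h1 : (k : T.GU) * g = g * (g⁻¹ * k * g) := by group
  rw [← π_mul, h1, π_mul, h4 _ hk4, map_smul]
end
end U17

namespace U17
open USetting
variable {F : Type u} [Field F] {T : USetting F (Fin 4 → F)}

lemma negmulE (A B : EE F) : (-A) * B = -(A * B) := LinearMap.ext fun _ => rfl
lemma mulnegE (A B : EE F) : A * (-B) = -(A * B) := LinearMap.ext fun v => map_neg A (B v)
lemma smulnegE (c : F) (B : EE F) : c • (-B) = -(c • B) := LinearMap.ext fun v => smul_neg c (B v)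
lemma conj2' : T.conj (2:F)⁻¹ = 2⁻¹ := by
  rw [map_inv₀, show (2:F) = 1 + 1 by norm_num, map_add, map_one]

lemma arch_mem (ha : ∀ x : F, ∃ k : ℕ, T.ϖ ^ (k:ℤ) * x ∈ T.O) {α} {Λ : T.LatSeq} (hs : Std T α Λ)
    (v : Fin 4 → F) : ∃ i : ℤ, v ∈ Λ.L i := by
  choose k hk using ha
  refine ⟨-∑ j, (6 * (k (v j)) + |α j|), ?_⟩
  rw [hs]
  intro j
  apply zp_mono T (hk (v j))
  have h2 := Finset.single_le_sum (f := fun j => (6 * (k (v j) : ℤ) + |α j|)) (fun i _ => by positivity) (Finset.mem_univ j)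
  have h3 := neg_abs_le (α j)
  omega

lemma arch_zero (ha : ∀ x : F, ∃ k : ℕ, T.ϖ ^ (k:ℤ) * x ∈ T.O) {x : F} (h : ∀ k : ℕ, T.ϖ ^ (-(k:ℤ)) * x ∈ T.O) : x = 0 := by
  by_contra hx
  obtain ⟨k, hk⟩ := ha x⁻¹
  have h1 := T.O.mul_mem (h (k+1)) hk
  have h2 : T.ϖ ^ (-((k+1:ℕ):ℤ)) * x * (T.ϖ ^ (k:ℤ) * x⁻¹) = T.ϖ ^ (-1:ℤ) * 1 := by
    have h3 : (-1:ℤ) = -((k+1:ℕ):ℤ) + k := by push_cast; ring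
    rw [h3, zpow_add₀ T.ϖ_ne_zero]
    field_simp
  rw [h2, ← mem_pF] at h1
  exact one_not_pF T h1

lemma arch_zero' (ha : ∀ x : F, ∃ k : ℕ, T.ϖ ^ (k:ℤ) * x ∈ T.O) {α} {Λ : T.LatSeq} (hs : Std T α Λ)
    {v : Fin 4 → F} (h : ∀ k : ℕ, v ∈ Λ.L k) : v = 0 := by
  funext j
  apply arch_zero ha
  intro k
  have := (hs _ _).mp (h (6 * k + (α j).toNat)) j
  apply zp_mono T this
  have := Int.self_le_toNat (α j)
  push_cast
  omega

lemma inv_mem {m : ℤ} (hm : 0 < m) (ha : ∀ x : F, ∃ k : ℕ, T.ϖ ^ (k:ℤ) * x ∈ T.O) {α} {Λ : T.LatSeq} (hs : Std T α Λ)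
    {Z R : EE F} (hZ : Z ∈ T.aFil Λ m) (hR : (1 - Z) * R = 1) : R ∈ T.aFil Λ 0 := by
  intro i v hv
  have h1 : R v = v + Z (R v) := by
    have := LinearMap.congr_fun hR v
    simp only [Module.End.mul_apply, LinearMap.sub_apply, Module.End.one_apply] at this
    exact sub_eq_iff_eq_add.mp this
  obtain ⟨j, hj⟩ := arch_mem ha hs (R v)
  have key : ∀ k : ℕ, R v ∈ Λ.L (min i (j + k)) := by
    intro k
    induction k with
    | zero => exact L_anti Λ (by omega) hj
    | succ k ih =>
      rw [h1]
      exact Λ.add_mem _ _ _ (L_anti Λ (by omega) hv) (L_anti Λ (by push_cast; omega) (hZ _ _ ih))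
  refine L_anti Λ ?_ (key (i - j).toNat)
  have := Int.self_le_toNat (i - j)
  omega

lemma inv_exists {m : ℤ} (hm : 0 < m) (ha : ∀ x : F, ∃ k : ℕ, T.ϖ ^ (k:ℤ) * x ∈ T.O) {α} {Λ : T.LatSeq} (hs : Std T α Λ)
    {Z : EE F} (hZ : Z ∈ T.aFil Λ m) : ∃ R : EE F, (1 - Z) * R = 1 ∧ R * (1 - Z) = 1 := by
  have hinj : Function.Injective (1 - Z : EE F) := by
    rw [← LinearMap.ker_eq_bot, LinearMap.ker_eq_bot']
    intro v hv
    have h1 : v = Z v := by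
      simpa [sub_eq_zero] using hv
    obtain ⟨j, hj⟩ := arch_mem ha hs v
    have key : ∀ k : ℕ, v ∈ Λ.L (j + k) := by
      intro k
      induction k with
      | zero => simpa using hj
      | succ k ih =>
        rw [h1]
        exact L_anti Λ (by push_cast; omega) (hZ _ _ ih)
    apply arch_zero' ha hs
    intro k
    refine L_anti Λ ?_ (key (k - j).toNat)
    have := Int.self_le_toNat (k - j)
    omega
  have hu : IsUnit (1 - Z : EE F) := by
    rw [LinearMap.isUnit_iff_ker_eq_bot, LinearMap.ker_eq_bot]
    exact hinj
  obtain ⟨U, hU⟩ := hu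
  exact ⟨↑U⁻¹, by rw [← hU]; simp, by rw [← hU]; simp⟩

section
variable {F₀ : Type w} [Field F₀] [Algebra F₀ F] [FiniteDimensional F₀ F]

lemma psi_cayley (hc : T.conj T.ϖ = T.ϖ) (h2 : (2:F) ≠ 0) (hfix : T.FixedField F₀) (hdeg : Module.finrank F₀ F = 2)
    {ψ₀ : F₀ → ℂ} (hψ : T.IsAddCh F₀ ψ₀) {n : ℤ} {α} {Λ : T.LatSeq} (hs : Std T α Λ)
    {β Z R : EE F} (hβ : β ∈ T.aFil Λ (-(2*n))) (hZ : Z ∈ T.aFil Λ (n+1)) (hR : R ∈ T.aFil Λ 0)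
    (hRZ : (1 - Z) * R = 1) :
    (1 + Z) * R - 1 ∈ T.aFil Λ (n+1) ∧ 
    ψ₀ (trA0 F₀ (β * ((1 + Z) * R - 1))) = ψ₀ (trA0 F₀ (β * (Z + Z))) := by
  have e0 : R = 1 + Z * R := by
    rw [sub_mul, one_mul] at hRZ
    rw [← hRZ]; abel
  have e1 : (1 + Z) * R - 1 = Z * R + Z * R := by
    rw [add_mul, one_mul]
    nth_rewrite 1 [e0]
    abel
  have e2 : (1 + Z) * R - 1 = (Z + Z) + (Z * Z * R + Z * Z * R) := by
    rw [e1]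
    have : Z * R = Z + Z * Z * R := by
      nth_rewrite 1 [e0]
      rw [mul_add, mul_one, mul_assoc]
    rw [this]
    abel
  refine ⟨?_, ?_⟩
  · rw [e1]
    have := aFil_mul (k := n+1) hZ hR (by ring)
    exact aFil_add this this
  · have h3 : Z * Z * R ∈ T.aFil Λ (2*n+2) := aFil_mul (aFil_mul (k := 2*n+2) hZ hZ (by ring)) hR (by ring)
    have h4 : β * (Z * Z * R + Z * Z * R) ∈ T.aFil Λ 1 :=
      aFil_anti (aFil_mul (k := 2) hβ (aFil_add h3 h3) (by ring)) (by norm_num)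
    rw [e2, mul_add]
    unfold trA0
    rw [map_add, map_add, hψ.1, ψ_tr_one hc h2 hfix hdeg hψ (tr_mem hs h4), mul_one]

lemma pair_skew (ha : ∀ x : F, ∃ k : ℕ, T.ϖ ^ (k:ℤ) * x ∈ T.O)
    (hc : T.conj T.ϖ = T.ϖ) (h2 : (2:F) ≠ 0 ∧ (2:F)⁻¹ ∈ T.O) (hfix : T.FixedField F₀) (hdeg : Module.finrank F₀ F = 2)
    {ψ₀ : F₀ → ℂ} (hψ : T.IsAddCh F₀ ψ₀) {n : ℤ} (hn : 0 < n) {Λ₄ Λ₅ : T.LatSeq} (hs4 : Std T α4 Λ₄) (hs5 : Std T α5 Λ₅)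
    {β γ : EE F} (hβ : β ∈ T.aFil Λ₄ (-(2*n))) (hγ : γ ∈ T.aFil Λ₅ (-(2*n))) {g : T.GU}
    (hg : ∀ k ∈ T.Pset Λ₅ (n+1), g⁻¹ * k * g ∈ T.Pset Λ₄ (n+1) → T.psiCh F₀ ψ₀ γ k = T.psiCh F₀ ψ₀ β (g⁻¹ * k * g))
    {Y : EE F} (hY : T.σA Y = -Y) (hY5 : Y ∈ T.aFil Λ₅ (n+1)) (hY4 : T.toE g⁻¹ * Y * T.toE g ∈ T.aFil Λ₄ (n+1)) :
    ψ₀ (trA0 F₀ ((γ - T.toE g * β * T.toE g⁻¹) * Y)) = 1 := by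
  obtain ⟨h2, h2i⟩ := h2
  have conj2 : T.conj (2:F)⁻¹ = 2⁻¹ := conj2'
  let Z : EE F := (2:F)⁻¹ • Y
  have hZZ : Z + Z = Y := by
    simp only [Z]
    rw [← add_smul]
    have : (2:F)⁻¹ + 2⁻¹ = 1 := by field_simp; norm_num
    rw [this, one_smul]
  have hZσ : T.σA Z = -Z := by
    simp only [Z]; rw [σ_smul, hY, conj2, smulnegE]
  have hZ5 : Z ∈ T.aFil Λ₅ (n+1) := aFil_smul h2i hY5
  obtain ⟨R, hR1, hR2⟩ := inv_exists (by omega) ha hs5 hZ5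
  have hR5 := inv_mem (by omega) ha hs5 hZ5 hR1
  have s1 : T.σA R * (1 + Z) = 1 := by
    have := congrArg T.σA hR1
    rw [T.σA_mul, σ_sub, T.σA_one, hZσ, sub_neg_eq_add] at this
    exact this
  have s2 : (1 + Z) * T.σA R = 1 := by
    have := congrArg T.σA hR2
    rw [T.σA_mul, σ_sub, T.σA_one, hZσ, sub_neg_eq_add] at this
    exact this
  have hcomm : (1 - Z) * (1 + Z) = (1 + Z) * (1 - Z) := by
    simp only [sub_mul, mul_sub, mul_add, add_mul, one_mul, mul_one]; abel
  have hcR : (1 + Z) * R = R * (1 + Z) := by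
    calc (1 + Z) * R = R * (1 - Z) * ((1 + Z) * R) := by rw [hR2, one_mul]
      _ = R * ((1 - Z) * (1 + Z)) * R := by simp only [mul_assoc]
      _ = R * (1 + Z) * ((1 - Z) * R) := by rw [hcomm]; simp only [mul_assoc]
      _ = _ := by rw [hR1, mul_one]
  have hσk : T.σA ((1 + Z) * R) = T.σA R * (1 - Z) := by
    rw [T.σA_mul, T.σA_add, T.σA_one, hZσ, ← sub_eq_add_neg]
  let k : T.GU := mkG ((1 + Z) * R) (by
      rw [hσk]
      calc T.σA R * (1 - Z) * ((1 + Z) * R) = T.σA R * ((1 - Z) * (1 + Z)) * R := by simp only [mul_assoc]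
        _ = (T.σA R * (1 + Z)) * ((1 - Z) * R) := by rw [hcomm]; simp only [mul_assoc]
        _ = 1 := by rw [s1, hR1, one_mul]) (by
      rw [hσk, hcR]
      calc R * (1 + Z) * (T.σA R * (1 - Z)) = R * ((1 + Z) * T.σA R) * (1 - Z) := by simp only [mul_assoc]
        _ = 1 := by rw [s2, mul_one, hR2])
  have hk : T.toE k = (1 + Z) * R := rfl
  set g' := T.toE g⁻¹ with hg'
  set g0 := T.toE g with hg0
  have gg : g0 * g' = 1 := toE_mul_inv g
  have gg' : g' * g0 = 1 := toE_inv_mul g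
  have cmul : ∀ A B : EE F, g' * (A * B) * g0 = (g' * A * g0) * (g' * B * g0) := by
    intro A B
    calc g' * (A * B) * g0 = g' * A * 1 * B * g0 := by simp only [mul_assoc, one_mul]
      _ = _ := by rw [← gg]; simp only [mul_assoc]
  let Z4 := g' * Z * g0
  let R4 := g' * R * g0
  have hZ4 : Z4 ∈ T.aFil Λ₄ (n+1) := by
    have := aFil_smul h2i hY4
    simp only [Z4, Z]
    rwa [mul_smul_comm, smul_mul_assoc]
  have c1 : ∀ A, g' * (1 + A) * g0 = 1 + g' * A * g0 := by
    intro A; rw [mul_add, add_mul, mul_one, gg']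
  have c2 : ∀ A, g' * (1 - A) * g0 = 1 - g' * A * g0 := by
    intro A; rw [mul_sub, sub_mul, mul_one, gg']
  have hR4 : (1 - Z4) * R4 = 1 := by
    rw [← c2, ← cmul, hR1, mul_one, gg']
  have hR44 := inv_mem (by omega) ha hs4 hZ4 hR4
  have hk4 : T.toE (g⁻¹ * k * g) = (1 + Z4) * R4 := by
    rw [toE_mul, toE_mul, hk, ← c1, ← cmul]
  obtain ⟨p5, q5⟩ := psi_cayley hc h2 hfix hdeg hψ hs5 hγ hZ5 hR5 hR1
  obtain ⟨p4, q4⟩ := psi_cayley hc h2 hfix hdeg hψ hs4 hβ hZ4 hR44 hR4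
  have key := hg k (by show T.toE k - 1 ∈ T.aFil Λ₅ (n+1); rw [hk]; exact p5) (by show T.toE (g⁻¹ * k * g) - 1 ∈ T.aFil Λ₄ (n+1); rw [hk4]; exact p4)
  unfold psiCh at key
  rw [hk, hk4, q5, q4, hZZ] at key
  have hZ44 : Z4 + Z4 = g' * Y * g0 := by
    simp only [Z4]; rw [← add_mul, ← mul_add, hZZ]
  rw [hZ44] at key
  have htr : trA0 F₀ (β * (g' * Y * g0)) = trA0 F₀ (g0 * β * g' * Y) := by
    unfold trA0
    congr 1
    rw [← mul_assoc, LinearMap.trace_mul_comm]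
    simp only [mul_assoc]
  rw [htr] at key
  have hadd : trA0 F₀ (γ * Y) = trA0 F₀ ((γ - g0 * β * g') * Y) + trA0 F₀ (g0 * β * g' * Y) := by
    unfold trA0
    rw [← map_add, ← map_add, ← add_mul, sub_add_cancel]
  rw [hadd, hψ.1] at key
  have h0 : ψ₀ (trA0 F₀ (g0 * β * g' * Y)) ≠ 0 := by
    intro h
    have ψ00 : ψ₀ 0 = 1 := hψ.2.1 0 ⟨0, T.O.zero_mem, by simp⟩
    have := hψ.1 (trA0 F₀ (g0 * β * g' * Y)) (-(trA0 F₀ (g0 * β * g' * Y)))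
    rw [add_neg_cancel, h, ψ00, zero_mul] at this
    exact one_ne_zero this
  exact (mul_eq_right₀ h0).mp key

lemma pair_all (ha : ∀ x : F, ∃ k : ℕ, T.ϖ ^ (k:ℤ) * x ∈ T.O) (hf : T.IsU4Form)
    (hc : T.conj T.ϖ = T.ϖ) (h2 : (2:F) ≠ 0 ∧ (2:F)⁻¹ ∈ T.O) (hfix : T.FixedField F₀) (hdeg : Module.finrank F₀ F = 2)
    {ψ₀ : F₀ → ℂ} (hψ : T.IsAddCh F₀ ψ₀) {n : ℤ} (hn : 0 < n) {Λ₄ Λ₅ : T.LatSeq} (hs4 : Std T α4 Λ₄) (hs5 : Std T α5 Λ₅)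
    {β γ : EE F} (hβ : β ∈ T.aFil Λ₄ (-(2*n))) (hγ : γ ∈ T.aFil Λ₅ (-(2*n))) 
    (hβs : T.σA β = -β) (hγs : T.σA γ = -γ) {g : T.GU}
    (hg : ∀ k ∈ T.Pset Λ₅ (n+1), g⁻¹ * k * g ∈ T.Pset Λ₄ (n+1) → T.psiCh F₀ ψ₀ γ k = T.psiCh F₀ ψ₀ β (g⁻¹ * k * g))
    {Y : EE F} (hY5 : Y ∈ T.aFil Λ₅ (n+1)) (hY4 : T.toE g⁻¹ * Y * T.toE g ∈ T.aFil Λ₄ (n+1)) :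
    LinearMap.trace F _ ((γ - T.toE g * β * T.toE g⁻¹) * Y) ∈ T.pF := by
  rcases inv_or_pF T (x := LinearMap.trace F _ ((γ - T.toE g * β * T.toE g⁻¹) * Y)) with h | ⟨hz0, hzi⟩
  · exact h
  exfalso
  have conj2 : T.conj (2:F)⁻¹ = 2⁻¹ := conj2'
  have hσg : T.σA (T.toE g) = T.toE g⁻¹ := (toE_inv g).symm
  have hσg' : T.σA (T.toE g⁻¹) = T.toE g := by rw [toE_inv, T.σA_invol]
  set X := γ - T.toE g * β * T.toE g⁻¹ with hX
  have hXσ : T.σA X = -X := by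
    rw [hX, σ_sub, T.σA_mul, T.σA_mul, hσg, hσg', hβs, hγs]
    simp only [negmulE, mulnegE, mul_assoc]
    abel
  set z := LinearMap.trace F _ (X * Y) with hz
  obtain ⟨x0, hx0, hx1⟩ := hψ.2.2
  apply hx1
  let c : F := algebraMap F₀ F x0 * (2:F)⁻¹ * z⁻¹
  have hcO : c ∈ T.O := T.O.mul_mem (T.O.mul_mem hx0 h2.2) hzi
  have hx0c : T.conj (algebraMap F₀ F x0) = algebraMap F₀ F x0 := (hfix _).mpr ⟨x0, rfl⟩
  let Y1 : EE F := c • Y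
  let Y2 : EE F := (2:F)⁻¹ • (Y1 - T.σA Y1)
  have hd4 := selfdual4 hf hc hs4
  have hd5 := selfdual5 hf hc hs5
  have m5 : Y1 ∈ T.aFil Λ₅ (n+1) := aFil_smul hcO hY5
  have m4 : T.toE g⁻¹ * Y1 * T.toE g ∈ T.aFil Λ₄ (n+1) := by
    have := aFil_smul hcO hY4
    simp only [Y1]
    rwa [mul_smul_comm, smul_mul_assoc]
  have m4' : T.toE g⁻¹ * T.σA Y1 * T.toE g ∈ T.aFil Λ₄ (n+1) := by
    have := σ_aFil hd4 m4
    rw [T.σA_mul, T.σA_mul, hσg, hσg'] at this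
    rwa [mul_assoc]
  have key := pair_skew ha hc h2 hfix hdeg hψ hn hs4 hs5 hβ hγ hg (Y := Y2) (by
      simp only [Y2]
      rw [σ_smul, conj2, σ_sub, T.σA_invol, ← smulnegE, neg_sub])
    (aFil_smul h2.2 (aFil_sub m5 (σ_aFil hd5 m5))) (by
      simp only [Y2]
      rw [mul_smul_comm, smul_mul_assoc, mul_sub, sub_mul]
      exact aFil_smul h2.2 (aFil_sub m4 m4'))
  have t1 : LinearMap.trace F _ (X * Y1) = algebraMap F₀ F x0 * (2:F)⁻¹ := by
    simp only [Y1]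
    rw [mul_smul_comm, map_smul, ← hz, smul_eq_mul]
    simp only [c]
    field_simp
  have t2 : LinearMap.trace F _ (X * T.σA Y1) = - (algebraMap F₀ F x0 * (2:F)⁻¹) := by
    have e1 : X * T.σA Y1 = - T.σA (Y1 * X) := by
      rw [T.σA_mul, hXσ, negmulE, neg_neg]
    rw [e1, map_neg, tr_σ hf, LinearMap.trace_mul_comm, t1, map_mul, hx0c, conj2]
  have t3 : LinearMap.trace F _ (X * Y2) = algebraMap F₀ F x0 * (2:F)⁻¹ := by
    simp only [Y2]
    rw [mul_smul_comm, map_smul, mul_sub, map_sub, t1, t2, smul_eq_mul]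
    have := h2.1
    field_simp
    ring
  have t4 : trA0 F₀ (X * Y2) = x0 := by
    apply (algebraMap F₀ F).injective
    unfold trA0
    rw [trace_alg h2.1 hfix hdeg, t3, map_mul, hx0c, conj2]
    have := h2.1
    field_simp
    ring
  rw [t4] at key
  exact key
end
end U17

namespace U17
open USetting
variable {F : Type u} [Field F] {T : USetting F (Fin 4 → F)}

lemma sep (A : ValuationSubring F) {V : Type*} [AddCommGroup V] [Module F V]
    (M : Submodule A V) (hfg : M.FG) (hsp : Submodule.span F (M : Set V) = ⊤) (x : V)
    (h : ∀ f : V →ₗ[F] F, (∀ m ∈ M, f m ∈ A) → f x ∈ A) : x ∈ M := by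
  have : Submodule.IsLattice F M := ⟨hfg, hsp⟩
  have t1 := Module.IsTorsionFree.trans_faithfulSMul A F V
  have hfl : Module.Flat A M := by
    rw [Module.Flat.flat_iff_torsion_eq_bot_of_isBezout, ← Submodule.isTorsionFree_iff_torsion_eq_bot]
    infer_instance
  have hfin : Module.Finite A M := Submodule.IsLattice.finite F M
  have hfr : Module.Free A M := Module.free_of_flat_of_isLocalRing
  let b := Module.Free.chooseBasis A M
  let b' := b.extendOfIsLattice F
  have hb' : ∀ i, b' i = (b i : V) := fun i => Module.Basis.extendOfIsLattice_apply F b i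
  have hrep : ∀ m : M, ∀ i, b'.repr (m : V) i = (b.repr m i : F) := by
    intro m i
    have h1 : (m : V) = ∑ j, ((b.repr m j : A) : F) • b' j := by
      conv_lhs => rw [← b.sum_repr m]
      rw [Submodule.coe_sum]
      apply Finset.sum_congr rfl
      intro j _
      rw [hb']
      rfl
    conv_lhs => rw [h1]
    rw [b'.repr_sum_self]
  have hx : ∀ i, b'.repr x i ∈ A := by
    intro i
    apply h (b'.coord i)
    intro m hm
    have := hrep ⟨m, hm⟩ i
    rw [Module.Basis.coord_apply, this]
    exact SetLike.coe_mem _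
  rw [← b'.sum_repr x]
  apply Submodule.sum_mem
  intro i _
  rw [hb']
  exact M.smul_mem (⟨_, hx i⟩ : A) (b i).2

lemma VS_aux (T : USetting F (Fin 4 → F)) (x : F) : x ∈ T.O ∨ x⁻¹ ∈ T.O := by
  by_cases h : x = 0
  · left; rw [h]; exact T.O.zero_mem
  · exact T.O_val x h

def VS (T : USetting F (Fin 4 → F)) : ValuationSubring F where
  toSubring := T.O
  mem_or_inv_mem' := VS_aux T

lemma mem_VS {x : F} : x ∈ VS T ↔ x ∈ T.O := Iff.rfl

variable (T) in
/-- generators of the lattice a_m -/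
def gen (α : Fin 4 → ℤ) (m : ℤ) (p : Fin 4 × Fin 4) : EE F := Eab (T.ϖ ^ (-((α p.1 - α p.2 - m)/6))) p.1 p.2

lemma gen_mem {α} {Λ : T.LatSeq} (hs : Std T α Λ) (m : ℤ) (p) : gen T α m p ∈ T.aFil Λ m := by
  rw [aFil_iff hs]
  intro j k
  unfold gen
  rw [Eab_ent]
  split_ifs with h
  · rw [h.1, h.2, ← zpow_add₀ T.ϖ_ne_zero, add_neg_cancel, zpow_zero]; exact T.O.one_mem
  · simp

lemma ent_ext {X Y : EE F} (h : ∀ j k, ent X j k = ent Y j k) : X = Y := by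
  apply LinearMap.ext
  intro v
  funext j
  rw [apply_eq, apply_eq]
  simp only [h]

lemma eq_sum_gen (α : Fin 4 → ℤ) (m : ℤ) (X : EE F) :
    X = ∑ p : Fin 4 × Fin 4, (T.ϖ ^ ((α p.1 - α p.2 - m)/6) * ent X p.1 p.2) • gen T α m p := by
  apply ent_ext
  intro j k
  have : ent (∑ p : Fin 4 × Fin 4, (T.ϖ ^ ((α p.1 - α p.2 - m)/6) * ent X p.1 p.2) • gen T α m p) j k =
     ∑ p : Fin 4 × Fin 4, (T.ϖ ^ ((α p.1 - α p.2 - m)/6) * ent X p.1 p.2) * ent (gen T α m p) j k := by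
    simp [ent, LinearMap.sum_apply, Finset.sum_apply]
  rw [this, Finset.sum_eq_single (j, k)]
  · unfold gen
    rw [Eab_ent, if_pos ⟨rfl, rfl⟩]
    simp only
    rw [mul_right_comm, ← zpow_add₀ T.ϖ_ne_zero, add_neg_cancel, zpow_zero, one_mul]
  · rintro ⟨a, b⟩ _ hab
    unfold gen
    rw [Eab_ent, if_neg, mul_zero]
    rintro ⟨rfl, rfl⟩
    exact hab rfl
  · simp

lemma fun_tr (f : EE F →ₗ[F] F) : ∃ Y : EE F, ∀ X, f X = LinearMap.trace F _ (Y * X) := by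
  let Y : EE F := Matrix.toLin' (Matrix.of fun i l => f (Eab 1 l i))
  have hY : ∀ i l, ent Y i l = f (Eab 1 l i) := by
    intro i l
    simp [ent, Y]
  refine ⟨Y, ?_⟩
  intro X
  have h : X = ∑ i, ∑ l, ent X l i • Eab 1 l i := by
    apply ent_ext
    intro j k
    have : ent (∑ i, ∑ l, ent X l i • Eab 1 l i) j k = ∑ i, ∑ l, ent X l i * ent (Eab 1 l i) j k := by
      simp [ent, LinearMap.sum_apply, Finset.sum_apply]
    rw [this, Finset.sum_eq_single k, Finset.sum_eq_single j]
    · simp [Eab_ent]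
    · intro b _ hb; simp [Eab_ent, hb.symm]
    · simp
    · intro b _ hb; simp [Eab_ent, hb.symm]
    · simp
  conv_lhs => rw [h]
  rw [trace_eq]
  simp only [ent_mul, hY, map_sum, map_smul, smul_eq_mul]
  apply Finset.sum_congr rfl
  intro i _
  apply Finset.sum_congr rfl
  intro l _
  exact mul_comm _ _

theorem lat_dual {Λ₄ Λ₅ : T.LatSeq} (hs4 : Std T α4 Λ₄) (hs5 : Std T α5 Λ₅) {m : ℤ} {g : T.GU} {X : EE F}
    (h : ∀ Y : EE F, Y ∈ T.aFil Λ₅ (1 - m) → T.toE g⁻¹ * Y * T.toE g ∈ T.aFil Λ₄ (1 - m) →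
      LinearMap.trace F _ (X * Y) ∈ T.pF) :
    ∃ X1 ∈ T.aFil Λ₅ m, ∃ X2 ∈ T.aFil Λ₄ m, X = X1 + T.toE g * X2 * T.toE g⁻¹ := by
  let c : EE F → EE F := fun X => T.toE g * X * T.toE g⁻¹
  let S : Set (EE F) := Set.range (gen T α5 m) ∪ Set.range fun p => c (gen T α4 m p)
  let M : Submodule (VS T) (EE F) := Submodule.span (VS T) S
  have m5 : ∀ Y ∈ T.aFil Λ₅ m, Y ∈ M := by
    intro Y hY
    rw [eq_sum_gen (T := T) α5 m Y]
    apply Submodule.sum_mem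
    intro p _
    exact M.smul_mem (⟨_, (aFil_iff hs5).mp hY p.1 p.2⟩ : VS T) (Submodule.subset_span (Or.inl ⟨p, rfl⟩))
  have m4 : ∀ Y ∈ T.aFil Λ₄ m, c Y ∈ M := by
    intro Y hY
    have : c Y = ∑ p : Fin 4 × Fin 4, (T.ϖ ^ ((α4 p.1 - α4 p.2 - m)/6) * ent Y p.1 p.2) • c (gen T α4 m p) := by
      conv_lhs => rw [eq_sum_gen (T := T) α4 m Y]
      simp only [c, Finset.mul_sum, Finset.sum_mul, mul_smul_comm, smul_mul_assoc]
    rw [this]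
    apply Submodule.sum_mem
    intro p _
    exact M.smul_mem (⟨_, (aFil_iff hs4).mp hY p.1 p.2⟩ : VS T) (Submodule.subset_span (Or.inr ⟨p, rfl⟩))
  have hX : X ∈ M := by
    apply sep (VS T) M
    · exact Submodule.fg_span (Set.toFinite S)
    · rw [eq_top_iff]
      rintro Y -
      rw [eq_sum_gen (T := T) α5 m Y]
      apply Submodule.sum_mem
      intro p _
      exact Submodule.smul_mem _ _ (Submodule.subset_span (m5 _ (gen_mem hs5 m p)))
    · intro f hf
      obtain ⟨Y, hY⟩ := fun_tr f
      have hp : ∀ z ∈ T.O, T.ϖ * z ∈ T.pF := fun z hz => ⟨z, hz, rfl⟩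
      have h1 := h (T.ϖ • Y) (by
        apply dual_mem hs5
        intro Z hZ
        rw [smul_mul_assoc, map_smul, smul_eq_mul, ← hY]
        exact hp _ (hf _ (m5 Z hZ))) (by
        apply dual_mem hs4
        intro Z hZ
        rw [mul_smul_comm, smul_mul_assoc, smul_mul_assoc, map_smul, smul_eq_mul]
        have : LinearMap.trace F _ (T.toE g⁻¹ * Y * T.toE g * Z) = f (c Z) := by
          rw [hY, mul_assoc, mul_assoc, LinearMap.trace_mul_comm]
          simp only [c, mul_assoc]
        rw [this]
        exact hp _ (hf _ (m4 Z hZ)))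
      rw [mul_smul_comm, map_smul, smul_eq_mul, LinearMap.trace_mul_comm, ← hY] at h1
      obtain ⟨z, hz, e⟩ := h1
      rw [mul_left_cancel₀ T.ϖ_ne_zero e]
      exact hz
  refine Submodule.span_induction (p := fun X _ => ∃ X1 ∈ T.aFil Λ₅ m, ∃ X2 ∈ T.aFil Λ₄ m, X = X1 + T.toE g * X2 * T.toE g⁻¹)
    ?_ ?_ ?_ ?_ hX
  · rintro _ (⟨p, rfl⟩ | ⟨p, rfl⟩)
    · exact ⟨_, gen_mem hs5 m p, 0, fun i v _ => Λ₄.zero_mem _, by simp⟩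
    · exact ⟨0, fun i v _ => Λ₅.zero_mem _, _, gen_mem hs4 m p, by simp [c]⟩
  · exact ⟨0, fun i v _ => Λ₅.zero_mem _, 0, fun i v _ => Λ₄.zero_mem _, by simp⟩
  · rintro _ _ - - ⟨a, ha, b, hb, rfl⟩ ⟨a', ha', b', hb', rfl⟩
    refine ⟨_, aFil_add ha ha', _, aFil_add hb hb', ?_⟩
    rw [mul_add, add_mul]; abel
  · rintro r _ - ⟨a, ha, b, hb, rfl⟩
    refine ⟨_, aFil_smul r.2 ha, _, aFil_smul r.2 hb, ?_⟩
    rw [mul_smul_comm, smul_mul_assoc, ← smul_add]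
    rfl
end U17

namespace U17
open USetting
variable {F : Type u} [Field F] {T : USetting F (Fin 4 → F)}

lemma h_lam5 (hf : T.IsU4Form) (hc : T.conj T.ϖ = T.ϖ) {Λ : T.LatSeq} (hs : Std T α5 Λ) {c : F}
    (hcO : c ∈ T.O) (hcu : c ∉ T.pF) {v : Fin 4 → F}
    (hv : v - c • (Pi.single 1 1 : Fin 4 → F) ∈ Λ.L 5) :
    T.ϖ ^ (-1:ℤ) * T.h v v ∈ T.O ∧ T.ϖ ^ (-2:ℤ) * T.h v v ∉ T.O := by
  set w := v - c • (Pi.single 1 1 : Fin 4 → F) with hw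
  have hwj : ∀ j, T.ϖ ^ (-1:ℤ) * w j ∈ T.O := by
    intro j
    apply zp_mono T ((hs _ _).mp hv j)
    fin_cases j <;> simp [α5]
  have hv' : v = c • (Pi.single 1 1 : Fin 4 → F) + w := by rw [hw]; abel
  have v0 : v 0 = w 0 := by rw [hv']; simp
  have v1 : v 1 = c + w 1 := by rw [hv']; simp
  have v2 : v 2 = w 2 := by rw [hv']; simp
  have v3 : v 3 = w 3 := by rw [hv']; simp
  have hwc : ∀ j, T.ϖ ^ (-1:ℤ) * T.conj (w j) ∈ T.O := fun j => zp_conj T hc (hwj j)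
  have zO : ∀ {x}, x ∈ T.O → T.ϖ ^ (0:ℤ) * x ∈ T.O := by intro x hx; simpa using hx
  have zϖ : T.ϖ ^ (-1:ℤ) * T.ϖ ∈ T.O := by
    rw [zpow_neg_one, inv_mul_cancel₀ T.ϖ_ne_zero]; exact T.O.one_mem
  have hcc := T.conj_O c hcO
  have e : T.h v v = T.ϖ * (T.conj c * c) + (T.conj (w 0) * w 3 + T.ϖ * (T.conj c * w 1) + T.ϖ * (T.conj (w 1) * c)
      + T.ϖ * (T.conj (w 1) * w 1) + T.conj (w 2) * w 2 + T.conj (w 3) * w 0) := by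
    rw [hf, v0, v1, v2, v3, map_add]; ring
  have r : T.ϖ ^ (-2:ℤ) * (T.conj (w 0) * w 3 + T.ϖ * (T.conj c * w 1) + T.ϖ * (T.conj (w 1) * c)
      + T.ϖ * (T.conj (w 1) * w 1) + T.conj (w 2) * w 2 + T.conj (w 3) * w 0) ∈ T.O := by
    refine zp_add T (zp_add T (zp_add T (zp_add T (zp_add T ?_ ?_) ?_) ?_) ?_) ?_
    · exact zp_mul T (hwc 0) (hwj 3) (by norm_num)
    · exact zp_mul T zϖ (zp_mul T (zO hcc) (hwj 1) (c := -1) (by norm_num)) (by norm_num)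
    · exact zp_mul T zϖ (zp_mul T (hwc 1) (zO hcO) (c := -1) (by norm_num)) (by norm_num)
    · exact zp_mul T zϖ (zp_mul T (hwc 1) (hwj 1) (c := -1) (by norm_num)) (by norm_num)
    · exact zp_mul T (hwc 2) (hwj 2) (by norm_num)
    · exact zp_mul T (hwc 3) (hwj 0) (by norm_num)
  rw [e]
  constructor
  · refine zp_add T ?_ (zp_mono T r (by norm_num))
    exact zp_mul T zϖ (zp_mul T (zO hcc) (zO hcO) (c := 0) (by norm_num)) (by norm_num)
  · intro h
    have h1 := T.O.sub_mem h r
    rw [mul_add, add_sub_cancel_right] at h1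
    have h2 : T.ϖ ^ (-2:ℤ) * (T.ϖ * (T.conj c * c)) = T.ϖ ^ (-1:ℤ) * (T.conj c * c) := by
      rw [show (-1:ℤ) = -2 + 1 by norm_num, zpow_add₀ T.ϖ_ne_zero, zpow_one]; ring
    rw [h2] at h1
    rcases unit_or_pF T hcO with h3 | ⟨h3, h4⟩
    · exact hcu h3
    · have h5 := T.O.mul_mem h1 (T.O.mul_mem h4 (T.conj_O _ h4))
      have h6 : T.conj c ≠ 0 := by simpa using h3
      have h7 : T.ϖ ^ (-1:ℤ) * (T.conj c * c) * (c⁻¹ * T.conj c⁻¹) = T.ϖ ^ (-1:ℤ) * 1 := by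
        rw [map_inv₀]; field_simp
      rw [h7, ← mem_pF] at h5
      exact one_not_pF T h5

lemma h_lam4 (hf : T.IsU4Form) (hc : T.conj T.ϖ = T.ϖ) {Λ : T.LatSeq} (hs : Std T α4 Λ) {a : ℤ} {v : Fin 4 → F}
    (hv : v ∈ Λ.L (6*a+2)) (h1 : T.ϖ ^ (-1:ℤ) * T.h v v ∈ T.O) (h2 : T.ϖ ^ (-2:ℤ) * T.h v v ∉ T.O) :
    a ≤ 0 ∧ v ∈ Λ.L (6*a+3) := by
  have hv' := (hs _ _).mp hv
  have w0 : T.ϖ ^ (-a) * v 0 ∈ T.O := zp_mono T (hv' 0) (by simp [α4]; omega)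
  have w1 : T.ϖ ^ (-a) * v 1 ∈ T.O := zp_mono T (hv' 1) (by simp [α4]; omega)
  have w2 : T.ϖ ^ (-a) * v 2 ∈ T.O := zp_mono T (hv' 2) (by simp [α4]; omega)
  have w3 : T.ϖ ^ (-a-1) * v 3 ∈ T.O := zp_mono T (hv' 3) (by simp [α4]; omega)
  have zϖ : T.ϖ ^ (-1:ℤ) * T.ϖ ∈ T.O := by
    rw [zpow_neg_one, inv_mul_cancel₀ T.ϖ_ne_zero]; exact T.O.one_mem
  have r : T.ϖ ^ (-(2*a)-1) * (T.conj (v 0) * v 3 + T.ϖ * (T.conj (v 1) * v 1) + T.conj (v 3) * v 0) ∈ T.O := by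
    refine zp_add T (zp_add T ?_ ?_) ?_
    · exact zp_mul T (zp_conj T hc w0) w3 (by omega)
    · exact zp_mul T zϖ (zp_mul T (zp_conj T hc w1) w1 (c := -(2*a)) (by omega)) (by omega)
    · exact zp_mul T (zp_conj T hc w3) w0 (by omega)
  have e : T.h v v = T.conj (v 2) * v 2 + (T.conj (v 0) * v 3 + T.ϖ * (T.conj (v 1) * v 1) + T.conj (v 3) * v 0) := by
    rw [hf]; ring
  have ha : a ≤ 0 := by
    by_contra ha
    apply h2
    rw [e]
    exact zp_add T (zp_mul T (zp_conj T hc w2) w2 (by omega)) (zp_mono T r (by omega))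
  refine ⟨ha, ?_⟩
  have s1 : T.ϖ ^ (-(2*a)-1) * (T.conj (v 2) * v 2) ∈ T.O := by
    have := T.O.sub_mem (zp_mono T h1 (b := -(2*a)-1) (by omega)) r
    rw [e, mul_add, add_sub_cancel_right] at this
    exact this
  have t : T.ϖ ^ (-a) * v 2 ∈ T.pF := by
    rcases unit_or_pF T w2 with h3 | ⟨h3, h4⟩
    · exact h3
    · exfalso
      have h5 := T.O.mul_mem s1 (T.O.mul_mem h4 (T.conj_O _ h4))
      have hv2 : v 2 ≠ 0 := right_ne_zero_of_mul h3
      have hv2' : T.conj (v 2) ≠ 0 := by simpa using hv2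
      have hz : T.ϖ ^ (-a) ≠ 0 := zpow_ne_zero _ T.ϖ_ne_zero
      have h7 : T.ϖ ^ (-(2*a)-1) * (T.conj (v 2) * v 2) * ((T.ϖ ^ (-a) * v 2)⁻¹ * T.conj (T.ϖ ^ (-a) * v 2)⁻¹) = T.ϖ ^ (-1:ℤ) * 1 := by
        rw [show -(2*a)-1 = -1 + (-a) + (-a) by ring, zpow_add₀ T.ϖ_ne_zero, zpow_add₀ T.ϖ_ne_zero, map_inv₀, map_mul,
          map_zpow₀, hc]
        generalize T.ϖ ^ (-a) = z at *
        generalize T.ϖ ^ (-1:ℤ) = z' at *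
        field_simp
      rw [h7, ← mem_pF] at h5
      exact one_not_pF T h5
  rw [mem_pF, zpe] at t
  rw [hs]
  intro j
  fin_cases j
  · exact zp_mono T w0 (by simp [α4]; omega)
  · exact zp_mono T w1 (by simp [α4]; omega)
  · exact zp_mono T t (by simp [α4]; omega)
  · exact zp_mono T w3 (by simp [α4]; omega)

theorem final (ha : ∀ x : F, ∃ k : ℕ, T.ϖ ^ (k:ℤ) * x ∈ T.O) (hf : T.IsU4Form) (hc : T.conj T.ϖ = T.ϖ)
    {n : ℤ} {p q} (hg : Good n p q) {Λ₄ Λ₅ : T.LatSeq} (hs4 : Std T α4 Λ₄) (hs5 : Std T α5 Λ₅)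
    {β γ : EE F} (hβ : β ∈ T.aFil Λ₄ (-(2*n))) (hγ : γ ∈ T.aFil Λ₅ (-(2*n))) (hu : ucoef T n p q β ∉ T.pF)
    {g : T.GU} (hgβ : γ = T.toE g * β * T.toE g⁻¹) : False := by
  set u := ucoef T n p q β with hu'
  have huO : u ∈ T.O := ucoef_mem hs4 hg hβ
  have huu : ∀ N : ℕ, (-u) ^ N ∉ T.pF := by
    intro N h
    rcases unit_or_pF T huO with h1 | ⟨h1, h2⟩
    · exact hu h1
    · obtain ⟨z, hz, e⟩ := h
      apply one_not_pF T
      refine ⟨z * (-u⁻¹) ^ N, T.O.mul_mem hz (T.O.pow_mem (T.O.neg_mem h2) N), ?_⟩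
      rw [← mul_assoc, ← e, ← mul_pow, neg_mul_neg, mul_inv_cancel₀ h1, one_pow]
  have hy : ∀ v, yE T n γ v = T.toE g (yE T n β (T.toE g⁻¹ v)) := by
    have gg' : T.toE g⁻¹ * T.toE g = 1 := toE_inv_mul g
    have : yE T n γ = T.toE g * yE T n β * T.toE g⁻¹ := by
      unfold yE
      rw [mul_smul_comm, smul_mul_assoc]
      congr 1
      rw [hgβ]
      calc (T.toE g * β * T.toE g⁻¹) ^ 3 = T.toE g * β * (T.toE g⁻¹ * T.toE g) * β * (T.toE g⁻¹ * T.toE g) * β * T.toE g⁻¹ := by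
            simp only [pow_succ, pow_zero, one_mul, mul_assoc]
        _ = _ := by rw [gg']; simp only [pow_succ, pow_zero, one_mul, mul_assoc]
    intro v; rw [this]; rfl
  let e1 : Fin 4 → F := Pi.single 1 1
  let v : ℕ → (Fin 4 → F) := fun N => Nat.rec e1 (fun _ x => yE T n γ x - u • x) N
  have v0 : v 0 = e1 := rfl
  have vs : ∀ N, v (N+1) = yE T n γ (v N) - u • v N := fun N => rfl
  have he1 : e1 ∈ Λ₅.L 4 := by
    have := single_mem hs5 1
    simpa [α5] using this
  have hv : ∀ N, v N - (-u)^N • e1 ∈ Λ₅.L 5 := by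
    intro N
    induction N with
    | zero => rw [v0, pow_zero, one_smul, sub_self]; exact Λ₅.zero_mem _
    | succ N ih =>
      have hvN : v N ∈ Λ₅.L 4 := by
        have := Λ₅.add_mem _ _ _ (L_anti Λ₅ (by norm_num : (4:ℤ) ≤ 5) ih) (Λ₅.smul_mem 4 _ (T.O.pow_mem (T.O.neg_mem huO) N) _ he1)
        rwa [sub_add_cancel] at this
      have h5 : yE T n γ (v N) ∈ Λ₅.L 5 := y5 hs5 hg hγ (by norm_num) hvN
      have : v (N+1) - (-u)^(N+1) • e1 = yE T n γ (v N) + (-u) • (v N - (-u)^N • e1) := by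
        rw [vs, smul_sub, smul_smul, pow_succ', neg_smul]; abel
      rw [this]
      exact Λ₅.add_mem _ _ _ h5 (Λ₅.smul_mem _ _ (T.O.neg_mem huO) _ ih)
  let x : ℕ → (Fin 4 → F) := fun N => T.toE g⁻¹ (v N)
  have xs : ∀ N, x (N+1) = yE T n β (x N) - u • x N := by
    intro N
    have gg' : ∀ w, T.toE g⁻¹ (T.toE g w) = w := fun w => LinearMap.congr_fun (toE_inv_mul g) w
    show T.toE g⁻¹ (v (N+1)) = yE T n β (T.toE g⁻¹ (v N)) - u • T.toE g⁻¹ (v N)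
    rw [vs, hy, map_sub, gg', map_smul]
  have hx : ∀ N, T.ϖ ^ (-1:ℤ) * T.h (x N) (x N) ∈ T.O ∧ T.ϖ ^ (-2:ℤ) * T.h (x N) (x N) ∉ T.O := by
    intro N
    have : T.h (x N) (x N) = T.h (v N) (v N) := h_G g⁻¹ _ _
    rw [this]
    exact h_lam5 hf hc hs5 (T.O.pow_mem (T.O.neg_mem huO) N) (huu N) (hv N)
  obtain ⟨i0, hi0⟩ := arch_mem ha hs4 (x 0)
  have key : ∀ k : ℕ, ∃ N, x N ∈ Λ₄.L (i0 + k) := by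
    intro k
    induction k with
    | zero => exact ⟨0, by simpa using hi0⟩
    | succ k ih =>
      obtain ⟨N, hN⟩ := ih
      have e : i0 + ((k+1:ℕ):ℤ) = i0 + k + 1 := by push_cast; ring
      rw [e]
      by_cases h1 : (i0 + k) % 2 = 1
      · refine ⟨N+1, ?_⟩
        rw [xs]
        exact y_odd hs4 hg hβ h1 hN
      by_cases h2 : (i0 + k) % 6 = 0 ∨ (i0 + k) % 6 = 4
      · exact ⟨N, step0 hs4 (α4_even h2) hN⟩
      · refine ⟨N, ?_⟩
        have h3 : i0 + k = 6 * ((i0 + k)/6) + 2 := by omega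
        rw [h3] at hN
        have := (h_lam4 hf hc hs4 hN (hx N).1 (hx N).2).2
        rw [h3]
        rw [show 6 * ((i0 + (k:ℤ)) / 6) + 2 + 1 = 6 * ((i0 + (k:ℤ)) / 6) + 3 by ring]
        exact this
  obtain ⟨N, hN⟩ := key (8 - i0).toNat
  have h8 : x N ∈ Λ₄.L (6 * 1 + 2) := by
    refine L_anti Λ₄ ?_ hN
    have := Int.self_le_toNat (8 - i0)
    omega
  have := (h_lam4 hf hc hs4 h8 (hx N).1 (hx N).2).1
  omega

theorem main (T : USetting F (Fin 4 → F)) (hodd : ¬ (2 ∣ T.residueChar)) (hform : T.IsU4Form) (hunram : T.IsUnramifiedQuadratic)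
    {F₀ : Type w} [Field F₀] [Algebra F₀ F] [FiniteDimensional F₀ F] (hfix : T.FixedField F₀) (hdeg : Module.finrank F₀ F = 2)
    (ψ₀ : F₀ → ℂ) (hψ : T.IsAddCh F₀ ψ₀) (n : ℤ) (hn : 0 < n) (hn3 : Int.gcd n 3 = 1)
    (Λ₄ Λ₅ : T.LatSeq) (hΛ4 : T.IsLam4 Λ₄) (hΛ5 : T.IsLam5 Λ₅) (β γ : EE F)
    (hβ : β ∈ T.aFil Λ₄ (-(2*n)) ∩ T.Aminus) (hγ : γ ∈ T.aFil Λ₅ (-(2*n)) ∩ T.Aminus)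
    (hβf : T.IsFundamental Λ₄ (2*n) β)
    {W : Type*} [AddCommGroup W] [Module ℂ W] (π : T.GU →* Module.End ℂ W) (hsm : T.Smooth π) (hirr : T.Irred π)
    (h4 : T.ContainsChar π (T.Pset Λ₄ (n + 1)) (T.psiCh F₀ ψ₀ β))
    (h5 : T.ContainsChar π (T.Pset Λ₅ (n + 1)) (T.psiCh F₀ ψ₀ γ)) : False := by
  obtain ⟨p, q, hg⟩ := exists_good hn3
  have hs4 := std4 T hΛ4
  have hs5 := std5 T hΛ5
  have hu := u_unit hs4 hΛ4.1 hn hn3 hg hβ.1 hβf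
  have hc := hunram.1
  have h2 := two_inv T hodd
  have ha : ∀ x : F, ∃ k : ℕ, T.ϖ ^ (k:ℤ) * x ∈ T.O :=
    fun x => arch hodd hform hunram hfix hdeg hψ hn hg hs4 hβ.1 hβ.2 hu hsm h4 x
  obtain ⟨g, hgg⟩ := intertwine ha hform hc hs4 hs5 hn (by
    intro k hk
    apply ψ_tr_one hc h2.1 hfix hdeg hψ
    exact tr_mem hs4 (aFil_mul hβ.1 hk (by ring))) hirr h4 h5
  obtain ⟨X1, hX1, X2, hX2, e⟩ := lat_dual (g := g) (m := -n) (X := γ - T.toE g * β * T.toE g⁻¹) hs4 hs5 (by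
    intro Y hY5 hY4
    rw [show 1 - -n = n + 1 by ring] at hY5 hY4
    exact pair_all ha hform hc h2 hfix hdeg hψ hn hs4 hs5 hβ.1 hγ.1 hβ.2 hγ.2 hgg hY5 hY4)
  refine final ha hform hc hg hs4 hs5 (β := β + X2) (γ := γ - X1) (g := g)
    (aFil_add hβ.1 (aFil_anti hX2 (by omega))) (aFil_sub hγ.1 (aFil_anti hX1 (by omega)))
    (u_pert hs4 hn hg hβ.1 (by rwa [add_sub_cancel_left]) hu) ?_
  rw [mul_add, add_mul]
  rw [sub_eq_iff_eq_add] at e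
  rw [e]
  abel
end U17

open USetting in
/-- **Proposition 5.3.** Let `G` be the non quasi-split
unramified `U(4)` and `gcd(n, 3) = 1`, `n > 0`.  Let `[Λ₄, 2n, n, β]` and
`[Λ₅, 2n, n, γ]` be fundamental skew strata.  Then no irreducible smooth
representation of `G` contains both of them. -/
theorem statement_17
    {F : Type u} [Field F] (T : USetting F (Fin 4 → F))
    (hodd : ¬ (2 ∣ T.residueChar))
    (hform : T.IsU4Form) (hunram : T.IsUnramifiedQuadratic)
    (F₀ : Type w) [Field F₀] [Algebra F₀ F] [FiniteDimensional F₀ F]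
    (hfix : T.FixedField F₀) (hdeg : Module.finrank F₀ F = 2)
    (ψ₀ : F₀ → ℂ) (hψ : T.IsAddCh F₀ ψ₀)
    (n : ℤ) (hn : 0 < n) (hn3 : Int.gcd n 3 = 1)
    (Λ₄ Λ₅ : T.LatSeq) (hΛ4 : T.IsLam4 Λ₄) (hΛ5 : T.IsLam5 Λ₅)
    (β γ : Module.End F (Fin 4 → F))
    (hβ : β ∈ T.aFil Λ₄ (-(2*n)) ∩ T.Aminus)
    (hγ : γ ∈ T.aFil Λ₅ (-(2*n)) ∩ T.Aminus)
    (hβf : T.IsFundamental Λ₄ (2*n) β) (hγf : T.IsFundamental Λ₅ (2*n) γ)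
    (Wπ : Type*) [AddCommGroup Wπ] [Module ℂ Wπ]
    (π : T.GU →* Module.End ℂ Wπ)
    (hsm : T.Smooth π) (hirr : T.Irred π) :
    ¬ (T.ContainsChar π (T.Pset Λ₄ (n + 1)) (T.psiCh F₀ ψ₀ β) ∧
        T.ContainsChar π (T.Pset Λ₅ (n + 1)) (T.psiCh F₀ ψ₀ γ)) := by
  rintro ⟨h4, h5⟩
  exact U17.main T hodd hform hunram hfix hdeg ψ₀ hψ n hn hn3 Λ₄ Λ₅ hΛ4 hΛ5 β γ hβ hγ hβf π hsm hirr h4 h5
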